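/- arXiv:2409.07103 — 5 statements merged into one kernel-verified Lean document; each statement's English description precedes it below -/
import Mathlib

section
/- Let 1 ≤ p < ∞ and let w = (w_n)_{n≥1} be a bounded sequence of positive real numbers, so that the weighted backward shift B_w is a bounded operator on ℓ_p(ℤ₊). Then B_w is frequently hypercyclic if and only if B_w is hereditarily frequently hypercyclic. -/
open Filter Topology Set
open scoped Classical ENNReal

/-- The lower density of a set `A ⊆ ℕ`: `liminf_{N→∞} #(A ∩ [1,N]) / N`. -/
noncomputable def lowerDensity (A : Set ℕ) : ℝ :=
  Filter.atTop.liminf fun N : ℕ => (((Finset.Icc 1 N).filter (· ∈ A)).card : ℝ) / N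

/-- The visit set `N_T(x,V) = {n ∈ ℕ : Tⁿ x ∈ V}`. -/
def visitSet {X : Type*} [TopologicalSpace X] [AddCommGroup X] [Module ℝ X]
    (T : X →L[ℝ] X) (x : X) (V : Set X) : Set ℕ :=
  {n : ℕ | (T ^ n) x ∈ V}

/-- `T` is frequently hypercyclic. -/
def FrequentlyHypercyclic {X : Type*} [TopologicalSpace X] [AddCommGroup X] [Module ℝ X]
    (T : X →L[ℝ] X) : Prop :=
  ∃ x : X, ∀ V : Set X, IsOpen V → V.Nonempty → 0 < lowerDensity (visitSet T x V)

/-- `T` is hereditarily frequently hypercyclic. -/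
def HereditarilyFrequentlyHypercyclic {X : Type*} [TopologicalSpace X] [AddCommGroup X]
    [Module ℝ X] (T : X →L[ℝ] X) : Prop :=
  ∀ (I : Type) [Countable I] (V : I → Set X) (A : I → Set ℕ),
    (∀ i, IsOpen (V i)) → (∀ i, (V i).Nonempty) → (∀ i, 0 < lowerDensity (A i)) →
    ∃ x : X, ∀ i, 0 < lowerDensity (visitSet T x (V i) ∩ A i)


/-- counting function -/
noncomputable def cntF (A : Set ℕ) (N : ℕ) : ℕ := ((Finset.Icc 1 N).filter (· ∈ A)).card

lemma cntF_le (A : Set ℕ) (N : ℕ) : cntF A N ≤ N := by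
  unfold cntF
  calc _ ≤ (Finset.Icc 1 N).card := Finset.card_filter_le _ _
    _ = N := by simp

lemma cntF_div_le (A : Set ℕ) (N : ℕ) : (cntF A N : ℝ) / N ≤ 1 := by
  apply div_le_one_of_le₀ _ (by positivity)
  exact_mod_cast cntF_le A N

lemma ld_pos_iff (A : Set ℕ) :
    0 < lowerDensity A ↔ ∃ c : ℝ, 0 < c ∧ ∀ᶠ N : ℕ in atTop, c * N ≤ cntF A N := by
  have hb1 : IsBoundedUnder (· ≥ ·) atTop (fun N : ℕ => (cntF A N : ℝ) / N) :=
    isBoundedUnder_of ⟨0, fun N => by positivity⟩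
  have hb2 : IsBoundedUnder (· ≤ ·) atTop (fun N : ℕ => (cntF A N : ℝ) / N) :=
    isBoundedUnder_of ⟨1, fun N => cntF_div_le A N⟩
  change 0 < Filter.atTop.liminf (fun N : ℕ => (cntF A N : ℝ) / N) ↔ _
  constructor
  · intro h
    refine ⟨_, half_pos h, ?_⟩
    have := eventually_lt_of_lt_liminf (half_lt_self h) hb1
    filter_upwards [this, eventually_gt_atTop 0] with N hN hN0
    have : (0:ℝ) < N := by exact_mod_cast hN0
    exact ((lt_div_iff₀ this).1 hN).le
  · rintro ⟨c, hc, h⟩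
    refine lt_of_lt_of_le hc ?_
    apply le_liminf_of_le hb2.isCoboundedUnder_ge
    filter_upwards [h, eventually_gt_atTop 0] with N hN hN0
    have : (0:ℝ) < N := by exact_mod_cast hN0
    exact (le_div_iff₀ this).2 hN

lemma cntF_mono {A B : Set ℕ} (h : A ⊆ B) (N : ℕ) : cntF A N ≤ cntF B N := by
  unfold cntF
  apply Finset.card_le_card
  intro x hx
  simp only [Finset.mem_filter] at hx ⊢
  exact ⟨hx.1, h hx.2⟩

lemma ld_mono {A B : Set ℕ} (h : A ⊆ B) (hA : 0 < lowerDensity A) : 0 < lowerDensity B := by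
  rw [ld_pos_iff] at *
  obtain ⟨c, hc, h1⟩ := hA
  refine ⟨c, hc, h1.mono fun N hN => hN.trans ?_⟩
  exact_mod_cast cntF_mono h N

lemma cntF_shift_lower (A : Set ℕ) (t N : ℕ) : cntF A N ≤ cntF {n | n + t ∈ A} N + t := by
  unfold cntF
  have : (Finset.Icc 1 N).filter (· ∈ A) ⊆
      ((Finset.Icc 1 N).filter (· ∈ {n | n + t ∈ A})).image (· + t) ∪ Finset.Icc 1 t := by
    intro x hx
    simp only [Finset.mem_filter, Finset.mem_Icc, Finset.mem_union, Finset.mem_image,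
      Set.mem_ofPred_eq] at hx ⊢
    by_cases h : x ≤ t
    · right; omega
    · left
      refine ⟨x - t, ⟨by omega, ?_⟩, by omega⟩
      rw [Nat.sub_add_cancel (by omega)]; exact hx.2
  refine (Finset.card_le_card this).trans ((Finset.card_union_le _ _).trans ?_)
  refine Nat.add_le_add Finset.card_image_le ?_
  simp

lemma cntF_shift_upper (A : Set ℕ) (t N : ℕ) : cntF {n | n + t ∈ A} N ≤ cntF A N + t := by
  unfold cntF
  have : ((Finset.Icc 1 N).filter (· ∈ {n | n + t ∈ A})).image (· + t) ⊆ 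
     (Finset.Icc 1 N).filter (· ∈ A) ∪ Finset.Icc (N+1) (N + t) := by
    intro x hx
    simp only [Finset.mem_filter, Finset.mem_Icc, Finset.mem_union, Finset.mem_image,
      Set.mem_ofPred_eq] at hx ⊢
    obtain ⟨y, ⟨h1, h2⟩, rfl⟩ := hx
    by_cases h : y + t ≤ N
    · left; exact ⟨by omega, h2⟩
    · right; omega
  rw [← Finset.card_image_of_injective _ (add_left_injective t)]
  refine (Finset.card_le_card this).trans ((Finset.card_union_le _ _).trans ?_)
  gcongr
  simp

/-- the return times in `A` with gap `j`. -/
def dset (A : Set ℕ) (j : ℕ) : Set ℕ := {n | n ∈ A ∧ n + j ∈ A}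

lemma sum_cnt_le (A : Set ℕ) (F : Finset ℕ) (N : ℕ) :
    ∑ t ∈ F, cntF {n | n + t ∈ A} N ≤
      N + ∑ q ∈ F.offDiag, cntF {n | n + q.1 ∈ A ∧ n + q.2 ∈ A} N := by
  unfold cntF
  simp only [Finset.card_filter]
  rw [Finset.sum_comm, Finset.sum_comm (s := F.offDiag)]
  have : ∀ x, N + x = ∑ n ∈ Finset.Icc 1 N, 1 + x := by simp
  rw [this, ← Finset.sum_add_distrib]
  apply Finset.sum_le_sum
  intro n _
  rw [← Finset.card_filter]
  refine le_of_le_of_eq (b := 1 + (F.offDiag.filter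
    (fun q : ℕ × ℕ => n ∈ {n | n + q.1 ∈ A ∧ n + q.2 ∈ A})).card) ?_
    (by rw [Finset.card_filter]; congr!)
  have h : (F.filter (fun t => n ∈ {n | n + t ∈ A})).offDiag ⊆
     F.offDiag.filter (fun q => n ∈ {n | n + q.1 ∈ A ∧ n + q.2 ∈ A}) := by
    intro q hq
    simp only [Finset.mem_offDiag, Finset.mem_filter, Set.mem_ofPred_eq] at hq ⊢
    tauto
  have h2 := Finset.card_le_card h
  rw [Finset.offDiag_card] at h2
  set s := (F.filter (fun t => n ∈ {n | n + t ∈ A})).card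
  refine le_trans ?_ (Nat.add_le_add_left h2 1)
  rcases Nat.lt_or_ge s 2 with h3 | h3
  · omega
  · have : 2 * s ≤ s * s := Nat.mul_le_mul_right _ h3
    omega

lemma pair_cnt_le (A : Set ℕ) (t t' N : ℕ) (h : t < t') :
    cntF {n | n + t ∈ A ∧ n + t' ∈ A} N ≤ cntF (dset A (t' - t)) N + t := by
  have : {n | n + t ∈ A ∧ n + t' ∈ A} = {n | n + t ∈ dset A (t' - t)} := by
    ext n
    simp only [dset, Set.mem_ofPred_eq]
    rw [show n + t + (t' - t) = n + t' by omega]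
  rw [this]
  exact cntF_shift_upper _ _ _

lemma no_big_family (U : Ultrafilter ℕ) (hU : (U : Filter ℕ) ≤ atTop) (A : Set ℕ) (δ c : ℝ)
    (hA : ∀ᶠ N : ℕ in atTop, δ * N ≤ cntF A N) (F : Finset ℕ)
    (h1 : 4 ≤ F.card * δ) (h2 : (F.card : ℝ) ^ 2 * c ≤ 1 / 4) (hc : 0 ≤ c)
    (hF : ∀ t ∈ F, ∀ t' ∈ F, t < t' → ∀ᶠ N : ℕ in U, (cntF (dset A (t' - t)) N : ℝ) < c * N) :
    False := by
  have hF' : ∀ᶠ N : ℕ in U, ∀ t ∈ F, ∀ t' ∈ F, t < t' →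
      (cntF (dset A (t' - t)) N : ℝ) < c * N := by
    rw [Filter.eventually_all_finset]
    intro t ht
    rw [Filter.eventually_all_finset]
    intro t' ht'
    by_cases h : t < t'
    · filter_upwards [hF t ht t' ht' h] with N hN _ using hN
    · exact Eventually.of_forall fun N h' => absurd h' h
  obtain ⟨Q, hQ⟩ : ∃ Q : ℕ, ∀ t ∈ F, t ≤ Q := ⟨F.sup id, fun t ht => Finset.le_sup (f := id) ht⟩
  have hbig : ∀ᶠ N : ℕ in U, 8 * (F.card + F.card ^ 2) * Q + 1 ≤ N :=
    hU (eventually_ge_atTop _)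
  obtain ⟨N, hN1, hN2, hN3⟩ := (hF'.and (hbig.and (hU hA))).exists
  have hs := sum_cnt_le A F N
  have hl : F.card * (δ * N - Q) ≤ (∑ t ∈ F, cntF {n | n + t ∈ A} N : ℕ) := by
    push_cast
    rw [← nsmul_eq_mul]
    apply Finset.card_nsmul_le_sum
    intro t ht
    have h := cntF_shift_lower A t N
    have hq := hQ t ht
    have : (cntF A N : ℝ) ≤ cntF {n | n + t ∈ A} N + Q := by exact_mod_cast h.trans (by omega)
    linarith
  have hr : ((∑ q ∈ F.offDiag, cntF {n | n + q.1 ∈ A ∧ n + q.2 ∈ A} N : ℕ) : ℝ) ≤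
      F.card ^ 2 * (c * N + Q) := by
    push_cast
    calc _ ≤ (F.offDiag.card : ℝ) * (c * N + Q) := by
          rw [← nsmul_eq_mul]
          apply Finset.sum_le_card_nsmul
          rintro ⟨t, t'⟩ hq
          simp only [Finset.mem_offDiag] at hq
          obtain ⟨ht, ht', hne⟩ := hq
          rcases lt_or_gt_of_ne hne with h | h
          · have h3 := hN1 t ht t' ht' h
            have h4 : (cntF {n | n + t ∈ A ∧ n + t' ∈ A} N : ℝ) ≤ cntF (dset A (t' - t)) N + t := by
              exact_mod_cast pair_cnt_le A t t' N h
            have h5 : (t : ℝ) ≤ Q := by exact_mod_cast hQ t ht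
            simp only
            linarith
          · have h3 := hN1 t' ht' t ht h
            have h4 : (cntF {n | n + t' ∈ A ∧ n + t ∈ A} N : ℝ) ≤ cntF (dset A (t - t')) N + t' := by
              exact_mod_cast pair_cnt_le A t' t N h
            have h5 : (t' : ℝ) ≤ Q := by exact_mod_cast hQ t' ht'
            have h6 : {n | n + t ∈ A ∧ n + t' ∈ A} = {n | n + t' ∈ A ∧ n + t ∈ A} := by
              ext; simp [and_comm]
            simp only
            rw [h6]
            linarith
      _ ≤ _ := by
          gcongr
          rw [Finset.offDiag_card, sq]
          exact_mod_cast Nat.sub_le _ _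
  have hs' : ((∑ t ∈ F, cntF {n | n + t ∈ A} N : ℕ) : ℝ) ≤
      N + (∑ q ∈ F.offDiag, cntF {n | n + q.1 ∈ A ∧ n + q.2 ∈ A} N : ℕ) := by exact_mod_cast hs
  have hN2' : 8 * ((F.card : ℝ) + (F.card : ℝ) ^ 2) * Q + 1 ≤ N := by exact_mod_cast hN2
  have hN0 : (0 : ℝ) ≤ N := by positivity
  have e1 : 4 * (N : ℝ) ≤ F.card * δ * N := by gcongr
  have e2 : (F.card : ℝ) ^ 2 * c * N ≤ 1 / 4 * N := by gcongr
  have e3 : (0 : ℝ) ≤ ((F.card : ℝ) + (F.card : ℝ) ^ 2) * Q := by positivity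
  nlinarith

lemma exists_syndetic (U : Ultrafilter ℕ) (hU : (U : Filter ℕ) ≤ atTop) (A : Set ℕ)
    (hA : 0 < lowerDensity A) : ∃ c : ℝ, 0 < c ∧ ∃ F : Finset ℕ, ∀ s, (∀ t ∈ F, t < s) →
      ∃ t ∈ F, ∀ᶠ N : ℕ in U, c * N ≤ cntF (dset A (s - t)) N := by
  obtain ⟨δ, hδ, hA⟩ := (ld_pos_iff A).1 hA
  obtain ⟨r, hr⟩ := exists_nat_ge (4 / δ)
  have hr' : 4 ≤ r * δ := (div_le_iff₀ hδ).1 hr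
  have hr0 : (0 : ℝ) < r := by
    by_contra h
    nlinarith
  set c : ℝ := 1 / (4 * r ^ 2) with hc
  have hc0 : 0 < c := by positivity
  refine ⟨c, hc0, ?_⟩
  by_contra hcon
  push Not at hcon
  have key : ∀ m : ℕ, ∃ F : Finset ℕ, F.card = m ∧
      ∀ t ∈ F, ∀ t' ∈ F, t < t' → ∀ᶠ N : ℕ in U, (cntF (dset A (t' - t)) N : ℝ) < c * N := by
    intro m
    induction m with
    | zero => exact ⟨∅, by simp⟩
    | succ m ih =>
      obtain ⟨F, hF1, hF2⟩ := ih
      obtain ⟨s, hs1, hs2⟩ := hcon F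
      have hsF : s ∉ F := fun h => lt_irrefl _ (hs1 s h)
      refine ⟨insert s F, by rw [Finset.card_insert_of_notMem hsF, hF1], ?_⟩
      intro t ht t' ht' htt
      rw [Finset.mem_insert] at ht ht'
      rcases ht with rfl | ht
      · rcases ht' with rfl | ht'
        · exact absurd htt (lt_irrefl _)
        · exact absurd (hs1 _ ht') (by omega)
      · rcases ht' with rfl | ht'
        · have := hs2 t ht
          filter_upwards [this] with N hN using by simpa using hN
        · exact hF2 t ht t' ht' htt
  obtain ⟨F, hF1, hF2⟩ := key r
  refine no_big_family U hU A δ c hA F (by rw [hF1]; exact hr') ?_ hc0.le hF2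
  rw [hF1, hc]
  field_simp
  norm_num

lemma summable_of_diff (a : ℕ → ℝ) (ha : ∀ n, 0 ≤ a n) (K : ℝ) (hK1 : 1 ≤ K)
    (hK : ∀ n, a n ≤ K * a (n + 1)) (A : Set ℕ) (hA : 0 < lowerDensity A) (C : ℝ)
    (hC : ∀ n ∈ A, ∀ E : Finset ℕ, (∀ j ∈ E, 1 ≤ j ∧ n + j ∈ A) → ∑ j ∈ E, a j ≤ C) :
    Summable a := by
  have hU : ((hyperfilter ℕ : Ultrafilter ℕ) : Filter ℕ) ≤ atTop := Nat.hyperfilter_le_atTop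
  set U : Ultrafilter ℕ := hyperfilter ℕ
  obtain ⟨c, hc, F, hF⟩ := exists_syndetic U hU A hA
  set D : Set ℕ := {j | 1 ≤ j ∧ ∀ᶠ N : ℕ in U, c * N ≤ cntF (dset A j) N} with hD
  have hne : C ≥ 0 := by
    obtain ⟨c', hc', h⟩ := (ld_pos_iff A).1 hA
    obtain ⟨N, h1, h2⟩ := (h.and (eventually_gt_atTop 0)).exists
    have : 0 < cntF A N := by
      have : (0 : ℝ) < N := by exact_mod_cast h2
      have : (0 : ℝ) < cntF A N := lt_of_lt_of_le (by positivity) h1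
      exact_mod_cast this
    obtain ⟨n, hn⟩ := Finset.card_pos.1 this
    simp only [Finset.mem_filter] at hn
    simpa using hC n hn.2 ∅ (by simp)
  have hKp : ∀ q n, a n ≤ K ^ q * a (n + q) := by
    intro q
    induction q with
    | zero => intro n; simp
    | succ q ih =>
      intro n
      calc a n ≤ K ^ q * a (n + q) := ih n
        _ ≤ K ^ q * (K * a (n + q + 1)) := by gcongr; exact hK _
        _ = _ := by ring_nf
  have hsD : Summable (D.indicator a) := by
    apply summable_of_sum_le (c := C / c) (fun j => Set.indicator_nonneg (fun j _ => ha j) j)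
    intro E
    have hE : ∑ j ∈ E, D.indicator a j = ∑ j ∈ E.filter (· ∈ D), a j := by
      rw [Finset.sum_filter]
      exact Finset.sum_congr rfl fun j _ => Set.indicator_apply _ _ _
    rw [hE]
    set E' := E.filter (· ∈ D)
    have hE' : ∀ j ∈ E', j ∈ D := fun j hj => (Finset.mem_filter.1 hj).2
    have hev : ∀ᶠ N : ℕ in U, ∀ j ∈ E', c * N ≤ cntF (dset A j) N := by
      rw [Filter.eventually_all_finset]
      exact fun j hj => (hE' j hj).2
    obtain ⟨N, hN1, hN2⟩ := (hev.and (hU (eventually_gt_atTop 0))).exists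
    have hN0 : (0 : ℝ) < N := by exact_mod_cast hN2
    rw [le_div_iff₀ hc]
    have h1 : (∑ j ∈ E', a j) * (c * N) ≤ ∑ j ∈ E', a j * cntF (dset A j) N := by
      rw [Finset.sum_mul]
      apply Finset.sum_le_sum
      intro j hj
      exact mul_le_mul_of_nonneg_left (hN1 j hj) (ha j)
    have h2 : ∑ j ∈ E', a j * cntF (dset A j) N ≤ N * C := by
      have : ∀ j ∈ E', a j * cntF (dset A j) N =
          ∑ n ∈ Finset.Icc 1 N, if n ∈ dset A j then a j else 0 := by
        intro j _
        unfold cntF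
        rw [Finset.card_filter]
        push_cast
        rw [Finset.mul_sum]
        apply Finset.sum_congr rfl
        intro n _
        simp
      rw [Finset.sum_congr rfl this, Finset.sum_comm]
      have hcard : (N : ℝ) * C = ∑ n ∈ Finset.Icc 1 N, C := by simp
      rw [hcard]
      apply Finset.sum_le_sum
      intro n _
      rw [← Finset.sum_filter]
      by_cases hn : n ∈ A
      · apply hC n hn
        intro j hj
        rw [Finset.mem_filter] at hj
        exact ⟨(hE' j hj.1).1, hj.2.2⟩
      · rw [Finset.filter_false_of_mem (fun j _ h => hn h.1)]
        simpa using hne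
    have h3 : ((∑ j ∈ E', a j) * c) * N ≤ C * N := by
      calc _ = (∑ j ∈ E', a j) * (c * N) := by ring
        _ ≤ _ := h1.trans h2
        _ = _ := by ring
    exact le_of_mul_le_mul_right h3 hN0
  obtain ⟨Q, hQ⟩ : ∃ Q : ℕ, ∀ t ∈ F, t ≤ Q := ⟨F.sup id, fun t ht => Finset.le_sup (f := id) ht⟩
  have hsum : Summable (fun j => K ^ Q * ∑ t ∈ F, D.indicator a ((j + 1) + (Q - t))) := by
    apply Summable.mul_left
    apply summable_sum
    intro t _
    have := (summable_nat_add_iff (1 + (Q - t))).2 hsD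
    refine this.congr fun j => ?_
    rw [add_assoc]
  rw [← summable_nat_add_iff 1]
  refine Summable.of_nonneg_of_le (fun j => ha _) (fun j => ?_) hsum
  obtain ⟨t, ht, htD⟩ := hF (j + 1 + Q) (fun t ht => by have := hQ t ht; omega)
  have hq := hQ t ht
  have hmem : j + 1 + (Q - t) ∈ D := by
    refine ⟨by omega, ?_⟩
    rw [show j + 1 + (Q - t) = j + 1 + Q - t by omega]
    exact htD
  calc a (j + 1) ≤ K ^ (Q - t) * a (j + 1 + (Q - t)) := hKp _ _
    _ ≤ K ^ Q * a (j + 1 + (Q - t)) := by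
      apply mul_le_mul_of_nonneg_right _ (ha _)
      exact pow_le_pow_right₀ hK1 (by omega)
    _ = K ^ Q * D.indicator a (j + 1 + (Q - t)) := by rw [Set.indicator_of_mem hmem]
    _ ≤ _ := by
      apply mul_le_mul_of_nonneg_left _ (by positivity)
      exact Finset.single_le_sum (f := fun t => D.indicator a ((j + 1) + (Q - t)))
        (fun t _ => Set.indicator_nonneg (fun j _ => ha j) _) ht

/-- greedy `M`-separated subset of `A` -/
def greedyP (A : Set ℕ) (M : ℕ) (n : ℕ) : Prop :=
  n ∈ A ∧ M ≤ n ∧ ∀ m, (_h : m < n) → n < m + M → ¬ greedyP A M m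
termination_by n

lemma exists_greedy (A : Set ℕ) (M : ℕ) (hM : 1 ≤ M) : ∃ B : Set ℕ, B ⊆ A ∧ (∀ n ∈ B, M ≤ n) ∧
    (∀ n ∈ B, ∀ m ∈ B, n < m → n + M ≤ m) ∧
    (∀ a ∈ A, M ≤ a → ∃ b ∈ B, b ≤ a ∧ a < b + M) := by
  refine ⟨{n | greedyP A M n}, ?_, ?_, ?_, ?_⟩
  · intro n hn
    rw [Set.mem_ofPred_eq, greedyP] at hn
    exact hn.1
  · intro n hn
    rw [Set.mem_ofPred_eq, greedyP] at hn
    exact hn.2.1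
  · intro n hn m hm h
    rw [Set.mem_ofPred_eq, greedyP] at hm
    by_contra h'
    exact hm.2.2 n h (by omega) hn
  · intro a ha hMa
    by_cases h : greedyP A M a
    · exact ⟨a, h, le_rfl, by omega⟩
    · rw [greedyP] at h
      push Not at h
      obtain ⟨m, h1, h2, h3⟩ := h ha hMa
      exact ⟨m, h3, h1.le, h2⟩

lemma greedy_upper (B : Set ℕ) (M : ℕ) (h1 : ∀ n ∈ B, M ≤ n)
    (h2 : ∀ n ∈ B, ∀ m ∈ B, n < m → n + M ≤ m) (X : ℕ) : cntF B X * M ≤ X := by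
  have : cntF B X * M = (((Finset.Icc 1 X).filter (· ∈ B)) ×ˢ Finset.range M).card := by
    rw [Finset.card_product, Finset.card_range]; rfl
  rw [this]
  have hX : X = (Finset.Icc 1 X).card := by simp
  refine le_of_le_of_eq ?_ hX.symm
  apply Finset.card_le_card_of_injOn (fun q => q.1 - q.2)
  · rintro ⟨b, i⟩ hq
    simp only [Finset.coe_product, Set.mem_prod, Finset.mem_coe, Finset.mem_filter,
      Finset.mem_Icc, Finset.mem_range] at hq ⊢
    have := h1 b hq.1.2
    omega
  · rintro ⟨b, i⟩ hq ⟨b', i'⟩ hq' he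
    simp only [Finset.coe_product, Set.mem_prod, Finset.mem_coe, Finset.mem_filter,
      Finset.mem_Icc, Finset.mem_range] at hq hq' he
    have e1 := h1 b hq.1.2
    have e2 := h1 b' hq'.1.2
    have e3 := h2 b hq.1.2 b' hq'.1.2
    have e4 := h2 b' hq'.1.2 b hq.1.2
    rcases lt_trichotomy b b' with h | h | h
    · have := e3 h; omega
    · subst h
      simp only [Prod.mk.injEq, true_and]
      omega
    · have := e4 h; omega

lemma greedy_lower (A B : Set ℕ) (M : ℕ) (hM : 1 ≤ M) (h1 : ∀ n ∈ B, M ≤ n)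
    (h2 : ∀ a ∈ A, M ≤ a → ∃ b ∈ B, b ≤ a ∧ a < b + M) (X : ℕ) :
    cntF A X ≤ cntF B X * M + M := by
  unfold cntF
  have : (Finset.Icc 1 X).filter (· ∈ A) ⊆
      ((Finset.Icc 1 X).filter (· ∈ B)).biUnion (fun b => Finset.Ico b (b + M)) ∪
        Finset.Icc 1 M := by
    intro x hx
    simp only [Finset.mem_filter, Finset.mem_Icc, Finset.mem_union, Finset.mem_biUnion,
      Finset.mem_Ico] at hx ⊢
    by_cases h : x ≤ M
    · right; omega
    · left
      obtain ⟨b, hb, hb1, hb2⟩ := h2 x hx.2 (by omega)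
      have := h1 b hb
      exact ⟨b, ⟨⟨by omega, by omega⟩, hb⟩, hb1, hb2⟩
  refine (Finset.card_le_card this).trans ((Finset.card_union_le _ _).trans ?_)
  gcongr
  · exact Finset.card_biUnion_le_card_mul _ _ _ (fun b _ => by simp)
  · simp

lemma near_count (B : Set ℕ) (M R : ℕ) (hR : 2 * R + 1 ≤ M) (h1 : ∀ n ∈ B, M ≤ n)
    (h2 : ∀ n ∈ B, ∀ m ∈ B, n < m → n + M ≤ m) (X : ℕ) :
    cntF {n | ∃ m ∈ B, n ≤ m + R ∧ m ≤ n + R} X * M ≤ (2 * R + 1) * (2 * X) := by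
  have hc : cntF {n | ∃ m ∈ B, n ≤ m + R ∧ m ≤ n + R} X ≤ cntF B (X + R) * (2 * R + 1) := by
    unfold cntF
    have : (Finset.Icc 1 X).filter (· ∈ {n | ∃ m ∈ B, n ≤ m + R ∧ m ≤ n + R}) ⊆
        ((Finset.Icc 1 (X + R)).filter (· ∈ B)).biUnion (fun b => Finset.Icc (b - R) (b + R)) := by
      intro x hx
      simp only [Finset.mem_filter, Finset.mem_Icc, Finset.mem_biUnion,
        Set.mem_ofPred_eq] at hx ⊢
      obtain ⟨hx, m, hm, e1, e2⟩ := hx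
      have := h1 m hm
      exact ⟨m, ⟨⟨by omega, by omega⟩, hm⟩, by omega, by omega⟩
    refine (Finset.card_le_card this).trans ?_
    exact Finset.card_biUnion_le_card_mul _ _ _ (fun b _ => by simp; omega)
  have hu := greedy_upper B M h1 h2 (X + R)
  rcases Nat.lt_or_ge X R with h | h
  · have : cntF B (X + R) = 0 := by
      by_contra h0
      have : 1 * M ≤ cntF B (X + R) * M := Nat.mul_le_mul_right _ (Nat.pos_of_ne_zero h0)
      omega
    rw [this] at hc
    simp only [zero_mul, nonpos_iff_eq_zero] at hc
    rw [hc]; simp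
  · calc _ ≤ cntF B (X + R) * (2 * R + 1) * M := Nat.mul_le_mul_right _ hc
      _ = (2 * R + 1) * (cntF B (X + R) * M) := by ring
      _ ≤ (2 * R + 1) * (2 * X) := Nat.mul_le_mul_left _ (by omega)

lemma exists_sep (A : ℕ → Set ℕ) (hA : ∀ k, 0 < lowerDensity (A k)) (N : ℕ → ℕ)
    (hN : Monotone N) : ∃ J : ℕ → Set ℕ, (∀ k, J k ⊆ A k) ∧ (∀ k, 0 < lowerDensity (J k)) ∧
      (∀ k, ∀ n ∈ J k, N k ≤ n) ∧
      (∀ k l n m, n ∈ J k → m ∈ J l → (k ≠ l ∨ n ≠ m) →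
        n + N k + N l < m ∨ m + N k + N l < n) := by
  have hq : ∀ k, ∃ q : ℕ, 1 ≤ q ∧ ∀ᶠ X : ℕ in atTop, X ≤ q * cntF (A k) X := by
    intro k
    obtain ⟨c, hc, h⟩ := (ld_pos_iff _).1 (hA k)
    obtain ⟨q, hq⟩ := exists_nat_ge (1 / c)
    have hq' : 1 ≤ q * c := (div_le_iff₀ hc).1 hq
    refine ⟨q, ?_, ?_⟩
    · rcases Nat.eq_zero_or_pos q with h0 | h0
      · subst h0; norm_num at hq'
      · exact h0
    · filter_upwards [h] with X hX
      have hX0 : (0 : ℝ) ≤ X := by positivity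
      have hq0 : (0 : ℝ) ≤ q := by positivity
      have : (X : ℝ) ≤ q * cntF (A k) X := by nlinarith
      exact_mod_cast this
  choose q hq1 hq2 using hq
  set R : ℕ → ℕ := fun l => 2 * N l with hR
  set s : ℕ → ℕ := fun l => ∑ k ∈ Finset.range (l + 1), q k with hs
  have hsq : ∀ k l, k ≤ l → q k ≤ s l := fun k l h =>
    Finset.single_le_sum (f := q) (fun _ _ => Nat.zero_le _) (Finset.mem_range.2 (by omega))
  set K : ℕ → ℕ := fun l => (2 * R l + 1) * 2 ^ (l + 4) * s l with hK
  have hs1 : ∀ l, 1 ≤ s l := fun l => (hq1 l).trans (hsq l l le_rfl)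
  have hK1 : ∀ l, 1 ≤ K l := fun l => by
    have := hs1 l
    have h2 : 1 ≤ 2 ^ (l + 4) := Nat.one_le_two_pow
    exact Nat.mul_pos (Nat.mul_pos (by omega) h2) this
  set M : ℕ → ℕ := fun l => ∏ i ∈ Finset.range (l + 1), K i with hM
  have hMs : ∀ l, M (l + 1) = M l * K (l + 1) := fun l => Finset.prod_range_succ _ _
  have hM1 : ∀ l, 1 ≤ M l := fun l => Nat.succ_le_of_lt (Finset.prod_pos fun i _ => hK1 i)
  have hMmono : Monotone M := monotone_nat_of_le_succ fun l => by
    rw [hMs]; exact Nat.le_mul_of_pos_right _ (hK1 _)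
  have hMK : ∀ l, K l ≤ M l := fun l => by
    cases l with
    | zero => simp [hM]
    | succ l => rw [hMs]; exact Nat.le_mul_of_pos_left _ (hM1 _)
  have hMkl : ∀ k l, k < l → M k * q k * ((2 * R l + 1) * 2 ^ (l + 4)) ≤ M l := by
    intro k l hkl
    obtain ⟨l, rfl⟩ : ∃ l', l = l' + 1 := ⟨l - 1, by omega⟩
    rw [hMs]
    calc M k * q k * ((2 * R (l+1) + 1) * 2 ^ (l + 1 + 4))
        ≤ M l * s (l+1) * ((2 * R (l+1) + 1) * 2 ^ (l + 1 + 4)) := by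
          gcongr
          · exact hMmono (by omega)
          · exact hsq _ _ (by omega)
      _ = M l * K (l + 1) := by simp only [hK]; ring
  have hKR : ∀ l, 2 * R l + 1 ≤ K l ∧ 2 ^ l ≤ K l := by
    intro l
    have e1 := hs1 l
    have e2 : 2 ^ (l + 4) = 16 * 2 ^ l := by ring
    have e3 : 1 ≤ 2 ^ l := Nat.one_le_two_pow
    simp only [hK]
    constructor
    · calc 2 * R l + 1 = (2 * R l + 1) * 1 * 1 := by ring
        _ ≤ _ := by gcongr; omega
    · calc 2 ^ l = 1 * 2 ^ l * 1 := by ring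
        _ ≤ _ := by
          gcongr
          · omega
          · omega
          · omega
  have hgr := fun k => exists_greedy (A k) (M k) (hM1 k)
  choose B hB1 hB2 hB3 hB4 using hgr
  set J : ℕ → Set ℕ := fun k =>
    {n | n ∈ B k ∧ ∀ l, k < l → ∀ m ∈ B l, ¬ (n ≤ m + R l ∧ m ≤ n + R l)} with hJ
  have hNM : ∀ k, 4 * N k + 1 ≤ M k := fun k => by
    have := (hKR k).1; have := hMK k; simp only [hR] at *; omega
  refine ⟨J, fun k n hn => hB1 k hn.1, ?_, ?_, ?_⟩
  · intro k
    rw [ld_pos_iff]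
    have hMq : (0 : ℝ) < M k * q k := by
      have := hM1 k; have := hq1 k; positivity
    refine ⟨1 / (4 * (M k * q k)), by positivity, ?_⟩
    filter_upwards [hq2 k, eventually_ge_atTop (2 * (M k * q k))] with X hX1 hX2
    have hBl : (X : ℝ) ≤ 2 * (M k * q k) * cntF (B k) X := by
      have h := greedy_lower (A k) (B k) (M k) (hM1 k) (hB2 k) (hB4 k) X
      have h' : X ≤ q k * (cntF (B k) X * M k + M k) := hX1.trans (Nat.mul_le_mul_left _ h)
      have h'' : X ≤ 2 * (M k * q k) * cntF (B k) X := by nlinarith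
      exact_mod_cast h''
    set D : ℕ → Set ℕ := fun l => {n | ∃ m ∈ B l, n ≤ m + R l ∧ m ≤ n + R l} with hD
    have hcov : (Finset.Icc 1 X).filter (· ∈ B k) ⊆ (Finset.Icc 1 X).filter (· ∈ J k) ∪
        ((Finset.range (4 * X + 4)).filter (k < ·)).biUnion
          (fun l => (Finset.Icc 1 X).filter (· ∈ D l)) := by
      intro n hn
      simp only [Finset.mem_filter, Finset.mem_union, Finset.mem_biUnion, Finset.mem_range] at hn ⊢
      by_cases h : n ∈ J k
      · exact Or.inl ⟨hn.1, h⟩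
      · right
        have : ∃ l, k < l ∧ ∃ m ∈ B l, n ≤ m + R l ∧ m ≤ n + R l := by
          by_contra hcon
          apply h
          exact ⟨hn.2, fun l hl m hm hh => hcon ⟨l, hl, m, hm, hh⟩⟩
        obtain ⟨l, hl, m, hm, hh⟩ := this
        refine ⟨l, ⟨?_, hl⟩, hn.1, m, hm, hh⟩
        have e1 := hB2 l m hm
        have e2 := hMK l
        have e3 := hKR l
        have e4 : l < 2 ^ l := Nat.lt_two_pow_self
        have e5 := (Finset.mem_Icc.1 hn.1)
        omega
    have hcard : cntF (B k) X ≤ cntF (J k) X +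
        ∑ l ∈ (Finset.range (4 * X + 4)).filter (k < ·), cntF (D l) X := by
      refine (Finset.card_le_card hcov).trans ((Finset.card_union_le _ _).trans ?_)
      refine Nat.add_le_add (le_of_eq ?_)
        (Finset.card_biUnion_le.trans (Finset.sum_le_sum fun l _ => le_of_eq ?_))
      · unfold cntF; congr!
      · unfold cntF; congr!
    have hrem : ∀ l, k < l → (cntF (D l) X : ℝ) ≤ X / (8 * (M k * q k)) * (1 / 2) ^ l := by
      intro l hl
      have h := near_count (B l) (M l) (R l) ((hKR l).1.trans (hMK l)) (hB2 l) (hB3 l) X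
      have h1 : cntF (D l) X * (M k * q k * ((2 * R l + 1) * 2 ^ (l + 4))) ≤
        (2 * R l + 1) * (2 * X) := le_trans (Nat.mul_le_mul_left _ (hMkl k l hl)) h
      have h2 : (2 * R l + 1) * (cntF (D l) X * (M k * q k * 2 ^ (l + 4))) ≤
        (2 * R l + 1) * (2 * X) := by
        refine le_trans (le_of_eq ?_) h1
        ring
      have h3 := Nat.le_of_mul_le_mul_left h2 (by omega)
      have h4 : (cntF (D l) X : ℝ) * (M k * q k * 2 ^ (l + 4)) ≤ 2 * X := by exact_mod_cast h3
      have h5 : (X : ℝ) / (8 * (M k * q k)) * (1 / 2) ^ l = 2 * X / (M k * q k * 2 ^ (l + 4)) := by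
        rw [div_pow, one_pow]
        field_simp
        ring
      rw [h5, le_div_iff₀ (by positivity)]
      exact h4
    have hsum : ((∑ l ∈ (Finset.range (4 * X + 4)).filter (k < ·), cntF (D l) X : ℕ) : ℝ) ≤
        X / (4 * (M k * q k)) := by
      push_cast
      calc _ ≤ ∑ l ∈ (Finset.range (4 * X + 4)).filter (k < ·),
              (X : ℝ) / (8 * (M k * q k)) * (1 / 2) ^ l :=
            Finset.sum_le_sum fun l hl => hrem l (Finset.mem_filter.1 hl).2
        _ = (X : ℝ) / (8 * (M k * q k)) *
              ∑ l ∈ (Finset.range (4 * X + 4)).filter (k < ·), (1 / 2) ^ l := by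
            rw [Finset.mul_sum]
        _ ≤ (X : ℝ) / (8 * (M k * q k)) * 2 := by
            apply mul_le_mul_of_nonneg_left _ (by positivity)
            calc _ ≤ ∑' l : ℕ, (1 / 2 : ℝ) ^ l :=
                  Summable.sum_le_tsum _ (fun _ _ => by positivity) summable_geometric_two
              _ = 2 := tsum_geometric_two
        _ = _ := by field_simp; ring
    have hcard' : (cntF (B k) X : ℝ) ≤ cntF (J k) X +
        (∑ l ∈ (Finset.range (4 * X + 4)).filter (k < ·), cntF (D l) X : ℕ) := by
      exact_mod_cast hcard
    have hBl' : (X : ℝ) / (2 * (M k * q k)) ≤ cntF (B k) X := by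
      rw [div_le_iff₀ (by positivity)]
      linarith
    have : (X : ℝ) / (2 * (M k * q k)) - X / (4 * (M k * q k)) = 1 / (4 * (M k * q k)) * X := by
      field_simp; norm_num
    linarith
  · intro k n hn
    have := hB2 k n hn.1
    have := hNM k
    omega
  · have main : ∀ k l n m, n ∈ J k → m ∈ J l → k < l →
        n + N k + N l < m ∨ m + N k + N l < n := by
      intro k l n m hn hm hkl
      have h := hn.2 l hkl m hm.1
      have := hN hkl.le
      simp only [hR] at h
      omega
    intro k l n m hn hm hne
    rcases lt_trichotomy k l with h | h | h
    · exact main k l n m hn hm h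
    · subst h
      have hnm : n ≠ m := by tauto
      have := hNM k
      rcases lt_or_gt_of_ne hnm with h | h
      · have := hB3 k n hn.1 m hm.1 h
        left; omega
      · have := hB3 k m hm.1 n hn.1 h
        right; omega
    · have := main l k m n hm hn h
      omega

lemma exists_growth (a : ℕ → ℝ) (ha : ∀ n, 0 < a n) (hs : Summable a) :
    ∃ g : ℕ → ℝ, (∀ n, 0 ≤ g n) ∧ Tendsto g atTop atTop ∧ Summable (fun n => g n * a n) := by
  set τ : ℕ → ℝ := fun j => ∑' i, a (i + j) with hτ
  have hsj : ∀ j, Summable (fun i => a (i + j)) := fun j => (summable_nat_add_iff j).2 hs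
  have hpos : ∀ j, 0 < τ j := fun j => (hsj j).tsum_pos (fun i => (ha _).le) 0 (ha _)
  have hrec : ∀ j, τ j = a j + τ (j + 1) := by
    intro j
    simp only [hτ]
    rw [(hsj j).tsum_eq_zero_add]
    simp only [zero_add]
    congr 2
    ext i
    congr 1
    omega
  have ht : Tendsto τ atTop (𝓝 0) := tendsto_sum_nat_add a
  refine ⟨fun n => (√(τ n))⁻¹, fun n => by positivity, ?_, ?_⟩
  · apply Tendsto.inv_tendsto_nhdsGT_zero
    rw [tendsto_nhdsWithin_iff]
    refine ⟨?_, Eventually.of_forall fun n => Real.sqrt_pos.2 (hpos n)⟩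
    have := (Real.continuous_sqrt.tendsto 0).comp ht
    rw [Real.sqrt_zero] at this
    exact this
  · apply summable_of_sum_range_le (c := 2 * √(τ 0))
    · intro n
      have := (ha n).le
      positivity
    · have hstep : ∀ n, (√(τ n))⁻¹ * a n ≤ 2 * √(τ n) - 2 * √(τ (n + 1)) := by
        intro n
        have h1 := Real.sqrt_pos.2 (hpos n)
        have h2 := Real.sqrt_pos.2 (hpos (n + 1))
        have e1 := Real.sq_sqrt (hpos n).le
        have e2 := Real.sq_sqrt (hpos (n + 1)).le
        have e3 := hrec n
        rw [inv_mul_le_iff₀ h1]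
        nlinarith [sq_nonneg (√(τ n) - √(τ (n + 1)))]
      intro n
      have : ∑ i ∈ Finset.range n, (√(τ i))⁻¹ * a i ≤ 2 * √(τ 0) - 2 * √(τ n) := by
        rw [← Finset.sum_range_sub' (fun i => 2 * √(τ i))]
        exact Finset.sum_le_sum fun i _ => hstep i
      have h1 := Real.sqrt_nonneg (τ n)
      linarith

/-- product of the weights -/
noncomputable def vprod (w : ℕ → ℝ) (n : ℕ) : ℝ := ∏ i ∈ Finset.range n, w (i + 1)

lemma vprod_pos {w : ℕ → ℝ} (hw : ∀ n, 0 < w n) (n : ℕ) : 0 < vprod w n :=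
  Finset.prod_pos fun _ _ => hw _

lemma shift_pow (p : ℝ≥0∞) [Fact (1 ≤ p)] (w : ℕ → ℝ)
    (T : lp (fun _ : ℕ => ℝ) p →L[ℝ] lp (fun _ : ℕ => ℝ) p)
    (hT : ∀ (x : lp (fun _ : ℕ => ℝ) p) (n : ℕ), (T x) n = w (n + 1) * x (n + 1))
    (x : lp (fun _ : ℕ => ℝ) p) (n j : ℕ) :
    vprod w j * ((T ^ n) x) j = vprod w (j + n) * x (j + n) := by
  induction n generalizing j with
  | zero => simp
  | succ n ih =>
    have h := ih (j + 1)
    rw [pow_succ', mul_apply_eq_comp, hT, ← mul_assoc]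
    have : vprod w j * w (j + 1) = vprod w (j + 1) := (Finset.prod_range_succ _ _).symm
    rw [this, h]
    rw [show j + 1 + n = j + (n + 1) by omega]

lemma toReal_pos' (p : ℝ≥0∞) [h : Fact (1 ≤ p)] (hp : p ≠ ∞) : 0 < p.toReal :=
  ENNReal.toReal_pos (lt_of_lt_of_le zero_lt_one h.out).ne' hp

lemma summable_of_fhc
    (p : ℝ≥0∞) [Fact (1 ≤ p)] (hp : p ≠ ∞)
    (w : ℕ → ℝ) (hw : ∀ n, 0 < w n) (hwb : ∃ C : ℝ, ∀ n, w n ≤ C)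
    (T : lp (fun _ : ℕ => ℝ) p →L[ℝ] lp (fun _ : ℕ => ℝ) p)
    (hT : ∀ (x : lp (fun _ : ℕ => ℝ) p) (n : ℕ), (T x) n = w (n + 1) * x (n + 1))
    (h : FrequentlyHypercyclic T) : Summable (fun n => ((vprod w n)⁻¹) ^ p.toReal) := by
  have hP := toReal_pos' p hp
  obtain ⟨x, hx⟩ := h
  obtain ⟨C, hC⟩ := hwb
  set P := p.toReal with hPdef
  set e : lp (fun _ : ℕ => ℝ) p := lp.single p 0 1
  have hA := hx (Metric.ball e (1 / 2)) Metric.isOpen_ball ⟨e, by simp⟩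
  set A := visitSet T x (Metric.ball e (1 / 2))
  set C' := max C 1
  have hC'1 : 1 ≤ C' := le_max_right _ _
  have hv := fun n => vprod_pos hw n
  have hnorm : ∀ n ∈ A, ‖(T ^ n) x - e‖ < 1 / 2 := by
    intro n hn
    have : (T ^ n) x ∈ Metric.ball e (1 / 2) := hn
    rwa [Metric.mem_ball, dist_eq_norm] at this
  have hp0 : p ≠ 0 := fun h => by simp [hPdef, h] at hP
  have hbig : ∀ n ∈ A, 1 / 2 ≤ |vprod w n * x n| := by
    intro n hn
    have h1 := (lp.norm_apply_le_norm hp0 ((T ^ n) x - e) 0).trans (hnorm n hn).le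
    have h2 := shift_pow p w T hT x n 0
    have h3 : e 0 = 1 := lp.single_apply_self _ _ _
    rw [lp.coeFn_sub, Pi.sub_apply, h3, Real.norm_eq_abs] at h1
    simp only [vprod, Finset.range_zero, Finset.prod_empty, one_mul, zero_add] at h2
    rw [h2] at h1
    change |vprod w n * x n - 1| ≤ 1 / 2 at h1
    rw [abs_le] at h1
    exact le_trans (by linarith) (le_abs_self _)
  apply summable_of_diff _ (fun n => by have := hv n; positivity) (C' ^ P)
    (Real.one_le_rpow hC'1 hP.le) _ A hA (2 ^ P)
  · intro n hn E hE
    have hcoord : ∀ j ∈ E, (vprod w j)⁻¹ ^ P ≤ 2 ^ P * ‖((T ^ n) x - e) j‖ ^ P := by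
      intro j hj
      obtain ⟨hj1, hj2⟩ := hE j hj
      have h3 : e j = 0 := lp.single_apply_ne _ _ _ (by omega)
      rw [lp.coeFn_sub, Pi.sub_apply, h3, sub_zero, Real.norm_eq_abs,
        ← Real.mul_rpow (by norm_num) (abs_nonneg _)]
      have hvj := hv j
      apply Real.rpow_le_rpow (by positivity) _ hP.le
      have h4 := hbig _ hj2
      rw [add_comm n j, ← shift_pow p w T hT x n j, abs_mul, abs_of_pos hvj] at h4
      rw [inv_le_iff_one_le_mul₀ hvj]
      linarith
    calc _ ≤ ∑ j ∈ E, 2 ^ P * ‖((T ^ n) x - e) j‖ ^ P := Finset.sum_le_sum hcoord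
      _ = 2 ^ P * ∑ j ∈ E, ‖((T ^ n) x - e) j‖ ^ P := by rw [Finset.mul_sum]
      _ ≤ 2 ^ P * ‖(T ^ n) x - e‖ ^ P := by
        gcongr
        exact lp.sum_rpow_le_norm_rpow hP _ _
      _ ≤ 2 ^ P * 1 := by
        gcongr
        apply Real.rpow_le_one (norm_nonneg _) _ hP.le
        linarith [hnorm n hn]
      _ = _ := mul_one _
  · intro n
    have hvn := hv n
    have hvn1 := hv (n + 1)
    rw [← Real.mul_rpow (by positivity) (by positivity)]
    apply Real.rpow_le_rpow (by positivity) _ hP.le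
    have : vprod w (n + 1) = vprod w n * w (n + 1) := Finset.prod_range_succ _ _
    have hw1 := hw (n + 1)
    rw [this, mul_inv]
    rw [show C' * ((vprod w n)⁻¹ * (w (n + 1))⁻¹) = (vprod w n)⁻¹ * (C' * (w (n + 1))⁻¹) by ring]
    apply le_mul_of_one_le_right (by positivity)
    rw [← div_eq_mul_inv, one_le_div hw1]
    exact (hC _).trans (le_max_left _ _)

lemma tendsto_trunc (p : ℝ≥0∞) [Fact (1 ≤ p)] (hp : p ≠ ∞) (y : lp (fun _ : ℕ => ℝ) p) :
    Tendsto (fun d => ∑ i ∈ Finset.range d, lp.single p i (y i)) atTop (𝓝 y) :=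
  (lp.hasSum_single hp y).tendsto_sum_nat

lemma trunc_apply (p : ℝ≥0∞) [Fact (1 ≤ p)] (y : ℕ → ℝ) (d j : ℕ) :
    (∑ i ∈ Finset.range d, lp.single (E := fun _ : ℕ => ℝ) p i (y i)) j =
      if j < d then y j else 0 := by
  rw [lp.coeFn_sum, Finset.sum_apply]
  simp only [lp.coeFn_single, Finset.sum_pi_single, Finset.mem_range]

lemma exists_fin (p : ℝ≥0∞) [Fact (1 ≤ p)] (hp : p ≠ ∞) (V : Set (lp (fun _ : ℕ => ℝ) p))
    (hV : IsOpen V) (hne : V.Nonempty) : ∃ (y : lp (fun _ : ℕ => ℝ) p) (d : ℕ) (r : ℝ), 0 < r ∧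
      Metric.ball y r ⊆ V ∧ ∀ j, d ≤ j → y j = 0 := by
  obtain ⟨z, hz⟩ := hne
  obtain ⟨d, hd⟩ := ((tendsto_trunc p hp z).eventually (hV.mem_nhds hz)).exists
  obtain ⟨r, hr, hrV⟩ := Metric.isOpen_iff.1 hV _ hd
  refine ⟨_, d, r, hr, hrV, fun j hj => ?_⟩
  rw [trunc_apply, if_neg (by omega)]

lemma fhc_of_hfhc (p : ℝ≥0∞) [Fact (1 ≤ p)] (hp : p ≠ ∞)
    (T : lp (fun _ : ℕ => ℝ) p →L[ℝ] lp (fun _ : ℕ => ℝ) p)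
    (h : HereditarilyFrequentlyHypercyclic T) : FrequentlyHypercyclic T := by
  have hun : 0 < lowerDensity (Set.univ : Set ℕ) := by
    rw [ld_pos_iff]
    refine ⟨1, one_pos, Eventually.of_forall fun N => ?_⟩
    simp [cntF]
  let f : List ℚ → lp (fun _ : ℕ => ℝ) p := fun L =>
    ∑ i ∈ Finset.range L.length, lp.single p i ((L.getD i 0 : ℚ) : ℝ)
  obtain ⟨x, hx⟩ := h (List ℚ × ℕ) (fun q => Metric.ball (f q.1) (1 / (q.2 + 1)))
    (fun _ => Set.univ) (fun _ => Metric.isOpen_ball)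
    (fun q => ⟨f q.1, Metric.mem_ball_self (by positivity)⟩) (fun _ => hun)
  refine ⟨x, fun V hV hne => ?_⟩
  obtain ⟨y, d, r, hr, hrV, hy⟩ := exists_fin p hp V hV hne
  obtain ⟨m, hm⟩ := exists_nat_one_div_lt (half_pos hr)
  have hyt : y = ∑ i ∈ Finset.range d, lp.single p i (y i) := by
    ext j
    rw [trunc_apply]
    split_ifs with h
    · rfl
    · exact hy j (by omega)
  have hd0 : (0 : ℝ) < d + 1 := by positivity
  have hq : ∀ i, ∃ q : ℚ, |y i - q| < r / 2 / (d + 1) := fun i => by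
    obtain ⟨q, hq⟩ := Rat.denseRange_cast.exists_dist_lt (y i) (ε := r / 2 / (d + 1)) (by positivity)
    exact ⟨q, by rwa [Real.dist_eq] at hq⟩
  choose q hq using hq
  have hp0 : 0 < p := lt_of_lt_of_le zero_lt_one (Fact.out : 1 ≤ p)
  set L : List ℚ := (List.range d).map q
  have hfL : f L = ∑ i ∈ Finset.range d, lp.single p i ((q i : ℚ) : ℝ) := by
    simp only [f]
    rw [show L.length = d by simp [L]]
    apply Finset.sum_congr rfl
    intro i hi
    have := Finset.mem_range.1 hi
    congr 2
    simp [L, this]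
  have hdist : dist (f L) y < r / 2 := by
    rw [dist_comm, dist_eq_norm, hfL]
    conv_lhs => rw [hyt]
    rw [← Finset.sum_sub_distrib]
    calc _ ≤ ∑ i ∈ Finset.range d, ‖lp.single p i (y i) - lp.single (E := fun _ : ℕ => ℝ) p i ((q i : ℚ) : ℝ)‖ :=
          norm_sum_le _ _
      _ ≤ ∑ i ∈ Finset.range d, r / 2 / (d + 1) := by
          apply Finset.sum_le_sum
          intro i _
          rw [← lp.single_sub, lp.norm_single hp0]
          exact (hq i).le
      _ = d * (r / 2 / (d + 1)) := by simp
      _ < r / 2 := by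
          rw [← mul_div_assoc, div_lt_iff₀ hd0]
          nlinarith
  refine ld_mono ?_ (hx (L, m))
  intro n hn
  apply hrV
  have h1 : (T ^ n) x ∈ Metric.ball (f L) (1 / (m + 1)) := hn.1
  rw [Metric.mem_ball] at h1 ⊢
  linarith [dist_triangle ((T ^ n) x) (f L) y]

lemma hfhc_nat
    (p : ℝ≥0∞) [Fact (1 ≤ p)] (hp : p ≠ ∞)
    (w : ℕ → ℝ) (hw : ∀ n, 0 < w n)
    (T : lp (fun _ : ℕ => ℝ) p →L[ℝ] lp (fun _ : ℕ => ℝ) p)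
    (hT : ∀ (x : lp (fun _ : ℕ => ℝ) p) (n : ℕ), (T x) n = w (n + 1) * x (n + 1))
    (hs : Summable (fun n => ((vprod w n)⁻¹) ^ p.toReal))
    (V : ℕ → Set (lp (fun _ : ℕ => ℝ) p)) (A : ℕ → Set ℕ) (hV : ∀ i, IsOpen (V i))
    (hVne : ∀ i, (V i).Nonempty) (hA : ∀ i, 0 < lowerDensity (A i)) :
    ∃ x : lp (fun _ : ℕ => ℝ) p, ∀ i, 0 < lowerDensity (visitSet T x (V i) ∩ A i) := by
  have hP := toReal_pos' p hp
  set P := p.toReal with hPdef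
  have hv := fun n => vprod_pos hw n
  set v := vprod w with hvdef
  obtain ⟨g, hg0, hgt, hgs⟩ := exists_growth _
    (fun n => Real.rpow_pos_of_pos (inv_pos.2 (hv n)) P) hs
  set b : ℕ → ℝ := fun n => g n * (v n)⁻¹ ^ P with hb
  have hb0 : ∀ n, 0 ≤ b n := fun n =>
    mul_nonneg (hg0 n) (Real.rpow_nonneg (inv_nonneg.2 (hv n).le) _)
  have hfin := fun k => exists_fin p hp (V k) (hV k) (hVne k)
  choose y d r hr hrV hy using hfin
  have hth : ∀ k, ∃ N0 : ℕ, ∀ N, N0 ≤ N → d k ≤ N ∧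
      (∀ i, |y k i * v i| ^ P ≤ g N) ∧ ∑' i, b (i + N) < (r k / 2) ^ P := by
    intro k
    have h1 : ∀ᶠ N in atTop, d k ≤ N := eventually_ge_atTop _
    have h2 : ∀ᶠ N in atTop, ∀ i, |y k i * v i| ^ P ≤ g N := by
      have : ∀ᶠ N in atTop, ∀ i ∈ Finset.range (d k), |y k i * v i| ^ P ≤ g N := by
        rw [Filter.eventually_all_finset]
        intro i _
        exact hgt.eventually_ge_atTop _
      filter_upwards [this] with N hN i
      by_cases hi : i < d k
      · exact hN i (Finset.mem_range.2 hi)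
      · rw [hy k i (by omega), zero_mul, abs_zero, Real.zero_rpow hP.ne']
        exact hg0 N
    have h3 : ∀ᶠ N in atTop, ∑' i, b (i + N) < (r k / 2) ^ P :=
      (tendsto_sum_nat_add b).eventually
        (gt_mem_nhds (Real.rpow_pos_of_pos (half_pos (hr k)) _))
    obtain ⟨N0, hN0⟩ := eventually_atTop.1 (h1.and (h2.and h3))
    exact ⟨N0, hN0⟩
  choose N0 hN0 using hth
  set N : ℕ → ℕ := fun k => ∑ i ∈ Finset.range (k + 1), N0 i with hN
  have hNmono : Monotone N := monotone_nat_of_le_succ fun k => by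
    simp only [hN]
    rw [Finset.sum_range_succ _ (k + 1)]
    omega
  have hNN : ∀ k, N0 k ≤ N k := fun k =>
    Finset.single_le_sum (f := N0) (fun _ _ => Nat.zero_le _) (Finset.mem_range.2 (by omega))
  have hdN : ∀ k, d k ≤ N k := fun k => (hN0 k _ (hNN k)).1
  have hUg : ∀ k j i, N k ≤ j → |y k i * v i| ^ P ≤ g j := fun k j i hj =>
    (hN0 k j ((hNN k).trans hj)).2.1 i
  have hsep := exists_sep A hA N hNmono
  obtain ⟨J, hJA, hJd, hJN, hJs⟩ := hsep
  set blk : ℕ → ℕ → ℕ → Prop := fun j k n => n ∈ J k ∧ n ≤ j ∧ j < n + d k with hblk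
  have hun : ∀ j k n l m, blk j k n → blk j l m → k = l ∧ n = m := by
    intro j k n l m h1 h2
    by_contra hcon
    have h3 := hJs k l n m h1.1 h2.1 (by tauto)
    have e1 := hdN k
    have e2 := hdN l
    have e3 := h1.2
    have e4 := h2.2
    omega
  have hu : ∀ j, ∃ u : ℝ, (∀ k n, blk j k n → u = y k (j - n) * v (j - n)) ∧
      ((∀ k n, ¬ blk j k n) → u = 0) := by
    intro j
    by_cases h : ∃ k n, blk j k n
    · obtain ⟨k, n, hkn⟩ := h
      refine ⟨y k (j - n) * v (j - n), ?_, fun h => absurd hkn (h k n)⟩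
      intro l m hlm
      obtain ⟨rfl, rfl⟩ := hun j k n l m hkn hlm
      rfl
    · push Not at h
      exact ⟨0, fun k n hkn => absurd hkn (h k n), fun _ => rfl⟩
  choose u hu1 hu2 using hu
  have hmem : Memℓp (fun j => u j * (v j)⁻¹ : ℕ → ℝ) p := by
    apply memℓp_gen
    refine Summable.of_nonneg_of_le (fun j => by positivity) (fun j => ?_) hgs
    have hvj := hv j
    rw [Real.norm_eq_abs, abs_mul, abs_of_pos (inv_pos.2 hvj),
      Real.mul_rpow (abs_nonneg _) (by positivity)]
    apply mul_le_mul_of_nonneg_right _ (by positivity)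
    by_cases h : ∃ k n, blk j k n
    · obtain ⟨k, n, hkn⟩ := h
      rw [hu1 j k n hkn]
      exact hUg k j _ ((hJN k n hkn.1).trans hkn.2.1)
    · push Not at h
      rw [hu2 j h, abs_zero, Real.zero_rpow hP.ne']
      exact hg0 j
  set x : lp (fun _ : ℕ => ℝ) p := ⟨fun j => u j * (v j)⁻¹, hmem⟩ with hx
  have hxj : ∀ j, v j * x j = u j := by
    intro j
    change v j * (u j * (v j)⁻¹) = u j
    have := (hv j).ne'
    field_simp
  refine ⟨x, fun k => ld_mono ?_ (hJd k)⟩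
  intro n hn
  refine ⟨?_, hJA k hn⟩
  apply hrV k
  rw [Metric.mem_ball, dist_eq_norm]
  refine lt_of_le_of_lt ?_ (half_lt_self (hr k))
  apply lp.norm_le_of_forall_sum_le hP (half_pos (hr k)).le
  intro s
  have hz : ∀ j, ((T ^ n) x - y k) j = (u (j + n) - v j * y k j) * (v j)⁻¹ := by
    intro j
    have h1 := shift_pow p w T hT x n j
    rw [← hvdef, hxj] at h1
    rw [lp.coeFn_sub, Pi.sub_apply, ← h1]
    have := (hv j).ne'
    field_simp
  have hcoord : ∀ j, ‖((T ^ n) x - y k) j‖ ^ P ≤ if N k ≤ j then b j else 0 := by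
    intro j
    rw [hz]
    have hvj := hv j
    have hzero : (0 : ℝ) ≤ if N k ≤ j then b j else 0 := by
      split_ifs
      · exact hb0 j
      · exact le_rfl
    by_cases hj : j < d k
    · rw [hu1 (j + n) k n ⟨hn, by omega, by omega⟩, Nat.add_sub_cancel, mul_comm (v j), sub_self,
        zero_mul, norm_zero, Real.zero_rpow hP.ne']
      exact hzero
    · rw [hy k j (by omega), mul_zero, sub_zero]
      by_cases h : ∃ l m, blk (j + n) l m
      · obtain ⟨l, m, hlm⟩ := h
        have hne : k ≠ l ∨ n ≠ m := by
          by_contra hcon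
          push Not at hcon
          obtain ⟨rfl, rfl⟩ := hcon
          have := hlm.2.2
          omega
        have h3 := hJs k l n m hn hlm.1 hne
        have e1 := hdN l
        have e2 := hlm.2
        rw [if_pos (by omega), hu1 _ l m hlm, Real.norm_eq_abs, abs_mul,
          abs_of_pos (inv_pos.2 hvj), Real.mul_rpow (abs_nonneg _) (by positivity)]
        apply mul_le_mul_of_nonneg_right _ (by positivity)
        exact hUg l j _ (by omega)
      · push Not at h
        rw [hu2 _ h, zero_mul, norm_zero, Real.zero_rpow hP.ne']
        exact hzero
  have hbt : Summable (fun i => b (i + N k)) := (summable_nat_add_iff (N k)).2 hgs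
  calc ∑ j ∈ s, ‖((T ^ n) x - y k) j‖ ^ P ≤ ∑ j ∈ s, if N k ≤ j then b j else 0 :=
        Finset.sum_le_sum fun j _ => hcoord j
    _ = ∑ j ∈ s.filter (N k ≤ ·), b j := by rw [Finset.sum_filter]
    _ = ∑ i ∈ (s.filter (N k ≤ ·)).image (· - N k), b (i + N k) := by
        rw [Finset.sum_image]
        · apply Finset.sum_congr rfl
          intro j hj
          rw [Nat.sub_add_cancel (Finset.mem_filter.1 hj).2]
        · intro i hi j hj hij
          have h1 := (Finset.mem_filter.1 hi).2
          have h2 := (Finset.mem_filter.1 hj).2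
          simp only at hij
          omega
    _ ≤ ∑' i, b (i + N k) := Summable.sum_le_tsum _ (fun _ _ => hb0 _) hbt
    _ ≤ (r k / 2) ^ P := (hN0 k _ (hNN k)).2.2.le

/-- A weighted backward shift `B_w` on `ℓ_p(ℤ₊)`, `1 ≤ p < ∞`, with bounded positive weight
sequence, is frequently hypercyclic if and only if it is hereditarily frequently
hypercyclic. -/
theorem weighted_shift_lp_frequentlyHypercyclic_iff_hereditarily
    (p : ℝ≥0∞) [Fact (1 ≤ p)] (hp : p ≠ ∞)
    (w : ℕ → ℝ) (hw : ∀ n, 0 < w n) (hwb : ∃ C : ℝ, ∀ n, w n ≤ C)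
    (T : lp (fun _ : ℕ => ℝ) p →L[ℝ] lp (fun _ : ℕ => ℝ) p)
    (hT : ∀ (x : lp (fun _ : ℕ => ℝ) p) (n : ℕ), (T x) n = w (n + 1) * x (n + 1)) :
    FrequentlyHypercyclic T ↔ HereditarilyFrequentlyHypercyclic T := by
  refine ⟨fun h => ?_, fun h => fhc_of_hfhc p hp T h⟩
  have hs := summable_of_fhc p hp w hw hwb T hT h
  intro I _ V A hV hne hA
  rcases isEmpty_or_nonempty I with hI | hI
  · exact ⟨0, fun i => hI.elim i⟩
  · obtain ⟨e, he⟩ := exists_surjective_nat I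
    obtain ⟨x, hx⟩ := hfhc_nat p hp w hw T hT hs (V ∘ e) (A ∘ e) (fun i => hV _)
      (fun i => hne _) (fun i => hA _)
    refine ⟨x, fun i => ?_⟩
    obtain ⟨k, rfl⟩ := he i
    exact hx k
end

section
/- There exist two bounded sequences w = (w_n)_{n≥1} and w' = (w'_n)_{n≥1} of positive real numbers, with values in [1/2, 2], such that the weighted backward shifts B_w and B_{w'} on c₀(ℤ₊) are both frequently hypercyclic, but the direct sum B_w ⊕ B_{w'} acting on c₀(ℤ₊) × c₀(ℤ₊) is not U-frequently hypercyclic. -/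
open Filter Topology Set
open scoped Classical ZeroAtInfty

/-- The upper density of a set `A ⊆ ℕ`: `limsup_{N→∞} #(A ∩ [1,N]) / N`. -/
noncomputable def upperDensity (A : Set ℕ) : ℝ :=
  Filter.atTop.limsup fun N : ℕ => (((Finset.Icc 1 N).filter (· ∈ A)).card : ℝ) / N

/-- `T` is `U`-frequently hypercyclic. -/
def UFrequentlyHypercyclic {X : Type*} [TopologicalSpace X] [AddCommGroup X] [Module ℝ X]
    (T : X →L[ℝ] X) : Prop :=
  ∃ x : X, ∀ V : Set X, IsOpen V → V.Nonempty → 0 < upperDensity (visitSet T x V)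


namespace FHCShift

/-- Demands on the exponent function: bumps at multiples of `64^p`. -/
def Bump (l h : ℕ) : Prop := ∃ p s : ℕ, 1 ≤ s ∧ l = 64 ^ p * s ∧ h = 3 * p

/-- Demands on the exponent function: plateaus around the blocks. -/
def Plat (c l h : ℕ) : Prop :=
  ∃ k : ℕ, 62 * c * 64 ^ k ≤ l ∧ l ≤ 128 * c * 64 ^ k ∧ h = 2 * (k + 1)

def Dem (c l h : ℕ) : Prop := Bump l h ∨ Plat c l h

/-- `φ m ≥ t` witnessed by a demand. -/
def Wit (c m t : ℕ) : Prop :=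
  ∃ l h, Dem c l h ∧ t + (m - l) + (l - m) ≤ h

noncomputable def phi (c m : ℕ) : ℕ := Nat.findGreatest (Wit c m) m

lemma lin_le (p : ℕ) : 6 * p + 1 ≤ 8 ^ p := by
  induction p with
  | zero => simp
  | succ n ih => rw [pow_succ]; omega

lemma lin_le64 (p : ℕ) : 6 * p + 1 ≤ 64 ^ p :=
  (lin_le p).trans (Nat.pow_le_pow_left (by norm_num) p)

lemma dem_le {c l h : ℕ} (hc : 1 ≤ c) (H : Dem c l h) : h ≤ l := by
  rcases H with ⟨p, s, hs, rfl, rfl⟩ | ⟨k, h1, h2, rfl⟩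
  · have := lin_le64 p
    nlinarith
  · have := lin_le64 k
    nlinarith [Nat.mul_le_mul hc this]

lemma le_phi {c m t : ℕ} (hc : 1 ≤ c) (H : Wit c m t) : t ≤ phi c m := by
  apply Nat.le_findGreatest _ H
  obtain ⟨l, h, hd, hl⟩ := H
  have := dem_le hc hd
  omega

lemma phi_wit {c m : ℕ} (h : phi c m ≠ 0) : Wit c m (phi c m) :=
  Nat.findGreatest_of_ne_zero rfl h

lemma phi_le (c m : ℕ) : phi c m ≤ m := Nat.findGreatest_le m

lemma phi_succ_le {c : ℕ} (hc : 1 ≤ c) (m : ℕ) : phi c (m + 1) ≤ phi c m + 1 := by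
  by_cases h : phi c (m+1) = 0
  · omega
  obtain ⟨l, h', hd, hl⟩ := phi_wit h
  have : phi c (m+1) - 1 ≤ phi c m := le_phi hc ⟨l, h', hd, by omega⟩
  omega

lemma phi_le_succ {c : ℕ} (hc : 1 ≤ c) (m : ℕ) : phi c m ≤ phi c (m + 1) + 1 := by
  by_cases h : phi c m = 0
  · omega
  obtain ⟨l, h', hd, hl⟩ := phi_wit h
  have : phi c m - 1 ≤ phi c (m + 1) := le_phi hc ⟨l, h', hd, by omega⟩
  omega

lemma phi_bump {c : ℕ} (hc : 1 ≤ c) {p s r : ℕ} (hs : 1 ≤ s) (hr : r ≤ p) :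
    2 * p ≤ phi c (64 ^ p * s + r) :=
  le_phi hc ⟨64 ^ p * s, 3 * p, Or.inl ⟨p, s, hs, rfl, rfl⟩, by omega⟩

lemma phi_plat {c : ℕ} (hc : 1 ≤ c) {k l : ℕ} (h1 : 62 * c * 64 ^ k ≤ l)
    (h2 : l ≤ 128 * c * 64 ^ k) : 2 * (k + 1) ≤ phi c l :=
  le_phi hc ⟨l, _, Or.inr ⟨k, h1, h2, rfl⟩, by omega⟩

/-- Joint largeness forces closeness to a bump. -/
lemma joint {m t : ℕ} (ht : 1 ≤ t) (h1 : t ≤ phi 1 m) (h2 : t ≤ phi 4 m) :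
    ∃ p s : ℕ, 1 ≤ s ∧ t + (m - 64 ^ p * s) + (64 ^ p * s - m) ≤ 3 * p := by
  obtain ⟨l, h, hd, hl⟩ := phi_wit (c := 1) (m := m) (by omega)
  obtain ⟨l', h', hd', hl'⟩ := phi_wit (c := 4) (m := m) (by omega)
  rcases hd with ⟨p, s, hs, rfl, rfl⟩ | ⟨k, a1, a2, rfl⟩
  · exact ⟨p, s, hs, by omega⟩
  rcases hd' with ⟨p, s, hs, rfl, rfl⟩ | ⟨k', b1, b2, rfl⟩
  · exact ⟨p, s, hs, by omega⟩
  exfalso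
  have e1 := lin_le64 k
  have e2 := lin_le64 k'
  rcases lt_or_ge k' k with hk | hk
  · have : 64 ^ (k' + 1) ≤ 64 ^ k := Nat.pow_le_pow_right (by norm_num) hk
    rw [pow_succ] at this
    omega
  · have : 64 ^ k ≤ 64 ^ k' := Nat.pow_le_pow_right (by norm_num) hk
    omega

/-- Counting points close to bumps. -/
lemma count_joint (P N : ℕ) :
    ((((Finset.Icc 1 N).filter
      (fun m => 3 * P + 1 ≤ phi 1 m ∧ 3 * P + 1 ≤ phi 4 m)).card : ℕ) : ℝ)
      ≤ 4 * N * (1 / 8) ^ P := by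
  have hsub : (Finset.Icc 1 N).filter (fun m => 3 * P + 1 ≤ phi 1 m ∧ 3 * P + 1 ≤ phi 4 m) ⊆
      (Finset.Icc P (2 * N)).biUnion fun p => (Finset.Icc 1 (2 * N / 64 ^ p)).biUnion fun s =>
        Finset.Icc (64 ^ p * s - 3 * p) (64 ^ p * s + 3 * p) := by
    intro m hm
    simp only [Finset.mem_filter, Finset.mem_Icc, Finset.mem_biUnion] at hm ⊢
    obtain ⟨⟨hm1, hm2⟩, h1, h2⟩ := hm
    obtain ⟨p, s, hs, h⟩ := joint (by omega) h1 h2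
    have e := lin_le64 p
    have e' : 64 ^ p ≤ 64 ^ p * s := Nat.le_mul_of_pos_right _ hs
    refine ⟨p, ⟨by omega, by omega⟩, s, ⟨hs, ?_⟩, by omega, by omega⟩
    rw [Nat.le_div_iff_mul_le (by positivity), mul_comm]
    omega
  have hcard : ((Finset.Icc 1 N).filter
      (fun m => 3 * P + 1 ≤ phi 1 m ∧ 3 * P + 1 ≤ phi 4 m)).card ≤
      ∑ p ∈ Finset.Icc P (2 * N), (2 * N / 64 ^ p) * (6 * p + 1) := by
    refine (Finset.card_le_card hsub).trans (Finset.card_biUnion_le.trans ?_)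
    refine Finset.sum_le_sum fun p _ => ?_
    refine (Finset.card_biUnion_le_card_mul _ _ (6 * p + 1) fun s _ => ?_).trans (by simp)
    simp only [Nat.card_Icc]; omega
  have hgeo : ∀ M : ℕ, ∑ p ∈ Finset.Icc P M, ((1 : ℝ) / 8) ^ p ≤ 2 * (1 / 8) ^ P := by
    intro M
    have : ∑ p ∈ Finset.Icc P M, ((1 : ℝ) / 8) ^ p = ∑ p ∈ Finset.Ico P (M+1), ((1 : ℝ) / 8) ^ p :=
      rfl
    rw [this]
    refine (geom_sum_Ico_le_of_lt_one (by norm_num) (by norm_num)).trans ?_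
    rw [div_le_iff₀ (by norm_num)]
    have : (0:ℝ) ≤ (1 / 8) ^ P := by positivity
    linarith
  calc _ ≤ ((∑ p ∈ Finset.Icc P (2 * N), (2 * N / 64 ^ p) * (6 * p + 1) : ℕ) : ℝ) := by
        exact_mod_cast hcard
    _ = ∑ p ∈ Finset.Icc P (2 * N), ((2 * N / 64 ^ p : ℕ) : ℝ) * ((6 * p + 1 : ℕ) : ℝ) := by
        push_cast; rfl
    _ ≤ ∑ p ∈ Finset.Icc P (2 * N), 2 * N * ((1 : ℝ) / 8) ^ p := by
        refine Finset.sum_le_sum fun p _ => ?_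
        have h1 : ((2 * N / 64 ^ p : ℕ) : ℝ) ≤ 2 * N / 64 ^ p := by
          refine Nat.cast_div_le.trans (by push_cast; rfl)
        have h2 : ((6 * p + 1 : ℕ) : ℝ) ≤ 8 ^ p := by exact_mod_cast lin_le p
        calc _ ≤ (2 * N / 64 ^ p : ℝ) * 8 ^ p := by gcongr
          _ = _ := by
            rw [show (64 : ℝ) = 8 * 8 by norm_num, mul_pow, div_pow, one_pow]
            field_simp
    _ ≤ _ := by
        rw [← Finset.mul_sum]
        have := hgeo (2 * N)
        have hN : (0:ℝ) ≤ 2 * N := by positivity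
        nlinarith

/-- The weights. -/
noncomputable def wt (c n : ℕ) : ℝ := 2 ^ phi c n / 2 ^ phi c (n - 1)

lemma wt_pos (c n : ℕ) : 0 < wt c n := by unfold wt; positivity

lemma wt_mem {c : ℕ} (hc : 1 ≤ c) (n : ℕ) : wt c n ∈ Set.Icc (1/2 : ℝ) 2 := by
  unfold wt
  rcases n with _ | n
  · simp; norm_num
  · simp only [Nat.add_sub_cancel]
    constructor
    · rw [le_div_iff₀ (by positivity)]
      have : (2:ℝ) ^ phi c n ≤ 2 ^ (phi c (n+1) + 1) :=
        pow_le_pow_right₀ (by norm_num) (phi_le_succ hc n)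
      rw [pow_succ] at this; linarith
    · rw [div_le_iff₀ (by positivity)]
      have : (2:ℝ) ^ phi c (n+1) ≤ 2 ^ (phi c n + 1) :=
        pow_le_pow_right₀ (by norm_num) (phi_succ_le hc n)
      rw [pow_succ] at this; linarith

lemma tendsto_c0 (x : C₀(ℕ, ℝ)) : Tendsto x atTop (𝓝 0) := by
  have := x.zero_at_infty'
  rwa [cocompact_eq_cofinite, Nat.cofinite_eq_atTop] at this

noncomputable def mk0 (f : ℕ → ℝ) (h : Tendsto f atTop (𝓝 0)) : C₀(ℕ, ℝ) :=
  ⟨⟨f, continuous_of_discreteTopology⟩, by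
    rw [cocompact_eq_cofinite, Nat.cofinite_eq_atTop]; exact h⟩

@[simp] lemma mk0_apply (f : ℕ → ℝ) (h : Tendsto f atTop (𝓝 0)) (n : ℕ) : mk0 f h n = f n := rfl

lemma norm_le_c0 (x : C₀(ℕ, ℝ)) {C : ℝ} (hC : 0 ≤ C) (h : ∀ n, |x n| ≤ C) : ‖x‖ ≤ C := by
  rw [← ZeroAtInftyContinuousMap.norm_toBCF_eq_norm]
  exact (BoundedContinuousFunction.norm_le hC).2 h

lemma coord_le (x : C₀(ℕ, ℝ)) (n : ℕ) : |x n| ≤ ‖x‖ := by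
  rw [← ZeroAtInftyContinuousMap.norm_toBCF_eq_norm]
  exact x.toBCF.norm_coe_le_norm n

lemma exists_shift (w : ℕ → ℝ) (hw : ∀ n, w n ∈ Set.Icc (1/2 : ℝ) 2) :
    ∃ T : C₀(ℕ, ℝ) →L[ℝ] C₀(ℕ, ℝ), ∀ (x : C₀(ℕ, ℝ)) (n : ℕ), (T x) n = w (n + 1) * x (n + 1) := by
  have hb : ∀ (x : C₀(ℕ, ℝ)) n, |w (n+1) * x (n+1)| ≤ 2 * |x (n+1)| := by
    intro x n
    rw [abs_mul]
    gcongr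
    obtain ⟨h1, h2⟩ := hw (n+1)
    rw [abs_of_nonneg (by linarith)]; exact h2
  have ht : ∀ x : C₀(ℕ, ℝ), Tendsto (fun n => w (n+1) * x (n+1)) atTop (𝓝 0) := by
    intro x
    have h1 : Tendsto (fun n => x (n+1)) atTop (𝓝 0) :=
      (tendsto_c0 x).comp (tendsto_add_atTop_nat 1)
    refine squeeze_zero_norm (fun n => hb x n) ?_
    simpa using h1.abs.const_mul 2
  refine ⟨LinearMap.mkContinuous
    { toFun := fun x => mk0 _ (ht x)
      map_add' := ?_
      map_smul' := ?_ } 2 ?_, ?_⟩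
  · intro x y; ext n; simp [mul_add]
  · intro a x; ext n; simp; ring
  · intro x
    refine norm_le_c0 _ (by positivity) fun n => ?_
    exact (hb x n).trans (by gcongr; exact coord_le x _)
  · intro x n; rfl

lemma shift_pow {c : ℕ} {T : C₀(ℕ, ℝ) →L[ℝ] C₀(ℕ, ℝ)}
    (hT : ∀ (x : C₀(ℕ, ℝ)) (n : ℕ), (T x) n = wt c (n + 1) * x (n + 1)) (x : C₀(ℕ, ℝ)) (n i : ℕ) :
    ((T ^ n) x) i = 2 ^ phi c (n + i) / 2 ^ phi c i * x (n + i) := by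
  induction n generalizing i with
  | zero => simp
  | succ n ih =>
    rw [pow_succ', mul_apply_eq_comp, hT, ih, wt]
    rw [show n + (i + 1) = n + 1 + i by ring]
    simp only [Nat.add_sub_cancel]
    field_simp

lemma phi_zero (c : ℕ) : phi c 0 = 0 := Nat.le_zero.1 (phi_le c 0)

lemma prodMap_pow (T T' : C₀(ℕ, ℝ) →L[ℝ] C₀(ℕ, ℝ)) (z : C₀(ℕ, ℝ) × C₀(ℕ, ℝ)) (n : ℕ) :
    ((T.prodMap T') ^ n) z = ((T ^ n) z.1, (T' ^ n) z.2) := by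
  induction n with
  | zero => simp
  | succ n ih => simp [pow_succ', ih]

lemma ev_large {c : ℕ} (x : C₀(ℕ, ℝ)) (t : ℕ) :
    ∀ᶠ n in atTop, 1 / 2 < 2 ^ phi c n * x n → t ≤ phi c n := by
  have h := tendsto_c0 x
  have : ∀ᶠ n in atTop, x n < 1 / 2 / 2 ^ t := h.eventually_lt_const (by positivity)
  filter_upwards [this] with n hn h
  by_contra hlt
  push Not at hlt
  have h1 : (2:ℝ) ^ phi c n ≤ 2 ^ t := pow_le_pow_right₀ (by norm_num) hlt.le
  have h2 : (0:ℝ) < 2 ^ phi c n := by positivity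
  have h3 : (2:ℝ) ^ phi c n * x n ≤ 2 ^ phi c n * (1 / 2 / 2 ^ t) := by gcongr
  have h4 : (2:ℝ) ^ phi c n * (1 / 2 / 2 ^ t) ≤ 2 ^ t * (1 / 2 / 2 ^ t) := by gcongr
  have h5 : (2:ℝ) ^ t * (1 / 2 / 2 ^ t) = 1 / 2 := by field_simp
  linarith

lemma not_UFHC {T T' : C₀(ℕ, ℝ) →L[ℝ] C₀(ℕ, ℝ)}
    (hT : ∀ (x : C₀(ℕ, ℝ)) (n : ℕ), (T x) n = wt 1 (n + 1) * x (n + 1))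
    (hT' : ∀ (x : C₀(ℕ, ℝ)) (n : ℕ), (T' x) n = wt 4 (n + 1) * x (n + 1)) :
    ¬ UFrequentlyHypercyclic (T.prodMap T') := by
  rintro ⟨z, hz⟩
  let V : Set (C₀(ℕ, ℝ) × C₀(ℕ, ℝ)) := {u | 1 / 2 < u.1 0 ∧ 1 / 2 < u.2 0}
  have hc0 : Continuous fun u : C₀(ℕ, ℝ) => u 0 := by
    refine LipschitzWith.continuous (K := 1) (LipschitzWith.of_dist_le_mul fun u v => ?_)
    have := coord_le (u - v) 0
    rw [dist_eq_norm, dist_eq_norm]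
    simpa using this
  have hVo : IsOpen V := by
    refine (isOpen_lt continuous_const (hc0.comp continuous_fst)).inter
      (isOpen_lt continuous_const (hc0.comp continuous_snd))
  have hVn : V.Nonempty := by
    let f : ℕ → ℝ := fun n => if n = 0 then 1 else 0
    have hf : Tendsto f atTop (𝓝 0) := by
      refine tendsto_const_nhds.congr' ?_
      filter_upwards [eventually_gt_atTop 0] with n hn
      simp [f, hn.ne']
    exact ⟨(mk0 f hf, mk0 f hf), by simp [V, f]; norm_num⟩
  have hpos := hz V hVo hVn
  set E := visitSet (T.prodMap T') z V with hE
  have hev : ∀ t : ℕ, ∀ᶠ n in atTop, n ∈ E → t ≤ phi 1 n ∧ t ≤ phi 4 n := by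
    intro t
    filter_upwards [ev_large (c := 1) z.1 t, ev_large (c := 4) z.2 t] with n h1 h2 hn
    have hn' : ((T.prodMap T') ^ n) z ∈ V := hn
    rw [prodMap_pow] at hn'
    obtain ⟨g1, g2⟩ := hn'
    simp only [shift_pow hT, shift_pow hT', phi_zero, add_zero, pow_zero, div_one] at g1 g2
    exact ⟨h1 g1, h2 g2⟩
  have hle : ∀ P : ℕ, upperDensity E ≤ 5 * (1 / 8) ^ P := by
    intro P
    obtain ⟨n0, hn0⟩ := eventually_atTop.1 (hev (3 * P + 1))
    have hbig : ∀ᶠ N : ℕ in atTop, (n0 : ℝ) ≤ N * (1 / 8) ^ P := by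
      have : Tendsto (fun N : ℕ => (N : ℝ) * (1 / 8) ^ P) atTop atTop :=
        tendsto_natCast_atTop_atTop.atTop_mul_const (by positivity)
      exact this.eventually_ge_atTop _
    refine limsup_le_of_le ?_ ?_
    · refine isCoboundedUnder_le_of_le (x := 0) _ fun N => by positivity
    · filter_upwards [hbig, eventually_gt_atTop 0] with N hN hN0
      have hN' : (0:ℝ) < N := by exact_mod_cast hN0
      rw [div_le_iff₀ hN']
      have hs : (Finset.Icc 1 N).filter (· ∈ E) ⊆ Finset.range n0 ∪ (Finset.Icc 1 N).filter
          (fun m => 3 * P + 1 ≤ phi 1 m ∧ 3 * P + 1 ≤ phi 4 m) := by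
        intro m hm
        simp only [Finset.mem_filter, Finset.mem_union, Finset.mem_range] at hm ⊢
        rcases lt_or_ge m n0 with h | h
        · exact Or.inl h
        · exact Or.inr ⟨hm.1, hn0 m h hm.2⟩
      have h1 := (Finset.card_le_card hs).trans (Finset.card_union_le _ _)
      rw [Finset.card_range] at h1
      have h2 : ((((Finset.Icc 1 N).filter (· ∈ E)).card : ℕ) : ℝ) ≤ n0 +
        (((Finset.Icc 1 N).filter
          (fun m => 3 * P + 1 ≤ phi 1 m ∧ 3 * P + 1 ≤ phi 4 m)).card : ℕ) := by exact_mod_cast h1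
      have h3 := count_joint P N
      linarith
  have hlim : Tendsto (fun P : ℕ => (5:ℝ) * (1 / 8) ^ P) atTop (𝓝 0) := by
    simpa using (tendsto_pow_atTop_nhds_zero_of_lt_one (r := (1/8 : ℝ)) (by norm_num)
      (by norm_num)).const_mul 5
  have := ge_of_tendsto' hlim hle
  linarith

lemma exists_targets : ∃ Y : ℕ → ℕ → ℝ, (∀ p j, p ≤ j → Y p j = 0) ∧
    (∀ p j, |Y p j| * 2 ^ j ≤ 2 ^ p) ∧
    (∀ (v : C₀(ℕ, ℝ)) (r : ℝ), 0 < r → ∀ Q : ℕ, ∃ p, Q ≤ p ∧ ∀ j, |Y p j - v j| ≤ r) := by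
  obtain ⟨f, hf⟩ := exists_surjective_nat (ℕ →₀ ℚ)
  let good : ℕ → Prop := fun p => (∀ j, p ≤ j → f p.unpair.1 j = 0) ∧
    (∀ j, |((f p.unpair.1 j : ℚ) : ℝ)| * 2 ^ j ≤ 2 ^ p)
  refine ⟨fun p j => if good p then ((f p.unpair.1 j : ℚ) : ℝ) else 0, ?_, ?_, ?_⟩
  · intro p j h
    by_cases hg : good p
    · simp [hg, hg.1 j h]
    · simp [hg]
  · intro p j
    by_cases hg : good p
    · simpa [hg] using hg.2 j
    · simp [hg]
  · intro v r hr Q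
    have h1 : ∀ᶠ n in atTop, |v n| < r := by
      have := (tendsto_c0 v).abs
      rw [abs_zero] at this
      exact this.eventually_lt_const hr
    obtain ⟨n0, hn0⟩ := eventually_atTop.1 h1
    have h2 : ∀ j, ∃ q : ℚ, |(q : ℝ) - v j| < r := by
      intro j
      obtain ⟨q, hq1, hq2⟩ := exists_rat_btwn (show v j - r < v j + r by linarith)
      exact ⟨q, by rw [abs_lt]; constructor <;> linarith⟩
    choose q hq using h2
    let g : ℕ →₀ ℚ := Finsupp.onFinset (Finset.range n0) (fun j => if j < n0 then q j else 0)
      (by intro j hj; simp at hj ⊢; exact hj.1)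
    have hg : ∀ j, g j = if j < n0 then q j else 0 := fun j => rfl
    obtain ⟨a, ha⟩ := hf g
    have h3 : ∃ B : ℕ, ∀ j, |((g j : ℚ) : ℝ)| * 2 ^ j ≤ 2 ^ B := by
      have : ∃ C : ℝ, ∀ j ∈ Finset.range n0, |((g j : ℚ) : ℝ)| * 2 ^ j ≤ C :=
        ⟨∑ j ∈ Finset.range n0, |((g j : ℚ) : ℝ)| * 2 ^ j, fun j hj =>
          Finset.single_le_sum (f := fun j => |((g j : ℚ) : ℝ)| * 2 ^ j)
            (fun i _ => by positivity) hj⟩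
      obtain ⟨C, hC⟩ := this
      obtain ⟨B, hB⟩ := pow_unbounded_of_one_lt C (show (1:ℝ) < 2 by norm_num)
      refine ⟨B, fun j => ?_⟩
      by_cases hj : j < n0
      · exact (hC j (Finset.mem_range.2 hj)).trans hB.le
      · simp [hg, hj]
    obtain ⟨B, hB⟩ := h3
    set p := Nat.pair a (Q + n0 + B) with hp
    have hpge : Q + n0 + B ≤ p := Nat.right_le_pair _ _
    have hfp : f p.unpair.1 = g := by simp [hp, ha]
    have hgood : good p := by
      refine ⟨fun j hj => ?_, fun j => ?_⟩
      · rw [hfp, hg, if_neg (by omega)]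
      · rw [hfp]
        exact (hB j).trans (pow_le_pow_right₀ (by norm_num) (by omega))
    refine ⟨p, by omega, fun j => ?_⟩
    simp only [hgood, if_true, hfp, hg]
    by_cases hj : j < n0
    · simpa [hj] using (hq j).le
    · simpa [hj] using (hn0 j (by omega)).le

/-- The type of a block. -/
def tau (k : ℕ) : ℕ := padicValNat 2 k

lemma tau_le (k : ℕ) : tau k ≤ k := by
  rcases Nat.eq_zero_or_pos k with rfl | hk
  · simp [tau]
  · exact (Nat.lt_two_pow_self.le).trans (Nat.le_of_dvd hk pow_padicValNat_dvd)

lemma tau_synd (q K : ℕ) (hK : 2 ^ (q + 1) ≤ K) :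
    ∃ k, 1 ≤ k ∧ k ≤ K ∧ K < k + 2 ^ (q + 1) ∧ tau k = q := by
  have h2 : 0 < 2 ^ q := by positivity
  rw [pow_succ] at hK ⊢
  set j := (K - 2 ^ q) / (2 ^ q * 2) with hj
  have e1 := Nat.div_add_mod (K - 2 ^ q) (2 ^ q * 2)
  have e2 := Nat.mod_lt (K - 2 ^ q) (show 0 < 2 ^ q * 2 by omega)
  rw [← hj] at e1
  have e3 : 2 ^ q * (2 * j + 1) = 2 ^ q * 2 * j + 2 ^ q := by ring
  refine ⟨2 ^ q * (2 * j + 1), ?_, ?_, ?_, ?_⟩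
  · omega
  · omega
  · omega
  · unfold tau
    rw [padicValNat.mul (by positivity) (by omega), padicValNat.prime_pow,
      padicValNat.eq_zero_of_not_dvd (by omega), add_zero]

/-- Block index. -/
def kap (c l : ℕ) : ℕ := Nat.log 64 (l / c)

lemma kap_eq {c l k : ℕ} (hc : 1 ≤ c) (h1 : c * 64 ^ k ≤ l) (h2 : l < 2 * c * 64 ^ k) :
    kap c l = k := by
  apply Nat.log_eq_of_pow_le_of_lt_pow
  · rw [Nat.le_div_iff_mul_le hc]; linarith
  · rw [Nat.div_lt_iff_lt_mul hc, pow_succ]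
    nlinarith [Nat.zero_le (c * 64 ^ k)]

lemma le_of_kap {c l : ℕ} (hc : 1 ≤ c) (h : 1 ≤ kap c l) : c * 64 ^ kap c l ≤ l := by
  have h0 : l / c ≠ 0 := by
    intro h0; simp [kap, h0] at h
  have := Nat.pow_log_le_self 64 h0
  rw [Nat.le_div_iff_mul_le hc] at this
  unfold kap; linarith

lemma lt_kap {c l : ℕ} (hc : 1 ≤ c) : l < c * 64 ^ (kap c l + 1) := by
  have := Nat.lt_pow_succ_log_self (b := 64) (by norm_num) (l / c)
  rw [Nat.div_lt_iff_lt_mul hc, mul_comm] at this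
  exact this

/-- The frequently hypercyclic vector. -/
noncomputable def vec (Y : ℕ → ℕ → ℝ) (c l : ℕ) : ℝ :=
  if 1 ≤ kap c l ∧ l < 2 * c * 64 ^ kap c l then
    Y (tau (kap c l)) (l % 64 ^ tau (kap c l)) * 2 ^ phi c (l % 64 ^ tau (kap c l)) / 2 ^ phi c l
  else 0

lemma Y_bd {Y : ℕ → ℕ → ℝ} (hY : ∀ p j, |Y p j| * 2 ^ j ≤ 2 ^ p) (c p j : ℕ) :
    |Y p j * 2 ^ phi c j| ≤ 2 ^ p := by
  rw [abs_mul, abs_of_pos (show (0:ℝ) < 2 ^ phi c j by positivity)]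
  refine le_trans ?_ (hY p j)
  gcongr
  · norm_num
  · exact phi_le c j

lemma bd_aux {a : ℝ} {p q m : ℕ} (h : |a| ≤ 2 ^ p) (hm : p + q ≤ m) :
    |a / 2 ^ m| ≤ 1 / 2 ^ q := by
  rw [abs_div, abs_of_pos (show (0:ℝ) < 2 ^ m by positivity),
    div_le_div_iff₀ (by positivity) (by positivity), one_mul]
  calc |a| * 2 ^ q ≤ 2 ^ p * 2 ^ q := by gcongr
    _ = 2 ^ (p + q) := by rw [pow_add]
    _ ≤ 2 ^ m := pow_le_pow_right₀ (by norm_num) hm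

lemma vec_bd {Y : ℕ → ℕ → ℝ} (hY : ∀ p j, |Y p j| * 2 ^ j ≤ 2 ^ p) {c : ℕ} (hc : 1 ≤ c) (l : ℕ) :
    |vec Y c l| ≤ 1 / 2 ^ kap c l := by
  unfold vec
  split_ifs with h
  · refine bd_aux (Y_bd hY c _ _) (p := tau (kap c l)) ?_
    have h1 := le_of_kap hc h.1
    have h2 := h.2
    have ht := tau_le (kap c l)
    obtain ⟨k, hk⟩ : ∃ k, kap c l = k + 1 := ⟨kap c l - 1, by omega⟩
    rw [hk] at h1 h2 ht ⊢
    rw [pow_succ] at h1 h2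
    have := phi_plat hc (k := k) (l := l) (by nlinarith [Nat.zero_le (c * 64 ^ k)]) (by nlinarith)
    omega
  · simp

lemma vec_tendsto {Y : ℕ → ℕ → ℝ} (hY : ∀ p j, |Y p j| * 2 ^ j ≤ 2 ^ p) {c : ℕ} (hc : 1 ≤ c) :
    Tendsto (vec Y c) atTop (𝓝 0) := by
  have hk : Tendsto (kap c) atTop atTop := by
    refine tendsto_atTop.2 fun b => ?_
    filter_upwards [eventually_ge_atTop (c * 64 ^ b)] with l hl
    have := lt_kap (l := l) hc
    have h2 : 64 ^ b < 64 ^ (kap c l + 1) := lt_of_mul_lt_mul_left (hl.trans_lt this) (Nat.zero_le c)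
    have := (Nat.pow_lt_pow_iff_right (by norm_num)).1 h2
    omega
  have h0 : Tendsto (fun n : ℕ => (1:ℝ) / 2 ^ n) atTop (𝓝 0) := by
    simpa using tendsto_pow_atTop_nhds_zero_of_lt_one (r := (1/2 : ℝ)) (by norm_num) (by norm_num)
  exact squeeze_zero_norm (fun l => vec_bd hY hc l) (h0.comp hk)

/-- The main estimate. -/
lemma orbit_close {Y : ℕ → ℕ → ℝ} (hY0 : ∀ p j, p ≤ j → Y p j = 0)
    (hY : ∀ p j, |Y p j| * 2 ^ j ≤ 2 ^ p) {c : ℕ} (hc : 1 ≤ c) {n k q : ℕ} (hk : 1 ≤ k)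
    (hq : tau k = q) (h1 : c * 64 ^ k ≤ n) (h2 : n < 2 * c * 64 ^ k) (hd : 64 ^ q ∣ n) (i : ℕ) :
    |2 ^ phi c (n + i) / 2 ^ phi c i * vec Y c (n + i) - Y q i| ≤ 1 / 2 ^ q := by
  have hqk : q ≤ k := hq ▸ tau_le k
  obtain ⟨s, rfl⟩ := hd
  have hq6 := lin_le64 q
  obtain ⟨e, he⟩ : ∃ e, k = q + e := ⟨k - q, by omega⟩
  have hNk : 2 * c * 64 ^ k = 64 ^ q * (2 * c * 64 ^ e) := by rw [he, pow_add]; ring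
  have hs : s + 1 ≤ 2 * c * 64 ^ e := by
    rw [hNk] at h2
    exact lt_of_mul_lt_mul_left h2 (Nat.zero_le _)
  by_cases hi : i < 64 ^ q
  · have hl : 64 ^ q * s + i < 2 * c * 64 ^ k := by
      rw [hNk]
      calc _ < 64 ^ q * (s + 1) := by rw [mul_add]; omega
        _ ≤ _ := Nat.mul_le_mul_left _ hs
    have hkap : kap c (64 ^ q * s + i) = k := kap_eq hc (by omega) hl
    have hmod : (64 ^ q * s + i) % 64 ^ q = i := by
      rw [Nat.mul_add_mod, Nat.mod_eq_of_lt hi]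
    have : vec Y c (64 ^ q * s + i) = Y q i * 2 ^ phi c i / 2 ^ phi c (64 ^ q * s + i) := by
      unfold vec
      rw [hkap, if_pos ⟨hk, hl⟩, hq, hmod]
    rw [this]
    have h0 : (2:ℝ) ^ phi c (64 ^ q * s + i) / 2 ^ phi c i *
      (Y q i * 2 ^ phi c i / 2 ^ phi c (64 ^ q * s + i)) - Y q i = 0 := by
      field_simp; ring
    rw [h0]; simp
  · push Not at hi
    rw [hY0 q i (by omega), sub_zero]
    unfold vec
    split_ifs with hcond
    swap
    · simp
    set l := 64 ^ q * s + i with hl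
    obtain ⟨hb1, hb2⟩ := hcond
    have hb3 := le_of_kap hc hb1
    set k2 := kap c l with hk2
    set p := tau k2 with hp
    have hrw : (2:ℝ) ^ phi c l / 2 ^ phi c i *
        (Y p (l % 64 ^ p) * 2 ^ phi c (l % 64 ^ p) / 2 ^ phi c l) =
        Y p (l % 64 ^ p) * 2 ^ phi c (l % 64 ^ p) / 2 ^ phi c i := by
      field_simp
    rw [hrw]
    have hkk : k ≤ k2 := by
      by_contra hlt
      push Not at hlt
      have : 64 ^ (k2 + 1) ≤ 64 ^ k := Nat.pow_le_pow_right (by norm_num) hlt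
      have h3 := Nat.mul_le_mul_left c this
      have := lt_kap (l := l) hc
      rw [← hk2] at this
      omega
    rcases hkk.eq_or_lt with heq | hlt
    · have hpq : p = q := by rw [hp, ← heq, hq]
      rw [hpq]
      have hmod : l % 64 ^ q = i % 64 ^ q := by rw [hl, Nat.mul_add_mod]
      rw [hmod]
      by_cases hr : q ≤ i % 64 ^ q
      · rw [hY0 q _ hr]; simp
      · refine bd_aux (Y_bd hY c _ _) ?_
        have := phi_bump hc (p := q) (s := i / 64 ^ q) (r := i % 64 ^ q)
          (Nat.div_pos hi (by positivity)) (by omega)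
        rw [Nat.div_add_mod] at this
        omega
    · refine bd_aux (Y_bd hY c _ _) ?_
      have hpk : p ≤ k2 := tau_le k2
      obtain ⟨m, hm⟩ : ∃ m, k2 = m + 1 := ⟨k2 - 1, by omega⟩
      have hkm : 64 ^ k ≤ 64 ^ m := Nat.pow_le_pow_right (by norm_num) (by omega)
      rw [hm, pow_succ] at hb2 hb3
      have h3 := Nat.mul_le_mul_left c hkm
      have := phi_plat hc (k := m) (l := i) (by nlinarith) (by nlinarith)
      omega

lemma lower_pos {c q : ℕ} (hc : 1 ≤ c) {A : Set ℕ}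
    (hA : ∀ k n, 1 ≤ k → tau k = q → c * 64 ^ k ≤ n → n < 2 * c * 64 ^ k → 64 ^ q ∣ n → n ∈ A) :
    0 < lowerDensity A := by
  set L := 2 ^ (q + 1) with hL
  suffices h : (1:ℝ) / (2 * 64 ^ (L + q)) ≤ lowerDensity A from lt_of_lt_of_le (by positivity) h
  refine le_liminf_of_le ?_ ?_
  · refine isCoboundedUnder_ge_of_le (x := 1) _ fun N => ?_
    refine div_le_one_of_le₀ ?_ (by positivity)
    exact_mod_cast (Finset.card_filter_le _ _).trans (by simp)
  · filter_upwards [eventually_ge_atTop (2 * c * 64 ^ L)] with N hN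
    have hNpos : 0 < N := lt_of_lt_of_le (by positivity) hN
    rw [div_le_div_iff₀ (by positivity) (by exact_mod_cast hNpos), one_mul]
    have hc2 : 1 ≤ 2 * c := by omega
    have hK1 := lt_kap (l := N) hc2
    have hKL : L ≤ kap (2 * c) N := by
      have h2 : 64 ^ L < 64 ^ (kap (2 * c) N + 1) :=
        lt_of_mul_lt_mul_left (hN.trans_lt hK1) (Nat.zero_le _)
      have := (Nat.pow_lt_pow_iff_right (by norm_num)).1 h2
      omega
    have hLpos : 0 < L := by positivity
    have hK2 := le_of_kap hc2 (l := N) (by omega)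
    set K := kap (2 * c) N
    obtain ⟨k, hk1, hk2, hk3, hk4⟩ := tau_synd q K hKL
    have hqk : q ≤ k := hk4 ▸ tau_le k
    obtain ⟨e, he⟩ : ∃ e, k = q + e := ⟨k - q, by omega⟩
    have hpk : 64 ^ k = 64 ^ q * 64 ^ e := by rw [he, pow_add]
    have hkK : 64 ^ k ≤ 64 ^ K := Nat.pow_le_pow_right (by norm_num) hk2
    have hkK' := Nat.mul_le_mul_left (2 * c) hkK
    have hcard : c * 64 ^ e ≤ ((Finset.Icc 1 N).filter (· ∈ A)).card := by
      have : (Finset.Ico (c * 64 ^ e) (2 * c * 64 ^ e)).card = c * 64 ^ e := by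
        rw [Nat.card_Ico, mul_assoc 2 c]; omega
      rw [← this]
      refine Finset.card_le_card_of_injOn (fun s => 64 ^ q * s) ?_ ?_
      · intro s hs
        simp only [Finset.coe_Ico, Set.mem_Ico] at hs
        have g1 : c * 64 ^ k ≤ 64 ^ q * s := by
          rw [hpk]
          calc _ = 64 ^ q * (c * 64 ^ e) := by ring
            _ ≤ _ := Nat.mul_le_mul_left _ hs.1
        have g2 : 64 ^ q * s < 2 * c * 64 ^ k := by
          rw [hpk]
          calc _ < 64 ^ q * (2 * c * 64 ^ e) := Nat.mul_lt_mul_of_pos_left hs.2 (by positivity)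
            _ = _ := by ring
        have g0 : 0 < c * 64 ^ k := by positivity
        simp only [Finset.coe_filter, Finset.mem_Icc, Set.mem_ofPred_eq]
        exact ⟨⟨by omega, by omega⟩, hA k _ hk1 hk4 g1 g2 (Dvd.intro _ rfl)⟩
      · intro a _ b _ hab
        exact Nat.eq_of_mul_eq_mul_left (show 0 < 64 ^ q by positivity) hab
    have hfin : N ≤ c * 64 ^ e * (2 * 64 ^ (L + q)) := by
      calc N ≤ 2 * c * 64 ^ (K + 1) := hK1.le
        _ ≤ 2 * c * 64 ^ (k + L) :=
          Nat.mul_le_mul_left _ (Nat.pow_le_pow_right (by norm_num) (by omega))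
        _ = _ := by rw [pow_add, hpk, pow_add]; ring
    have := hfin.trans (Nat.mul_le_mul_right (2 * 64 ^ (L + q)) hcard)
    exact_mod_cast this

lemma isFHC {c : ℕ} (hc : 1 ≤ c) {T : C₀(ℕ, ℝ) →L[ℝ] C₀(ℕ, ℝ)}
    (hT : ∀ (x : C₀(ℕ, ℝ)) (n : ℕ), (T x) n = wt c (n + 1) * x (n + 1)) :
    FrequentlyHypercyclic T := by
  obtain ⟨Y, hY0, hY, hYd⟩ := exists_targets
  refine ⟨mk0 (vec Y c) (vec_tendsto hY hc), fun V hVo ⟨v, hv⟩ => ?_⟩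
  obtain ⟨r, hr, hball⟩ := Metric.isOpen_iff.1 hVo v hv
  obtain ⟨Q, hQ⟩ := exists_pow_lt_of_lt_one (show 0 < r / 4 by positivity)
    (show (1 / 2 : ℝ) < 1 by norm_num)
  obtain ⟨q, hqQ, hq⟩ := hYd v (r / 4) (by positivity) Q
  refine lower_pos (q := q) hc fun k n hk ht h1 h2 hd => ?_
  apply hball
  rw [Metric.mem_ball, dist_eq_norm]
  refine lt_of_le_of_lt (norm_le_c0 _ (C := r / 2) (by positivity) fun i => ?_) (by linarith)
  have h3 := orbit_close hY0 hY hc hk ht h1 h2 hd i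
  have h4 := hq i
  have h5 : (1:ℝ) / 2 ^ q ≤ r / 4 := by
    refine le_trans ?_ hQ.le
    rw [← one_div_pow]
    exact pow_le_pow_of_le_one (by norm_num) (by norm_num) hqQ
  rw [ZeroAtInftyContinuousMap.sub_apply, shift_pow hT, mk0_apply]
  calc _ ≤ _ := abs_sub_le _ (Y q i) _
    _ ≤ r / 2 := by linarith

end FHCShift

/-- There exist two frequently hypercyclic weighted backward shifts `B_w`, `B_{w'}` on
`c₀(ℤ₊)` (with weights in `[1/2,2]`) whose direct sum `B_w ⊕ B_{w'}` is not `U`-frequently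
hypercyclic. -/
theorem exists_frequentlyHypercyclic_shifts_sum_not_UFHC :
    ∃ (w w' : ℕ → ℝ),
      (∀ n, w n ∈ Set.Icc (1/2 : ℝ) 2) ∧ (∀ n, w' n ∈ Set.Icc (1/2 : ℝ) 2) ∧
      (∀ n, 0 < w n) ∧ (∀ n, 0 < w' n) ∧
      ∃ (T T' : C₀(ℕ, ℝ) →L[ℝ] C₀(ℕ, ℝ)),
        (∀ (x : C₀(ℕ, ℝ)) (n : ℕ), (T x) n = w (n + 1) * x (n + 1)) ∧
        (∀ (x : C₀(ℕ, ℝ)) (n : ℕ), (T' x) n = w' (n + 1) * x (n + 1)) ∧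
        FrequentlyHypercyclic T ∧ FrequentlyHypercyclic T' ∧
        ¬ UFrequentlyHypercyclic (T.prodMap T') := by
  obtain ⟨T, hT⟩ := FHCShift.exists_shift (FHCShift.wt 1) (FHCShift.wt_mem (by norm_num))
  obtain ⟨T', hT'⟩ := FHCShift.exists_shift (FHCShift.wt 4) (FHCShift.wt_mem (by norm_num))
  exact ⟨FHCShift.wt 1, FHCShift.wt 4, FHCShift.wt_mem (by norm_num), FHCShift.wt_mem (by norm_num),
    FHCShift.wt_pos 1, FHCShift.wt_pos 4, T, T', hT, hT', FHCShift.isFHC (by norm_num) hT,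
    FHCShift.isFHC (by norm_num) hT', FHCShift.not_UFHC hT hT'⟩
end

section
/- There exists a bounded sequence w = (w_n)_{n≥1} of positive real numbers such that the weighted backward shift B_w on c₀(ℤ₊) is frequently hypercyclic but not hereditarily frequently hypercyclic. -/
open Filter Topology Set
open scoped Classical ZeroAtInfty

/-- The demand relation: position `l` is required to have height at least `h`. -/
def Demand (l h : ℕ) : Prop :=
  (∃ p c : ℕ, 1 ≤ c ∧ c * 100 ^ (p + 1) ≤ l ∧ l ≤ c * 100 ^ (p + 1) + p ∧ h = 2 * p) ∨
  (∃ i : ℕ, 1 ≤ i ∧ 100 ^ i ≤ 2 * l ∧ l < 3 * 100 ^ i ∧ h = 2 * i)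

lemma lin_le_pow (i : ℕ) : 4 * i + 1 ≤ 100 ^ i := by
  induction i with
  | zero => norm_num
  | succ n ih => rw [pow_succ]; omega

lemma pow_mono_lin (j d : ℕ) : 100 ^ j + 4 * d ≤ 100 ^ (j + d) := by
  induction d with
  | zero => simp
  | succ n ih =>
    rw [← add_assoc, pow_succ]
    have : 0 < 100 ^ (j + n) := by positivity
    omega

lemma Demand.le {l h : ℕ} (H : Demand l h) : h ≤ l := by
  rcases H with ⟨p, c, hc, h1, h2, rfl⟩ | ⟨i, hi, h1, h2, rfl⟩
  · have := lin_le_pow (p + 1)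
    have : 1 * 100 ^ (p + 1) ≤ c * 100 ^ (p + 1) := Nat.mul_le_mul_right _ hc
    omega
  · have := lin_le_pow i
    omega

/-- The set of heights forced at `k`. -/
def forced (k : ℕ) : Set ℕ := {r | ∃ l h, k ≤ l ∧ Demand l h ∧ k + h = l + r}

/-- The logarithm in base two of the weight products. -/
noncomputable def uu (k : ℕ) : ℕ := sSup (forced k)

lemma forced_bdd (k : ℕ) : BddAbove (forced k) := by
  refine ⟨k, ?_⟩
  rintro r ⟨l, h, hk, hd, e⟩
  have := hd.le
  omega

lemma le_uu {k h : ℕ} (H : Demand k h) : h ≤ uu k :=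
  le_csSup (forced_bdd k) ⟨k, h, le_rfl, H, rfl⟩

lemma uu_le {k b : ℕ} (H : ∀ r ∈ forced k, r ≤ b) : uu k ≤ b := by
  rcases (forced k).eq_empty_or_nonempty with h | h
  · simp [uu, h]
  · exact csSup_le h H

lemma uu_zero : uu 0 = 0 := by
  apply Nat.le_zero.1
  apply uu_le
  rintro r ⟨l, h, hk, hd, e⟩
  have := hd.le
  omega

lemma uu_succ (k : ℕ) : uu (k + 1) ≤ uu k + 1 := by
  apply uu_le
  rintro r ⟨l, h, hk, hd, e⟩
  rcases Nat.eq_zero_or_pos r with rfl | hr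
  · omega
  · have : r - 1 ≤ uu k := le_csSup (forced_bdd k) ⟨l, h, by omega, hd, by omega⟩
    omega

/-- Positions near multiples of `100^(p+1)`. -/
def badSet (j : ℕ) : Finset ℕ :=
  (Finset.Ico 1 j).biUnion fun p =>
    ((Finset.range (2 * 100 ^ (j - p - 1) + 1)) ×ˢ (Finset.range (3 * p + 1))).image
      fun cs => cs.1 * 100 ^ (p + 1) + cs.2 - 2 * p

lemma uu_eq_zero {j k : ℕ} (hj : 1 ≤ j) (h1 : 3 * 100 ^ (j - 1) ≤ k)
    (h2 : 2 * k + 4 * j < 100 ^ j) (hb : k ∉ badSet j) : uu k = 0 := by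
  apply Nat.le_zero.1
  apply uu_le
  rintro r ⟨l, h, hk, hd, e⟩
  by_contra hr
  rcases hd with ⟨p, c, hc, h3, h4, rfl⟩ | ⟨i, hi, h3, h4, rfl⟩
  · apply hb
    have hp : 1 ≤ p := by omega
    have hc' : 1 * 100 ^ (p + 1) ≤ c * 100 ^ (p + 1) := Nat.mul_le_mul_right _ hc
    have hpj : p < j := by
      by_contra hcon
      obtain ⟨d, rfl⟩ := Nat.exists_eq_add_of_le (not_lt.1 hcon)
      have := pow_mono_lin j d
      have := pow_succ 100 (j + d)
      omega
    obtain ⟨d, rfl⟩ : ∃ d, j = p + 1 + d := Nat.exists_eq_add_of_le hpj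
    have hcle : c ≤ 2 * 100 ^ d := by
      have hpos : 0 < 100 ^ (p + 1) := by positivity
      have e1 : 100 ^ (p + 1 + d) = 100 ^ d * 100 ^ (p + 1) := by rw [pow_add, mul_comm]
      by_contra hcon
      have : (2 * 100 ^ d + 1) * 100 ^ (p + 1) ≤ c * 100 ^ (p + 1) :=
        Nat.mul_le_mul_right _ (by omega)
      have h9 := lin_le_pow (p + 1)
      rw [add_mul, mul_assoc, ← e1] at this
      omega
    simp only [badSet, Finset.mem_biUnion, Finset.mem_Ico, Finset.mem_image, Finset.mem_product,
      Finset.mem_range, Prod.exists]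
    refine ⟨p, ⟨hp, hpj⟩, c, k + 2 * p - c * 100 ^ (p + 1), ⟨?_, ?_⟩, ?_⟩
    · have : p + 1 + d - p - 1 = d := by omega
      rw [this]; omega
    · omega
    · omega
  · rcases Nat.lt_or_ge i j with hij | hij
    · have : 100 ^ i ≤ 100 ^ (j - 1) := Nat.pow_le_pow_right (by norm_num) (by omega)
      omega
    · obtain ⟨d, rfl⟩ := Nat.exists_eq_add_of_le hij
      have := pow_mono_lin j d
      omega

lemma badSet_card (j : ℕ) : ((badSet j).card : ℝ) ≤ 100 ^ j / 8 := by
  have h1 : (badSet j).card ≤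
      ∑ p ∈ Finset.Ico 1 j, (2 * 100 ^ (j - p - 1) + 1) * (3 * p + 1) := by
    refine Finset.card_biUnion_le.trans (Finset.sum_le_sum fun p _ => ?_)
    refine Finset.card_image_le.trans ?_
    simp
  have h2 : ∀ p ∈ Finset.Ico 1 j,
      (((2 * 100 ^ (j - p - 1) + 1) * (3 * p + 1) : ℕ) : ℝ) ≤ 100 ^ j / 16 * (1 / 2) ^ p := by
    intro p hp
    rw [Finset.mem_Ico] at hp
    obtain ⟨d, rfl⟩ : ∃ d, j = p + 1 + d := Nat.exists_eq_add_of_le hp.2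
    have e : p + 1 + d - p - 1 = d := by omega
    rw [e]
    have h3 : ∀ q : ℕ, 1 ≤ q → (3 * (3 * q + 1) * 16 : ℝ) ≤ 100 * 50 ^ q := by
      intro q hq
      induction q, hq using Nat.le_induction with
      | base => norm_num
      | succ n hn ih =>
        rw [pow_succ]; push_cast
        have : (1 : ℝ) ≤ n := by exact_mod_cast hn
        nlinarith
    have h4 : (100 : ℝ) ^ (p + 1 + d) / 16 * (1 / 2) ^ p = 100 * 50 ^ p / 16 * 100 ^ d := by
      have : (50 : ℝ) ^ p = 100 ^ p * (1 / 2) ^ p := by rw [← mul_pow]; norm_num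
      rw [this, pow_add, pow_succ]; ring
    rw [h4]; push_cast
    have h5 := h3 p hp.1
    have h6 : (1 : ℝ) ≤ 100 ^ d := one_le_pow₀ (by norm_num)
    have h7 : (0 : ℝ) ≤ 3 * p + 1 := by positivity
    calc (2 * (100 : ℝ) ^ d + 1) * (3 * p + 1) ≤ (3 * 100 ^ d) * (3 * p + 1) := by
          apply mul_le_mul_of_nonneg_right _ h7; linarith
      _ = (3 * (3 * p + 1) * 16) / 16 * 100 ^ d := by ring
      _ ≤ _ := by gcongr
  have h8 : ((badSet j).card : ℝ) ≤ ∑ p ∈ Finset.Ico 1 j, (100 : ℝ) ^ j / 16 * (1 / 2) ^ p := by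
    calc ((badSet j).card : ℝ) ≤
        ((∑ p ∈ Finset.Ico 1 j, (2 * 100 ^ (j - p - 1) + 1) * (3 * p + 1) : ℕ) : ℝ) := by
          exact_mod_cast h1
      _ ≤ _ := by
          rw [Nat.cast_sum]; exact Finset.sum_le_sum h2
  rw [← Finset.mul_sum] at h8
  have h9 : ∑ p ∈ Finset.Ico 1 j, ((1 : ℝ) / 2) ^ p ≤ 2 := by
    refine le_trans ?_ (sum_geometric_two_le j)
    apply Finset.sum_le_sum_of_subset_of_nonneg
    · intro a; simp
    · intros; positivity
  have : (0 : ℝ) ≤ 100 ^ j / 16 := by positivity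
  nlinarith

lemma lowerDensity_pos {A : Set ℕ} {c : ℝ} (hc : 0 < c)
    (h : ∀ᶠ N : ℕ in atTop, c * N ≤ (((Finset.Icc 1 N).filter (· ∈ A)).card : ℝ)) :
    0 < lowerDensity A := by
  refine lt_of_lt_of_le hc ?_
  unfold lowerDensity
  refine le_liminf_of_le ?_ ?_
  · refine IsCoboundedUnder.of_frequently_le (a := 1) (Eventually.frequently ?_)
    refine Eventually.of_forall fun N => ?_
    have : ((Finset.Icc 1 N).filter (· ∈ A)).card ≤ N := by
      simpa using Finset.card_filter_le (Finset.Icc 1 N) (· ∈ A)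
    exact div_le_one_of_le₀ (by exact_mod_cast this) (by positivity)
  · filter_upwards [h, eventually_gt_atTop 0] with N hN hN0
    rw [le_div_iff₀ (by exact_mod_cast hN0)]
    exact hN

lemma lowerDensity_mono {A B : Set ℕ} (h : A ⊆ B) : lowerDensity A ≤ lowerDensity B := by
  unfold lowerDensity
  refine liminf_le_liminf ?_ ?_ ?_
  · refine Eventually.of_forall fun N => ?_
    gcongr
  · exact ⟨0, by simpa using ⟨0, fun N _ => by positivity⟩⟩
  · refine IsCoboundedUnder.of_frequently_le (a := 1) (Eventually.frequently ?_)
    refine Eventually.of_forall fun N => ?_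
    have : ((Finset.Icc 1 N).filter (· ∈ B)).card ≤ N := by
      simpa using Finset.card_filter_le (Finset.Icc 1 N) (· ∈ B)
    exact div_le_one_of_le₀ (by exact_mod_cast this) (by positivity)

lemma lowerDensity_finite {A : Set ℕ} (h : A.Finite) : lowerDensity A ≤ 0 := by
  unfold lowerDensity
  have : Tendsto (fun N : ℕ => (((Finset.Icc 1 N).filter (· ∈ A)).card : ℝ) / N) atTop (𝓝 0) := by
    refine squeeze_zero (g := fun N : ℕ => (h.toFinset.card : ℝ) / N)
      (fun N => by positivity) (fun N => ?_) ?_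
    · gcongr
      intro a ha
      simp at ha ⊢
      exact ha.2
    · exact tendsto_const_div_atTop_nhds_zero_nat _
  exact this.liminf_eq.le

/-- Positions where the weight product is one. -/
def flatSet : Set ℕ := {k | uu k = 0}

lemma flat_density : 0 < lowerDensity flatSet := by
  refine lowerDensity_pos (c := 1 / 1000) (by norm_num) ?_
  filter_upwards [eventually_ge_atTop 100] with N hN
  set j := Nat.log 100 N with hjdef
  have hj1 : 100 ^ j ≤ N := Nat.pow_log_le_self 100 (by omega)
  have hj2 : N < 100 ^ (j + 1) := Nat.lt_pow_succ_log_self (by norm_num) N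
  have hj : 1 ≤ j := Nat.log_pos (by norm_num) hN
  obtain ⟨i, hi⟩ : ∃ i, j = i + 1 := ⟨j - 1, by omega⟩
  have hlin := lin_le_pow i
  have e1 : 100 ^ j = 100 ^ i * 100 := by rw [hi, pow_succ]
  have e2 : 100 ^ (j + 1) = 100 ^ j * 100 := pow_succ _ _
  have hsub : Finset.Ico (3 * 100 ^ i) (40 * 100 ^ i) \ badSet j ⊆
      (Finset.Icc 1 N).filter (· ∈ flatSet) := by
    intro k hk
    simp only [Finset.mem_sdiff, Finset.mem_Ico] at hk
    simp only [Finset.mem_filter, Finset.mem_Icc]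
    refine ⟨by omega, (uu_eq_zero hj ?_ ?_ hk.2 : uu k = 0)⟩
    · rw [hi, Nat.add_sub_cancel]; exact hk.1.1
    · omega
  have h1 := Finset.card_le_card hsub
  have h2 := Finset.le_card_sdiff (badSet j) (Finset.Ico (3 * 100 ^ i) (40 * 100 ^ i))
  rw [Nat.card_Ico] at h2
  have h3 := badSet_card j
  have h4 : 37 * 100 ^ i ≤ ((Finset.Icc 1 N).filter (· ∈ flatSet)).card
      + (badSet j).card := by omega
  have h5 : (37 * 100 ^ i : ℝ) ≤ ((Finset.Icc 1 N).filter (· ∈ flatSet)).card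
      + (badSet j).card := by exact_mod_cast h4
  have h6 : (N : ℝ) ≤ 100 ^ j * 100 := by
    have : N ≤ 100 ^ j * 100 := by omega
    exact_mod_cast this
  have h7 : (100 : ℝ) ^ j = 100 ^ i * 100 := by exact_mod_cast e1
  rw [h7] at h3 h6
  have : (0 : ℝ) < 100 ^ i := by positivity
  refine le_trans ?_ (sub_le_iff_le_add.2 h5)
  linarith

/-- The weight products. -/
noncomputable def WW (k : ℕ) : ℝ := 2 ^ uu k

lemma WW_pos (k : ℕ) : 0 < WW k := by unfold WW; positivity

lemma WW_zero : WW 0 = 1 := by simp [WW, uu_zero]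

/-- The weights. -/
noncomputable def ww (k : ℕ) : ℝ := WW k / WW (k - 1)

lemma ww_pos (k : ℕ) : 0 < ww k := div_pos (WW_pos _) (WW_pos _)

lemma ww_le (k : ℕ) : ww k ≤ 2 := by
  unfold ww
  rw [div_le_iff₀ (WW_pos _)]
  rcases k with _ | k
  · have := WW_pos 0
    simp only [Nat.zero_sub]; linarith
  · rw [Nat.add_sub_cancel]
    unfold WW
    rw [← pow_succ']
    exact pow_le_pow_right₀ (by norm_num) (uu_succ k)

lemma tendsto_c0 (x : C₀(ℕ, ℝ)) : Tendsto x atTop (𝓝 0) := by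
  have := x.zero_at_infty'
  rwa [cocompact_eq_cofinite, Nat.cofinite_eq_atTop] at this

/-- Build an element of `c₀`. -/
def mkC0 (f : ℕ → ℝ) (hf : Tendsto f atTop (𝓝 0)) : C₀(ℕ, ℝ) where
  toFun := f
  continuous_toFun := continuous_of_discreteTopology
  zero_at_infty' := by rwa [cocompact_eq_cofinite, Nat.cofinite_eq_atTop]

lemma mkC0_apply (f : ℕ → ℝ) (hf : Tendsto f atTop (𝓝 0)) (n : ℕ) : mkC0 f hf n = f n := rfl

lemma c0_norm_le (x : C₀(ℕ, ℝ)) {C : ℝ} (hC : 0 ≤ C) (h : ∀ n, |x n| ≤ C) : ‖x‖ ≤ C := by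
  rw [← ZeroAtInftyContinuousMap.norm_toBCF_eq_norm]
  exact (BoundedContinuousFunction.norm_le hC).2 h

lemma c0_le_norm (x : C₀(ℕ, ℝ)) (n : ℕ) : |x n| ≤ ‖x‖ := by
  rw [← ZeroAtInftyContinuousMap.norm_toBCF_eq_norm]
  exact x.toBCF.norm_coe_le_norm n

lemma shift_tendsto (x : C₀(ℕ, ℝ)) :
    Tendsto (fun n => ww (n + 1) * x (n + 1)) atTop (𝓝 0) := by
  have h := ((tendsto_c0 x).comp (tendsto_add_atTop_nat 1)).abs.const_mul 2
  simp only [abs_zero, mul_zero] at h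
  refine squeeze_zero_norm (fun n => ?_) h
  simp only [Real.norm_eq_abs, abs_mul, abs_of_pos (ww_pos _), Function.comp]
  exact mul_le_mul_of_nonneg_right (ww_le _) (abs_nonneg _)

/-- The weighted shift. -/
noncomputable def shiftT : C₀(ℕ, ℝ) →L[ℝ] C₀(ℕ, ℝ) :=
  LinearMap.mkContinuous
    { toFun := fun x => mkC0 (fun n => ww (n + 1) * x (n + 1)) (shift_tendsto x)
      map_add' := fun x y => by
        ext n; simp only [mkC0_apply, ZeroAtInftyContinuousMap.add_apply]; ring
      map_smul' := fun c x => by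
        ext n
        simp only [mkC0_apply, ZeroAtInftyContinuousMap.smul_apply, smul_eq_mul, RingHom.id_apply]
        ring } 2 (fun x => by
      refine c0_norm_le _ (by positivity) fun n => ?_
      change |ww (n + 1) * x (n + 1)| ≤ _
      rw [abs_mul, abs_of_pos (ww_pos _)]
      exact mul_le_mul (ww_le _) (c0_le_norm _ _) (abs_nonneg _) (by norm_num))

lemma shiftT_apply (x : C₀(ℕ, ℝ)) (n : ℕ) : shiftT x n = ww (n + 1) * x (n + 1) := rfl

lemma shiftT_pow (n : ℕ) (x : C₀(ℕ, ℝ)) (k : ℕ) :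
    (shiftT ^ n) x k = x (n + k) * WW (n + k) / WW k := by
  induction n generalizing k with
  | zero => simp [mul_div_assoc, div_self (WW_pos k).ne']
  | succ n ih =>
    rw [pow_succ', mul_apply_eq_comp, shiftT_apply, ih, ww, Nat.add_sub_cancel,
      show n + (k + 1) = n + 1 + k by ring]
    have := (WW_pos k).ne'
    have := (WW_pos (k + 1)).ne'
    field_simp

lemma not_hereditarily : ¬ HereditarilyFrequentlyHypercyclic shiftT := by
  intro H
  have hev : Continuous fun y : C₀(ℕ, ℝ) => y 0 :=
    (continuous_eval_const (F := BoundedContinuousFunction ℕ ℝ) 0).comp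
      (ZeroAtInftyContinuousMap.isometry_toBCF).continuous
  obtain ⟨x, hx⟩ := H Unit (fun _ => {y | 1 < y 0}) (fun _ => flatSet)
    (fun _ => isOpen_lt continuous_const hev)
    (fun _ => ⟨mkC0 (fun n => if n = 0 then 2 else 0) (by
        refine tendsto_const_nhds.congr' ?_
        filter_upwards [eventually_gt_atTop 0] with n hn
        rw [if_neg hn.ne']), by simp [mkC0_apply]⟩)
    (fun _ => flat_density)
  refine (hx ()).not_ge (lowerDensity_finite ?_)
  have h1 : ∀ᶠ n in atTop, x n < 1 := (tendsto_c0 x).eventually_lt_const (by norm_num)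
  obtain ⟨M, hM⟩ := eventually_atTop.1 h1
  refine (Set.finite_lt_nat M).subset ?_
  rintro n ⟨h2, h3⟩
  by_contra hn
  have h4 : 1 < (shiftT ^ n) x 0 := h2
  have h5 : WW n = 1 := by
    have : uu n = 0 := h3
    simp [WW, this]
  rw [shiftT_pow, WW_zero, add_zero, h5] at h4
  have := hM n (not_lt.1 hn)
  linarith

lemma exists_targets : ∃ v : ℕ → ℕ → ℝ, (∀ p t, p < t → v p t = 0) ∧
    (∀ p t, |v p t| * WW t ≤ 2 ^ p) ∧
    ∀ (y : C₀(ℕ, ℝ)) (ε : ℝ), 0 < ε → ∃ p, (1 / 2 : ℝ) ^ p < ε ∧ ∀ t, |v p t - y t| < ε := by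
  obtain ⟨e, he⟩ := exists_surjective_nat (ℕ →₀ ℚ)
  let good : ℕ → (ℕ →₀ ℚ) → Prop := fun p f =>
    (∀ t, p < t → f t = 0) ∧ ∀ t, |(f t : ℝ)| * WW t ≤ 2 ^ p
  refine ⟨fun p t => if good p (e p.unpair.1) then (e p.unpair.1 t : ℝ) else 0, ?_, ?_, ?_⟩
  · intro p t h
    dsimp only
    split_ifs with hg
    · rw [hg.1 t h]; simp
    · rfl
  · intro p t
    dsimp only
    split_ifs with hg
    · exact hg.2 t
    · simp
  · intro y ε hε
    obtain ⟨M, hM⟩ := eventually_atTop.1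
      ((tendsto_c0 y).abs.eventually_lt_const (by simpa using hε : |(0 : ℝ)| < ε))
    have hq : ∀ t, ∃ q : ℚ, |(q : ℝ) - y t| < ε := by
      intro t
      obtain ⟨q, h1, h2⟩ := exists_rat_btwn (show y t < y t + ε by linarith)
      exact ⟨q, by rw [abs_lt]; constructor <;> linarith⟩
    choose q hq using hq
    let f : ℕ →₀ ℚ := Finsupp.onFinset (Finset.range M) (fun t => if t < M then q t else 0)
      (by intro t ht; by_contra hc; simp at hc; simp [not_lt.2 hc] at ht)
    have hf : ∀ t, f t = if t < M then q t else 0 := fun t => rfl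
    obtain ⟨j, hj⟩ := he f
    obtain ⟨r1, hr1⟩ := exists_pow_lt_of_lt_one hε (show (1 / 2 : ℝ) < 1 by norm_num)
    obtain ⟨r2, hr2⟩ := pow_unbounded_of_one_lt
      (∑ t ∈ Finset.range M, |(q t : ℝ)| * WW t) (show (1 : ℝ) < 2 by norm_num)
    let r := r1 + r2 + M
    let p := Nat.pair j r
    have hpr : r ≤ p := Nat.right_le_pair j r
    have hep : e p.unpair.1 = f := by simp [p, hj]
    have hgood : good p f := by
      constructor
      · intro t ht
        rw [hf, if_neg]
        omega
      · intro t
        rw [hf]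
        split_ifs with ht
        · refine (Finset.single_le_sum (f := fun t => |(q t : ℝ)| * WW t)
            (fun i _ => mul_nonneg (abs_nonneg _) (WW_pos i).le) (Finset.mem_range.2 ht)).trans ?_
          exact hr2.le.trans (pow_le_pow_right₀ (by norm_num) (by omega))
        · simp
    refine ⟨p, lt_of_le_of_lt (pow_le_pow_of_le_one (by norm_num) (by norm_num) (by omega)) hr1, ?_⟩
    intro t
    dsimp only
    rw [hep, if_pos hgood, hf]
    split_ifs with ht
    · exact hq t
    · have := hM t (not_lt.1 ht)
      simpa using this

/-- The index attached to a position. -/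
noncomputable def pidx (k : ℕ) : ℕ := padicValNat 2 (Nat.log 100 k)

/-- The coordinates of the frequently hypercyclic vector. -/
noncomputable def xv (v : ℕ → ℕ → ℝ) (k : ℕ) : ℝ :=
  if 1 ≤ Nat.log 100 k ∧ k < 3 * 100 ^ Nat.log 100 k then
    v (pidx k) (k % 100 ^ (pidx k + 1)) * WW (k % 100 ^ (pidx k + 1)) / WW k else 0

lemma val_lt {i : ℕ} (hi : 1 ≤ i) : padicValNat 2 i + 1 ≤ i := by
  have h1 : 2 ^ padicValNat 2 i ≤ i := Nat.le_of_dvd hi pow_padicValNat_dvd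
  have h2 : padicValNat 2 i < 2 ^ padicValNat 2 i := Nat.lt_two_pow_self
  omega

lemma pow_log_le {k : ℕ} (hk : 1 ≤ Nat.log 100 k) : 100 ^ Nat.log 100 k ≤ k := by
  apply Nat.pow_log_le_self
  rintro rfl
  simp at hk

lemma div_WW_le {a : ℝ} {q p k : ℕ} (ha : |a| ≤ 2 ^ q) (hu : q + p ≤ uu k) :
    |a / WW k| ≤ (1 / 2) ^ p := by
  rw [abs_div, abs_of_pos (WW_pos k), div_le_iff₀ (WW_pos k)]
  refine ha.trans ?_
  have : (2 : ℝ) ^ (q + p) ≤ WW k := pow_le_pow_right₀ (by norm_num) hu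
  calc (2 : ℝ) ^ q = (1 / 2) ^ p * 2 ^ (q + p) := by
        rw [pow_add, mul_left_comm, ← mul_pow]; norm_num
    _ ≤ _ := by gcongr

lemma xv_tendsto {v : ℕ → ℕ → ℝ} (hv : ∀ p t, |v p t| * WW t ≤ 2 ^ p) :
    Tendsto (xv v) atTop (𝓝 0) := by
  have h1 : Tendsto (fun k => (1 / 2 : ℝ) ^ (Nat.log 100 k)) atTop (𝓝 0) := by
    refine (tendsto_pow_atTop_nhds_zero_of_lt_one (by norm_num) (by norm_num)).comp ?_
    refine tendsto_atTop.2 fun b => ?_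
    filter_upwards [eventually_ge_atTop (100 ^ b)] with k hk
    have := Nat.log_mono_right (b := 100) hk
    rwa [Nat.log_pow (by norm_num)] at this
  refine squeeze_zero_norm (fun k => ?_) h1
  rw [Real.norm_eq_abs]
  unfold xv
  split_ifs with h
  · refine div_WW_le (q := pidx k) ?_ ?_
    · rw [abs_mul, abs_of_pos (WW_pos _)]; exact hv _ _
    · have h2 : 2 * Nat.log 100 k ≤ uu k :=
        le_uu (Or.inr ⟨_, h.1, (pow_log_le h.1).trans (by omega), h.2, rfl⟩)
      have := val_lt h.1
      unfold pidx
      omega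
  · simp

/-- The visiting set for the index `p`. -/
def EE (p : ℕ) : Set ℕ :=
  {n | 1 ≤ Nat.log 100 n ∧ n < 2 * 100 ^ Nat.log 100 n ∧ pidx n = p ∧ 100 ^ (p + 1) ∣ n}

lemma visit_close {v : ℕ → ℕ → ℝ} (hv0 : ∀ p t, p < t → v p t = 0)
    (hv : ∀ p t, |v p t| * WW t ≤ 2 ^ p) {p n : ℕ} (hn : n ∈ EE p) (k : ℕ) :
    |xv v (n + k) * WW (n + k) / WW k - v p k| ≤ (1 / 2) ^ p := by
  obtain ⟨hn1, hn2, hn3, hn4⟩ := hn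
  set i := Nat.log 100 n with hi
  have hpi : p + 1 ≤ i := by rw [← hn3]; exact val_lt hn1
  have hlin := lin_le_pow i
  have hni := pow_log_le hn1
  rw [← hi] at hni
  by_cases hkp : k ≤ p
  · have hlog : Nat.log 100 (n + k) = i := by
      refine Nat.log_eq_of_pow_le_of_lt_pow (by omega) ?_
      rw [pow_succ]; omega
    have hpid : pidx (n + k) = p := by unfold pidx; rw [hlog]; exact hn3
    have hmod : (n + k) % 100 ^ (p + 1) = k := by
      obtain ⟨c, rfl⟩ := hn4
      rw [Nat.mul_add_mod, Nat.mod_eq_of_lt]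
      have := lin_le_pow (p + 1)
      omega
    unfold xv
    rw [if_pos (by rw [hlog]; omega), hpid, hmod]
    have := (WW_pos k).ne'
    have := (WW_pos (n + k)).ne'
    have e : v p k * WW k / WW (n + k) * WW (n + k) / WW k - v p k = 0 := by
      field_simp; ring
    rw [e]; simp
  · rw [hv0 p k (by omega), sub_zero]
    unfold xv
    split_ifs with h
    swap
    · simp
    set j := Nat.log 100 (n + k) with hj
    set q := pidx (n + k) with hq
    set t := (n + k) % 100 ^ (q + 1) with ht
    rw [div_mul_cancel₀ _ (WW_pos (n + k)).ne']
    by_cases htq : q < t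
    · rw [hv0 q t htq]; simp
    refine div_WW_le (q := q) ?_ ?_
    · rw [abs_mul, abs_of_pos (WW_pos _)]; exact hv _ _
    have hqj : q + 1 ≤ j := val_lt h.1
    have hjn := pow_log_le h.1
    rw [← hj] at hjn
    have hij : i ≤ j := Nat.log_mono_right (by omega)
    rcases hij.eq_or_lt with hij | hij
    · have hqp : q = p := by rw [← hn3, hq]; unfold pidx; rw [← hj, ← hi, hij]
      have htk : t = k % 100 ^ (p + 1) := by
        rw [ht, hqp]
        obtain ⟨c, rfl⟩ := hn4
        rw [Nat.mul_add_mod]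
      have hdm := Nat.div_add_mod' k (100 ^ (p + 1))
      rw [← htk] at hdm
      have hc : 1 ≤ k / 100 ^ (p + 1) := by
        rcases Nat.eq_zero_or_pos (k / 100 ^ (p + 1)) with hc | hc
        · rw [hc] at hdm
          omega
        · exact hc
      have : 2 * p ≤ uu k := le_uu (Or.inl ⟨p, k / 100 ^ (p + 1), hc, by omega, by omega, rfl⟩)
      omega
    · have h5 : 100 ^ (i + 1) ≤ 100 ^ j := Nat.pow_le_pow_right (by norm_num) hij
      rw [pow_succ] at h5
      have : 2 * j ≤ uu k := le_uu (Or.inr ⟨j, by omega, by omega, by omega, rfl⟩)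
      omega

lemma EE_density (p : ℕ) : 0 < lowerDensity (EE p) := by
  set D := 2 ^ (p + 1) with hD
  have hD0 : 0 < D := by positivity
  refine lowerDensity_pos (c := 1 / 100 ^ (2 * D + 2 + (p + 1))) (by positivity) ?_
  filter_upwards [eventually_ge_atTop (100 ^ (2 * D + 2))] with N hN
  have hN0 : N ≠ 0 := by
    have : 0 < 100 ^ (2 * D + 2) := by positivity
    omega
  set L := Nat.log 100 N with hL
  have hL1 : 100 ^ L ≤ N := Nat.pow_log_le_self 100 hN0
  have hL2 : N < 100 ^ (L + 1) := Nat.lt_pow_succ_log_self (by norm_num) N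
  have hL3 : 2 * D + 2 ≤ L := by
    have := Nat.log_mono_right (b := 100) hN
    rwa [Nat.log_pow (by norm_num)] at this
  -- choose the block index
  obtain ⟨i, hi1, hi2, hi3⟩ : ∃ i, i + 1 ≤ L ∧ L ≤ i + 2 * D + 1 ∧ padicValNat 2 i = p := by
    have h1 := Nat.div_add_mod (L - 1) D
    have h2 := Nat.mod_lt (L - 1) hD0
    set s := (L - 1) / D with hs
    have hs1 : 1 ≤ s := by
      rw [hs]; exact (Nat.one_le_div_iff hD0).2 (by omega)
    have hDe : D = 2 ^ p * 2 := by rw [hD, pow_succ]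
    refine ⟨2 ^ p * (2 * (s - 1) + 1), ?_, ?_, ?_⟩
    · have e : 2 ^ p * (2 * (s - 1) + 1) + 2 ^ p = D * s := by
        obtain ⟨a, ha⟩ := Nat.exists_eq_add_of_le hs1
        rw [ha, hDe, Nat.add_sub_cancel_left]; ring
      omega
    · have e : 2 ^ p * (2 * (s - 1) + 1) + 2 ^ p = D * s := by
        obtain ⟨a, ha⟩ := Nat.exists_eq_add_of_le hs1
        rw [ha, hDe, Nat.add_sub_cancel_left]; ring
      omega
    · rw [padicValNat.mul (by positivity) (by omega), padicValNat.prime_pow,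
        padicValNat.eq_zero_of_not_dvd (by omega), add_zero]
  have hi0 : 1 ≤ i := by
    omega
  have hpi : p + 1 ≤ i := by rw [← hi3]; exact val_lt hi0
  obtain ⟨d, hd⟩ := Nat.exists_eq_add_of_le hpi
  have hposp : 0 < 100 ^ (p + 1) := by positivity
  have e1 : 100 ^ i = 100 ^ (p + 1) * 100 ^ d := by rw [hd, pow_add]
  have hsub : (Finset.range (100 ^ d)).image (fun c => 100 ^ i + c * 100 ^ (p + 1)) ⊆
      (Finset.Icc 1 N).filter (· ∈ EE p) := by
    intro n hn
    simp only [Finset.mem_image, Finset.mem_range] at hn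
    obtain ⟨c, hc, rfl⟩ := hn
    have h1 : c * 100 ^ (p + 1) < 100 ^ i := by
      rw [e1, mul_comm]; exact Nat.mul_lt_mul_of_pos_left hc hposp
    have h2 : 100 ^ (i + 1) ≤ 100 ^ L := Nat.pow_le_pow_right (by norm_num) hi1
    rw [pow_succ] at h2
    have hlog : Nat.log 100 (100 ^ i + c * 100 ^ (p + 1)) = i := by
      refine Nat.log_eq_of_pow_le_of_lt_pow (by omega) ?_
      rw [pow_succ 100 i]; omega
    rw [Finset.mem_filter, Finset.mem_Icc]
    refine ⟨by omega, ?_, ?_, ?_, ?_⟩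
    · rw [hlog]; exact hi0
    · rw [hlog]; omega
    · unfold pidx; rw [hlog]; exact hi3
    · exact dvd_add (by rw [e1]; exact dvd_mul_right _ _) (dvd_mul_left _ _)
  have hcard := Finset.card_le_card hsub
  rw [Finset.card_image_of_injective _ (by
    intro a b hab
    have hab' : a * 100 ^ (p + 1) = b * 100 ^ (p + 1) := by
      simpa using hab
    exact Nat.eq_of_mul_eq_mul_right hposp hab'), Finset.card_range] at hcard
  have hcard' : (100 : ℝ) ^ d ≤ (((Finset.Icc 1 N).filter (· ∈ EE p)).card : ℝ) := by
    exact_mod_cast hcard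
  refine le_trans ?_ hcard'
  rw [div_mul_eq_mul_div, one_mul, div_le_iff₀ (by positivity), ← pow_add]
  have : N ≤ 100 ^ (d + (2 * D + 2 + (p + 1))) :=
    hL2.le.trans (Nat.pow_le_pow_right (by norm_num) (by omega))
  exact_mod_cast this

lemma shift_fhc : FrequentlyHypercyclic shiftT := by
  obtain ⟨v, hv0, hv, hvd⟩ := exists_targets
  refine ⟨mkC0 (xv v) (xv_tendsto hv), fun V hV ⟨y, hy⟩ => ?_⟩
  obtain ⟨ε, hε, hball⟩ := Metric.isOpen_iff.1 hV y hy
  obtain ⟨p, hp1, hp2⟩ := hvd y (ε / 3) (by positivity)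
  refine (EE_density p).trans_le (lowerDensity_mono fun n hn => hball ?_)
  rw [Metric.mem_ball, dist_eq_norm]
  refine lt_of_le_of_lt (c0_norm_le _ (C := ε / 3 + ε / 3) (by positivity) fun k => ?_)
    (by linarith)
  rw [ZeroAtInftyContinuousMap.sub_apply, shiftT_pow, mkC0_apply]
  have h1 := visit_close hv0 hv hn k
  have h2 := hp2 k
  calc _ ≤ _ := abs_sub_le _ (v p k) _
    _ ≤ _ := by linarith

/-- There exists a weighted backward shift on `c₀(ℤ₊)`, with bounded positive weight
sequence, which is frequently hypercyclic but not hereditarily frequently hypercyclic. -/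
theorem exists_shift_c0_frequentlyHypercyclic_not_hereditarily :
    ∃ (w : ℕ → ℝ), (∀ n, 0 < w n) ∧ (∃ C : ℝ, ∀ n, w n ≤ C) ∧
      ∃ T : C₀(ℕ, ℝ) →L[ℝ] C₀(ℕ, ℝ),
        (∀ (x : C₀(ℕ, ℝ)) (n : ℕ), (T x) n = w (n + 1) * x (n + 1)) ∧
        FrequentlyHypercyclic T ∧ ¬ HereditarilyFrequentlyHypercyclic T :=
  ⟨ww, ww_pos, ⟨2, ww_le⟩, shiftT, shiftT_apply, shift_fhc, not_hereditarily⟩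
end

section
/- Let U be a unitary operator on a complex separable Hilbert space H. Assume that (a) there exists a closed subspace K ⊆ H with U(K) = K such that the restriction of U to K has countable Lebesgue spectrum, and (b) for every f ∈ H the spectral measure σ_f of f with respect to U is absolutely continuous with respect to the Lebesgue measure on the unit circle 𝕋 (i.e., the maximal spectral type of U is the Lebesgue measure). Then U has countable Lebesgue spectrum on all of H. -/
open Filter Topology Set MeasureTheory
open scoped Classical InnerProductSpace

/-- A countably infinite family `(gᵢ)` such that `{Uⁿ gᵢ : n ∈ ℤ, i ∈ ℕ}` is an orthonormal
basis of `H`: this says that the unitary `U` has countable Lebesgue spectrum. -/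
def HasCountableLebesgueSpectrum {H : Type*} [NormedAddCommGroup H]
    [InnerProductSpace ℂ H] (U : H ≃ₗᵢ[ℂ] H) : Prop :=
  ∃ g : ℕ → H, Orthonormal ℂ (fun p : ℤ × ℕ => (U ^ p.1) (g p.2)) ∧
    Dense (Submodule.span ℂ (Set.range fun p : ℤ × ℕ => (U ^ p.1) (g p.2)) : Set H)


lemma cls_zpow_comm {H : Type*} [NormedAddCommGroup H] [InnerProductSpace ℂ H]
    (U : H ≃ₗᵢ[ℂ] H) (A : H →L[ℂ] H) (hA : ∀ x, A (U x) = U (A x)) (n : ℤ) (x : H) :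
    A ((U ^ n) x) = (U ^ n) (A x) := by
  have h2 : ∀ x, A (U⁻¹ x) = U⁻¹ (A x) := by
    intro x
    have h := hA (U⁻¹ x)
    have e : ∀ y, U (U⁻¹ y) = y := fun y => U.apply_symm_apply y
    apply U.injective
    rw [← h, e, e]
  induction n using Int.induction_on generalizing x with
  | zero => rfl
  | succ n ih =>
    rw [zpow_add_one]
    change A ((U ^ (n:ℤ)) (U x)) = (U ^ (n:ℤ)) (U (A x))
    rw [ih, hA]
  | pred n ih =>
    rw [zpow_sub_one]
    change A ((U ^ (-n:ℤ)) (U⁻¹ x)) = (U ^ (-n:ℤ)) (U⁻¹ (A x))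
    rw [ih, h2]

lemma cls_final {H : Type*} [NormedAddCommGroup H] [InnerProductSpace ℂ H] [CompleteSpace H]
    (U : H ≃ₗᵢ[ℂ] H) (g : ℕ → H) (hg : Orthonormal ℂ (fun p : ℤ × ℕ => (U ^ p.1) (g p.2)))
    (A : H →L[ℂ] H) (hA : ∀ x, A (U x) = U (A x)) (hinj : ∀ x, A x = 0 → x = 0)
    (hr : ∀ x, A x ∈ (Submodule.span ℂ
          (Set.range fun p : ℤ × ℕ => (U ^ p.1) (g p.2))).topologicalClosure)
    (d : ℕ → ℂ) (hd : ∀ i, d i ≠ 0) (hAg : ∀ i, A (g i) = d i • g i) :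
    HasCountableLebesgueSpectrum U := by
  let V : H →L[ℂ] H := (U : H →L[ℂ] H)
  let V' : H →L[ℂ] H := (U.symm : H →L[ℂ] H)
  have hadj : star V' = V := by
    rw [ContinuousLinearMap.star_eq_adjoint]
    symm
    rw [ContinuousLinearMap.eq_adjoint_iff]
    intro x y
    change ⟪U x, y⟫_ℂ = ⟪x, U.symm y⟫_ℂ
    rw [← U.inner_map_map x, U.apply_symm_apply]
  have hc1 : Commute V A := by
    ext x; exact (hA x).symm
  have hc2 : Commute V' A := by
    ext x
    change U.symm (A x) = A (U.symm x)
    apply U.injective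
    rw [← hA, U.apply_symm_apply, U.apply_symm_apply]
  have hc3 : Commute V (star A) := by
    have := hc2.star_star
    rwa [hadj] at this
  set R := CFC.abs A with hR
  have hcR : Commute V R := by
    have h5 : star V = V' := by rw [← hadj, star_star]
    exact (Commute.cfcAbs_left hc1.symm (by rw [h5]; exact hc2.symm)).symm
  have hRU : ∀ x, R (U x) = U (R x) := fun x => (congrArg (fun T : H →L[ℂ] H => T x) hcR).symm
  have hRR : R * R = star A * A := CFC.abs_mul_abs A
  have hRs : star R = R := (CFC.abs_nonneg A).isSelfAdjoint
  have hin : ∀ x y, ⟪R x, R y⟫_ℂ = ⟪A x, A y⟫_ℂ := by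
    intro x y
    have h1 : ⟪R x, R y⟫_ℂ = ⟪x, (star R * R) y⟫_ℂ := by
      rw [ContinuousLinearMap.star_eq_adjoint]
      exact (ContinuousLinearMap.adjoint_inner_right R x (R y)).symm
    have h2 : ⟪A x, A y⟫_ℂ = ⟪x, (star A * A) y⟫_ℂ := by
      rw [ContinuousLinearMap.star_eq_adjoint]
      exact (ContinuousLinearMap.adjoint_inner_right A x (A y)).symm
    rw [h1, h2, hRs, hRR]
  have hnorm : ∀ x, ‖R x‖ = ‖A x‖ := by
    intro x
    rw [@norm_eq_sqrt_re_inner ℂ, @norm_eq_sqrt_re_inner ℂ _ _ _ _ (A x), hin]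
  have hAU := cls_zpow_comm U A hA
  have hRUn := cls_zpow_comm U R hRU
  have hdense : Dense (LinearMap.range R.toLinearMap : Set H) := by
    rw [Submodule.dense_iff_topologicalClosure_eq_top,
      Submodule.topologicalClosure_eq_top_iff, Submodule.eq_bot_iff]
    intro x hx
    apply hinj
    rw [← norm_eq_zero, ← hnorm, norm_eq_zero, ← inner_self_eq_zero (𝕜 := ℂ)]
    rw [Submodule.mem_orthogonal] at hx
    have h3 := hx (R (R x)) ⟨R x, rfl⟩
    have h4 : ⟪R (R x), x⟫_ℂ = ⟪R x, R x⟫_ℂ := by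
      conv_lhs => rw [← hRs]
      rw [ContinuousLinearMap.star_eq_adjoint, ContinuousLinearMap.adjoint_inner_left, ← ContinuousLinearMap.star_eq_adjoint, hRs]
    rw [← h4, h3]
  have hkey : ∀ p : ℤ × ℕ, A ((U ^ p.1) ((d p.2)⁻¹ • g p.2)) = (U ^ p.1) (g p.2) := by
    intro p
    rw [hAU, map_smul, hAg, smul_smul, inv_mul_cancel₀ (hd _), one_smul]
  refine ⟨fun i => R ((d i)⁻¹ • g i), ?_, ?_⟩
  · rw [orthonormal_iff_ite] at hg ⊢
    intro p q
    rw [← hg p q]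
    simp only [← hRUn, hin]
    rw [hkey, hkey]
  · set S := Submodule.span ℂ (Set.range fun p : ℤ × ℕ => (U ^ p.1) (R ((d p.2)⁻¹ • g p.2)))
    suffices h : ∀ z, R z ∈ S.topologicalClosure by
      have h2 : Dense ((S.topologicalClosure : Submodule ℂ H) : Set H) :=
        hdense.mono (by rintro _ ⟨z, rfl⟩; exact h z)
      rw [Submodule.topologicalClosure_coe] at h2
      exact dense_closure.1 h2
    intro z
    change R z ∈ closure (S : Set H)
    rw [Metric.mem_closure_iff]
    intro ε hε
    obtain ⟨b, hb, hbε⟩ := Metric.mem_closure_iff.1 (hr z) ε hε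
    have hex : ∃ y, A y = b ∧ R y ∈ S := by
      clear hbε
      induction hb using Submodule.span_induction with
      | mem x hx =>
        obtain ⟨p, rfl⟩ := hx
        refine ⟨_, hkey p, ?_⟩
        rw [hRUn]
        exact Submodule.subset_span ⟨p, rfl⟩
      | zero => exact ⟨0, by simp, by simp⟩
      | add x y _ _ hx hy =>
        obtain ⟨a, rfl, ha⟩ := hx
        obtain ⟨b, rfl, hb⟩ := hy
        exact ⟨a + b, by simp, by simpa using S.add_mem ha hb⟩
      | smul c x _ hx =>
        obtain ⟨a, rfl, ha⟩ := hx
        exact ⟨c • a, by simp, by simpa using S.smul_mem c ha⟩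
    obtain ⟨y, rfl, hy⟩ := hex
    refine ⟨R y, hy, ?_⟩
    rw [dist_eq_norm, ← map_sub, hnorm, map_sub, ← dist_eq_norm]
    exact hbε

lemma cls_funcalc {H : Type*} [NormedAddCommGroup H] [InnerProductSpace ℂ H] [CompleteSpace H]
    (U : H ≃ₗᵢ[ℂ] H) : ∃ Φ : C(AddCircle (1 : ℝ), ℂ) →⋆ₐ[ℂ] (H →L[ℂ] H),
      ∀ (n : ℤ) (x : H), Φ (fourier n) x = (U ^ n) x := by
  let u : unitary (H →L[ℂ] H) := Unitary.linearIsometryEquiv.symm U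
  let a : H →L[ℂ] H := u
  have ha : IsStarNormal a := inferInstance
  have hs : ∀ z ∈ spectrum ℂ a, ‖z‖ = 1 := by
    intro z hz
    have := spectrum.subset_circle_of_unitary (𝕜 := ℂ) u.2 hz
    simpa using this
  let j : C(spectrum ℂ a, AddCircle (1:ℝ)) :=
    ⟨fun z => (AddCircle.homeomorphCircle (T := (1:ℝ)) one_ne_zero).symm
        ⟨z.1, by simpa [Submonoid.unitSphere] using hs z.1 z.2⟩,
      (AddCircle.homeomorphCircle (T := (1:ℝ)) one_ne_zero).symm.continuous.comp
        (by exact Continuous.subtype_mk continuous_subtype_val _)⟩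
  have hj : ∀ z, ((AddCircle.toCircle (j z) : Circle) : ℂ) = z := by
    intro z
    rw [← AddCircle.homeomorphCircle_apply one_ne_zero]
    exact congrArg Subtype.val
      ((AddCircle.homeomorphCircle (T := (1:ℝ)) one_ne_zero).apply_symm_apply _)
  let Ψ : C(AddCircle (1:ℝ), ℂ) →⋆ₐ[ℂ] C(spectrum ℂ a, ℂ) := ContinuousMap.compStarAlgHom' ℂ ℂ j
  let Φ := (cfcHom ha (R := ℂ)).comp Ψ
  have h1 : Φ (fourier 1) = a := by
    change cfcHom ha (Ψ (fourier 1)) = a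
    conv_rhs => rw [← cfcHom_id (R := ℂ) ha]
    congr 1
    ext z
    change fourier 1 (j z) = z.1
    rw [fourier_one, hj]
  have hadd : ∀ m n : ℤ, (fourier (m + n) : C(AddCircle (1:ℝ), ℂ)) = fourier m * fourier n := by
    intro m n; ext x; simp
  have h0 : (fourier 0 : C(AddCircle (1:ℝ), ℂ)) = 1 := by ext x; simp
  refine ⟨Φ, ?_⟩
  intro n
  induction n using Int.induction_on with
  | zero => intro x; rw [h0, map_one]; rfl
  | succ n ih =>
    intro x
    rw [hadd, map_mul, h1, zpow_add_one]
    exact ih (a x)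
  | pred n ih =>
    intro x
    have h2 := ih x
    have h3 : (-(n:ℤ)) = (-(n:ℤ) - 1) + 1 := by ring
    obtain ⟨y, rfl⟩ := U.surjective x
    have h4 := ih y
    rw [h3, hadd, map_mul, h1, zpow_add_one] at h4
    exact h4

lemma cls_integral {H : Type*} [NormedAddCommGroup H] [InnerProductSpace ℂ H] [CompleteSpace H]
    (Φ : C(AddCircle (1 : ℝ), ℂ) →⋆ₐ[ℂ] (H →L[ℂ] H)) (f : H) :
    ∃ σ : Measure (AddCircle (1 : ℝ)), IsFiniteMeasure σ ∧
      ∀ φ : C(AddCircle (1 : ℝ), ℂ), ∫ t, φ t ∂σ = ⟪f, Φ φ f⟫_ℂ := by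
  let c : C(AddCircle (1:ℝ), ℝ) →ₗ[ℝ] C(AddCircle (1:ℝ), ℂ) :=
    { toFun := fun φ => ⟨fun t => (φ t : ℂ), by fun_prop⟩
      map_add' := by intro x y; ext t; simp
      map_smul' := by intro x y; ext t; simp }
  have hreal : ∀ φ : C(AddCircle (1:ℝ), ℝ), ((⟪f, Φ (c φ) f⟫_ℂ).re : ℂ) = ⟪f, Φ (c φ) f⟫_ℂ := by
    intro φ
    have hs : star (c φ) = c φ := by ext t; simp [c]
    apply Complex.conj_eq_iff_re.1
    rw [inner_conj_symm]
    conv_lhs => rw [← hs, map_star, ContinuousLinearMap.star_eq_adjoint]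
    rw [ContinuousLinearMap.adjoint_inner_left]
  have hpos : ∀ φ : C(AddCircle (1:ℝ), ℝ), 0 ≤ φ → 0 ≤ (⟪f, Φ (c φ) f⟫_ℂ).re := by
    intro φ hφ
    let s : C(AddCircle (1:ℝ), ℝ) := ⟨fun t => Real.sqrt (φ t), by fun_prop⟩
    have hs : c φ = star (c s) * c s := by
      ext t
      simp only [c, s, LinearMap.coe_mk, AddHom.coe_mk, ContinuousMap.coe_mk, ContinuousMap.mul_apply,
        ContinuousMap.star_apply, RCLike.star_def, Complex.conj_ofReal]
      rw [← Complex.ofReal_mul, Real.mul_self_sqrt (show 0 ≤ φ t from hφ t)]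
    rw [hs, map_mul, map_star, ContinuousLinearMap.star_eq_adjoint]
    change 0 ≤ (⟪f, ContinuousLinearMap.adjoint (Φ (c s)) (Φ (c s) f)⟫_ℂ).re
    rw [ContinuousLinearMap.adjoint_inner_right]
    exact inner_self_nonneg (𝕜 := ℂ)
  let Λ0 : CompactlySupportedContinuousMap (AddCircle (1:ℝ)) ℝ →ₗ[ℝ] ℝ :=
    { toFun := fun φ => (⟪f, Φ (c φ.toContinuousMap) f⟫_ℂ).re
      map_add' := by
        intro x y
        have : (x + y).toContinuousMap = x.toContinuousMap + y.toContinuousMap := rfl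
        rw [this, map_add, map_add]
        simp
      map_smul' := by
        intro r x
        have h1 : c (r • x).toContinuousMap = (r : ℂ) • c x.toContinuousMap := by
          ext t; simp [c]
        rw [h1, map_smul]
        simp }
  let Λ : CompactlySupportedContinuousMap (AddCircle (1:ℝ)) ℝ →ₚ[ℝ] ℝ :=
    PositiveLinearMap.mk₀ Λ0 (fun φ hφ => hpos φ.toContinuousMap hφ)
  refine ⟨RealRMK.rieszMeasure Λ, ?_, ?_⟩
  · infer_instance
  · have hR : ∀ φ : C(AddCircle (1:ℝ), ℝ), ∫ t, (φ t : ℂ) ∂(RealRMK.rieszMeasure Λ) = ⟪f, Φ (c φ) f⟫_ℂ := by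
      intro φ
      have := RealRMK.integral_rieszMeasure Λ ⟨φ, HasCompactSupport.of_compactSpace φ⟩
      rw [integral_complex_ofReal, ← hreal φ]
      congr 1
    intro φ
    let re : C(AddCircle (1:ℝ), ℝ) := ⟨fun t => (φ t).re, by fun_prop⟩
    let im : C(AddCircle (1:ℝ), ℝ) := ⟨fun t => (φ t).im, by fun_prop⟩
    have hφ : φ = c re + Complex.I • c im := by
      ext t
      simp only [c, re, im, LinearMap.coe_mk, AddHom.coe_mk, ContinuousMap.add_apply, ContinuousMap.coe_mk, ContinuousMap.smul_apply, smul_eq_mul]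
      rw [mul_comm, Complex.re_add_im]
    conv_rhs => rw [hφ, map_add, map_smul]
    rw [add_apply, smul_apply, inner_add_right, inner_smul_right, ← hR, ← hR]
    rw [← integral_const_mul, ← integral_add]
    · apply integral_congr_ae
      filter_upwards with t
      simp only [re, im, ContinuousMap.coe_mk]
      rw [mul_comm, Complex.re_add_im]
    · exact (c re).continuous.integrable_of_hasCompactSupport (HasCompactSupport.of_compactSpace _)
    · exact ((c im).continuous.integrable_of_hasCompactSupport (HasCompactSupport.of_compactSpace _)).const_mul _

lemma cls_memLp (σ : Measure (AddCircle (1 : ℝ))) [IsFiniteMeasure σ]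
    (ψ : C(AddCircle (1 : ℝ), ℂ)) : MemLp ψ 2 σ :=
  MemLp.of_bound ψ.continuous.aestronglyMeasurable ‖ψ‖
    (Eventually.of_forall fun t => ψ.norm_coe_le_norm t)

lemma cls_enorm {H : Type*} [NormedAddCommGroup H] [InnerProductSpace ℂ H] [CompleteSpace H]
    (Φ : C(AddCircle (1 : ℝ), ℂ) →⋆ₐ[ℂ] (H →L[ℂ] H)) (f : H)
    (σ : Measure (AddCircle (1 : ℝ))) [IsFiniteMeasure σ]
    (hσ : ∀ φ : C(AddCircle (1 : ℝ), ℂ), ∫ t, φ t ∂σ = ⟪f, Φ φ f⟫_ℂ)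
    (ψ : C(AddCircle (1 : ℝ), ℂ)) : ‖Φ ψ f‖ₑ = eLpNorm ψ 2 σ := by
  have h1 : ((‖Φ ψ f‖ ^ 2 : ℝ) : ℂ) = ((∫ t, ‖ψ t‖ ^ 2 ∂σ : ℝ) : ℂ) := by
    have h2 : ((‖Φ ψ f‖ ^ 2 : ℝ) : ℂ) = ⟪f, Φ (star ψ * ψ) f⟫_ℂ := by
      rw [map_mul, map_star, ContinuousLinearMap.star_eq_adjoint]
      change _ = ⟪f, ContinuousLinearMap.adjoint (Φ ψ) (Φ ψ f)⟫_ℂ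
      rw [ContinuousLinearMap.adjoint_inner_right, inner_self_eq_norm_sq_to_K]
      simp
    rw [h2, ← hσ, ← integral_complex_ofReal]
    congr 1
    ext t
    simp [Complex.conj_mul']
  have h3 : ‖Φ ψ f‖ ^ 2 = ∫ t, ‖ψ t‖ ^ 2 ∂σ := by exact_mod_cast h1
  rw [MemLp.eLpNorm_eq_integral_rpow_norm (by norm_num) (by norm_num) (cls_memLp σ ψ)]
  simp only [ENNReal.toReal_ofNat, Real.rpow_ofNat]
  rw [← h3, ← ofReal_norm]
  congr 1
  rw [← Real.rpow_natCast, ← Real.rpow_mul (norm_nonneg _)]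
  norm_num

lemma cls_indicator {H : Type*} [NormedAddCommGroup H] [InnerProductSpace ℂ H] [CompleteSpace H]
    (Φ : C(AddCircle (1 : ℝ), ℂ) →⋆ₐ[ℂ] (H →L[ℂ] H)) (f : H)
    (σ : Measure (AddCircle (1 : ℝ))) [IsFiniteMeasure σ]
    (hσ : ∀ φ : C(AddCircle (1 : ℝ), ℂ), ∫ t, φ t ∂σ = ⟪f, Φ φ f⟫_ℂ)
    (S : Set (AddCircle (1 : ℝ))) (hS : MeasurableSet S) :
    ∃ η : H, ∀ p q : C(AddCircle (1 : ℝ), ℂ),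
      ‖Φ q f - Φ p η‖ₑ ≤ eLpNorm (fun t => q t - p t * S.indicator (fun _ => (1:ℂ)) t) 2 σ := by
  set χ : AddCircle (1 : ℝ) → ℂ := S.indicator (fun _ => (1:ℂ)) with hχ
  have hχL : MemLp χ 2 σ := memLp_indicator_const 2 hS 1 (Or.inr (measure_ne_top _ _))
  have hN := cls_enorm Φ f σ hσ
  have hex : ∀ k : ℕ, ∃ φ : C(AddCircle (1 : ℝ), ℂ), eLpNorm (χ - ⇑φ) 2 σ ≤ 1 / 2 ^ k := by
    intro k
    obtain ⟨φ, h, -⟩ := hχL.exists_boundedContinuous_eLpNorm_sub_le (by norm_num)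
      (ε := 1 / 2 ^ k) (by simp)
    exact ⟨φ.toContinuousMap, h⟩
  choose φ hφ using hex
  have hmχ : ∀ ψ : C(AddCircle (1 : ℝ), ℂ), AEStronglyMeasurable (χ - ⇑ψ) σ := fun ψ =>
    (hχL.sub (cls_memLp σ ψ)).1
  have hcau : CauchySeq (fun k => Φ (φ k) f) := by
    apply cauchySeq_of_edist_le_geometric_two 2 (by norm_num)
    intro k
    rw [edist_eq_enorm_sub, ← sub_apply, ← map_sub, hN]
    have e : (⇑(φ k - φ (k+1)) : AddCircle (1 : ℝ) → ℂ) = (χ - ⇑(φ (k+1))) - (χ - ⇑(φ k)) := by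
      ext t; simp
    rw [e]
    calc _ ≤ eLpNorm (χ - ⇑(φ (k+1))) 2 σ + eLpNorm (χ - ⇑(φ k)) 2 σ :=
          eLpNorm_sub_le (hmχ _) (hmχ _) (by norm_num)
      _ ≤ 1 / 2 ^ (k+1) + 1 / 2 ^ k := add_le_add (hφ _) (hφ _)
      _ ≤ 1 / 2 ^ k + 1 / 2 ^ k := by
          gcongr <;> norm_num
      _ = 2 / 2 ^ k := by rw [← ENNReal.add_div, one_add_one_eq_two]
  obtain ⟨η, hη⟩ := cauchySeq_tendsto_of_complete hcau
  refine ⟨η, fun p q => ?_⟩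
  have hlim : Tendsto (fun k => ‖Φ q f - Φ p (Φ (φ k) f)‖ₑ) atTop (𝓝 ‖Φ q f - Φ p η‖ₑ) := by
    have : Tendsto (fun k => Φ q f - Φ p (Φ (φ k) f)) atTop (𝓝 (Φ q f - Φ p η)) :=
      tendsto_const_nhds.sub (((Φ p).continuous.tendsto η).comp hη)
    exact this.enorm
  have hlim2 : Tendsto (fun k : ℕ => eLpNorm (fun t => q t - p t * χ t) 2 σ + ‖p‖₊ * (1 / 2 ^ k))
      atTop (𝓝 (eLpNorm (fun t => q t - p t * χ t) 2 σ + ‖p‖₊ * 0)) := by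
    refine tendsto_const_nhds.add (ENNReal.Tendsto.const_mul ?_ (Or.inr (by simp)))
    have := ENNReal.tendsto_pow_atTop_nhds_zero_of_lt_one (r := 2⁻¹) (by norm_num)
    simp [ENNReal.inv_pow, this]
  rw [mul_zero, add_zero] at hlim2
  refine le_of_tendsto_of_tendsto' hlim hlim2 fun k => ?_
  have e1 : Φ q f - Φ p (Φ (φ k) f) = Φ (q - p * φ k) f := by
    rw [map_sub, map_mul]; rfl
  have e2 : (⇑(q - p * φ k) : AddCircle (1 : ℝ) → ℂ)
      = (fun t => q t - p t * χ t) + (fun t => p t * (χ - ⇑(φ k)) t) := by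
    ext t; simp; ring
  have m1 : AEStronglyMeasurable (fun t => q t - p t * χ t) σ :=
    q.continuous.aestronglyMeasurable.sub (p.continuous.aestronglyMeasurable.mul hχL.1)
  have m2 : AEStronglyMeasurable (fun t => p t * (χ - ⇑(φ k)) t) σ :=
    p.continuous.aestronglyMeasurable.mul (hmχ _)
  rw [e1, hN, e2]
  refine (eLpNorm_add_le m1 m2 (by norm_num)).trans ?_
  gcongr
  refine (eLpNorm_le_mul_eLpNorm_of_ae_le_mul' (c := ‖p‖₊) (g := χ - ⇑(φ k)) ?_ 2).trans ?_
  · filter_upwards with t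
    rw [enorm_mul]
    gcongr
    rw [enorm_eq_nnnorm]
    exact_mod_cast p.norm_coe_le_norm t
  · gcongr
    exact hφ k

lemma cls_trig (a : ℤ → ℂ) (F : Finset ℤ) :
    eLpNorm (⇑(∑ n ∈ F, a n • (fourier n : C(AddCircle (1 : ℝ), ℂ)))) 2 volume
      = ENNReal.ofReal (Real.sqrt (∑ n ∈ F, ‖a n‖ ^ 2)) := by
  have hv : (volume : Measure (AddCircle (1 : ℝ))) = AddCircle.haarAddCircle := by
    rw [AddCircle.volume_eq_smul_haarAddCircle]; simp
  rw [hv]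
  set p := ∑ n ∈ F, a n • (fourier n : C(AddCircle (1 : ℝ), ℂ))
  let L := ContinuousMap.toLp (E := ℂ) 2 (AddCircle.haarAddCircle (T := (1:ℝ))) ℂ
  have h1 : ‖L p‖ₑ = eLpNorm p 2 AddCircle.haarAddCircle := by
    rw [Lp.enorm_def]
    exact eLpNorm_congr_ae (ContinuousMap.coeFn_toLp _ p)
  rw [← h1, ← ofReal_norm]
  congr 1
  have h2 : L p = ∑ n ∈ F, a n • fourierLp 2 n := by
    simp only [p, map_sum, map_smul]; rfl
  have h3 := (orthonormal_fourier (T := (1:ℝ))).inner_sum a a F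
  rw [← h2] at h3
  rw [@norm_eq_sqrt_re_inner ℂ, h3]
  congr 1
  simp [Complex.conj_mul', ← Complex.ofReal_pow]

/-- Bessel vectors. -/
def ClsBessel {H : Type*} [NormedAddCommGroup H] [InnerProductSpace ℂ H]
    (U : H ≃ₗᵢ[ℂ] H) (η : H) (C : ℝ) : Prop :=
  0 ≤ C ∧ ∀ (x : H) (F : Finset ℤ), ∑ n ∈ F, ‖⟪(U ^ n) η, x⟫_ℂ‖ ^ 2 ≤ C * ‖x‖ ^ 2

lemma cls_bessel_dense {H : Type*} [NormedAddCommGroup H] [InnerProductSpace ℂ H]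
    [CompleteSpace H] (U : H ≃ₗᵢ[ℂ] H)
    (Φ : C(AddCircle (1 : ℝ), ℂ) →⋆ₐ[ℂ] (H →L[ℂ] H))
    (hΦ : ∀ (n : ℤ) (x : H), Φ (fourier n) x = (U ^ n) x) (f : H)
    (σ : Measure (AddCircle (1 : ℝ))) [IsFiniteMeasure σ]
    (hσ : ∀ φ : C(AddCircle (1 : ℝ), ℂ), ∫ t, φ t ∂σ = ⟪f, Φ φ f⟫_ℂ)
    (hac : σ ≪ volume) (ε : ℝ) (hε : 0 < ε) :
    ∃ η C, ClsBessel U η C ∧ dist f η < ε := by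
  set w := σ.rnDeriv volume with hw
  have hwm : Measurable w := Measure.measurable_rnDeriv _ _
  have hwσ : volume.withDensity w = σ := Measure.withDensity_rnDeriv_eq _ _ hac
  let T : ℕ → Set (AddCircle (1 : ℝ)) := fun M => {t | (M : ENNReal) < w t}
  have hTm : ∀ M, MeasurableSet (T M) := fun M => measurableSet_lt measurable_const hwm
  have hlim : Tendsto (σ ∘ T) atTop (𝓝 (σ (⋂ M, T M))) := by
    apply tendsto_measure_iInter_atTop (fun M => (hTm M).nullMeasurableSet)
    · intro a b hab t ht
      exact lt_of_le_of_lt (show (a : ENNReal) ≤ b by exact_mod_cast hab) (show (b : ENNReal) < w t from ht)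
    · exact ⟨0, measure_ne_top _ _⟩
  have h0 : σ (⋂ M, T M) = 0 := by
    have h1 : ∀ᵐ t ∂σ, w t < ⊤ := hac.ae_le (Measure.rnDeriv_lt_top σ volume)
    rw [ae_iff] at h1
    refine measure_mono_null ?_ h1
    intro t ht hlt
    obtain ⟨n, hn⟩ := ENNReal.exists_nat_gt hlt.ne
    exact absurd (mem_iInter.1 ht n) (not_lt.2 hn.le)
  rw [h0] at hlim
  have hpos : (0 : ENNReal) < ENNReal.ofReal (ε ^ 2) := by
    rw [ENNReal.ofReal_pos]; positivity
  obtain ⟨M, hM⟩ := (hlim.eventually (gt_mem_nhds hpos)).exists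
  let S := (T M)ᶜ
  have hSm : MeasurableSet S := (hTm M).compl
  have hres : σ.restrict S ≤ (M : ENNReal) • (volume : Measure (AddCircle (1 : ℝ))) := by
    rw [Measure.le_iff]
    intro B hB
    rw [Measure.restrict_apply hB]
    conv_lhs => rw [← hwσ]
    rw [withDensity_apply _ (hB.inter hSm)]
    calc ∫⁻ t in B ∩ S, w t ≤ ∫⁻ t in B ∩ S, (M : ENNReal) := by
          apply setLIntegral_mono measurable_const
          intro t ht
          exact not_lt.1 ht.2
      _ = M * volume (B ∩ S) := by simp
      _ ≤ M * volume B := by gcongr; exact inter_subset_left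
      _ = _ := by simp
  obtain ⟨η, hη⟩ := cls_indicator Φ f σ hσ S hSm
  have hb : ∀ (a : ℤ → ℂ) (F : Finset ℤ), ‖∑ n ∈ F, a n • (U ^ n) η‖
      ≤ Real.sqrt M * Real.sqrt (∑ n ∈ F, ‖a n‖ ^ 2) := by
    intro a F
    set p := ∑ n ∈ F, a n • (fourier n : C(AddCircle (1 : ℝ), ℂ)) with hp
    have e1 : Φ p η = ∑ n ∈ F, a n • (U ^ n) η := by
      simp [hp, map_sum, hΦ]
    have h1 := hη p 0
    rw [map_zero, zero_apply, zero_sub, enorm_neg, e1] at h1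
    have e2 : eLpNorm (fun t => (0 : C(AddCircle (1 : ℝ), ℂ)) t
        - p t * S.indicator (fun _ => (1:ℂ)) t) 2 σ = eLpNorm p 2 (σ.restrict S) := by
      rw [← eLpNorm_indicator_eq_eLpNorm_restrict hSm, ← eLpNorm_neg]
      congr 1
      ext t
      by_cases ht : t ∈ S <;> simp [ht]
    rw [e2] at h1
    have h2 := h1.trans (eLpNorm_mono_measure p hres)
    rw [eLpNorm_smul_measure_of_ne_top (by norm_num), cls_trig] at h2
    have e3 : (M : ENNReal) ^ (1 / (2 : ENNReal)).toReal = ENNReal.ofReal (Real.sqrt M) := by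
      rw [Real.sqrt_eq_rpow, ← ENNReal.ofReal_rpow_of_nonneg (by positivity) (by norm_num)]
      simp
    rw [e3, smul_eq_mul, ← ENNReal.ofReal_mul (Real.sqrt_nonneg _), ← ofReal_norm] at h2
    exact (ENNReal.ofReal_le_ofReal_iff (by positivity)).1 h2
  refine ⟨η, M, ⟨Nat.cast_nonneg _, fun x F => ?_⟩, ?_⟩
  · set a : ℤ → ℂ := fun n => ⟪(U ^ n) η, x⟫_ℂ with ha
    set s := ∑ n ∈ F, ‖a n‖ ^ 2 with hs
    have hs0 : 0 ≤ s := Finset.sum_nonneg fun _ _ => by positivity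
    have h1 : ⟪∑ n ∈ F, a n • (U ^ n) η, x⟫_ℂ = (s : ℂ) := by
      rw [sum_inner, hs]
      push_cast
      refine Finset.sum_congr rfl fun n _ => ?_
      rw [inner_smul_left, ← Complex.conj_mul']
    have h2 : s ≤ Real.sqrt M * Real.sqrt s * ‖x‖ := by
      calc s = ‖(s : ℂ)‖ := by simp [abs_of_nonneg hs0]
        _ = ‖⟪∑ n ∈ F, a n • (U ^ n) η, x⟫_ℂ‖ := by rw [h1]
        _ ≤ ‖∑ n ∈ F, a n • (U ^ n) η‖ * ‖x‖ := norm_inner_le_norm _ _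
        _ ≤ _ := by gcongr; exact hb a F
    change s ≤ M * ‖x‖ ^ 2
    rcases hs0.eq_or_lt with h | h
    · rw [← h]; positivity
    · have hr : 0 < Real.sqrt s := Real.sqrt_pos.2 h
      have h3 : Real.sqrt s ≤ Real.sqrt M * ‖x‖ := by
        have : Real.sqrt s * Real.sqrt s ≤ Real.sqrt s * (Real.sqrt M * ‖x‖) := by
          rw [Real.mul_self_sqrt hs0]; linarith
        exact le_of_mul_le_mul_left this hr
      calc s = Real.sqrt s ^ 2 := (Real.sq_sqrt hs0).symm
        _ ≤ (Real.sqrt M * ‖x‖) ^ 2 := by gcongr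
        _ = _ := by rw [mul_pow, Real.sq_sqrt (by positivity)]
  · have h1 := hη 1 1
    have e2 : eLpNorm (fun t => (1 : C(AddCircle (1 : ℝ), ℂ)) t
        - (1 : C(AddCircle (1 : ℝ), ℂ)) t * S.indicator (fun _ => (1:ℂ)) t) 2 σ
        = eLpNorm ((T M).indicator (fun _ => (1:ℂ))) 2 σ := by
      congr 1
      ext t
      by_cases ht : t ∈ T M <;> simp [S, ht]
    rw [e2, eLpNorm_indicator_const (hTm M) (by norm_num) (by norm_num), map_one] at h1
    have h2 : ‖f - η‖ₑ < ENNReal.ofReal ε := by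
      refine lt_of_le_of_lt h1 ?_
      have h3 : σ (T M) ^ (1 / (2:ENNReal).toReal) < ENNReal.ofReal (ε ^ 2) ^ (1 / (2:ENNReal).toReal) :=
        ENNReal.rpow_lt_rpow hM (by norm_num)
      have e4 : ENNReal.ofReal (ε ^ 2) ^ (1 / (2:ENNReal).toReal) = ENNReal.ofReal ε := by
        rw [ENNReal.ofReal_rpow_of_nonneg (by positivity) (by norm_num)]
        congr 1
        rw [← Real.rpow_natCast, ← Real.rpow_mul hε.le]
        norm_num
      rw [e4] at h3
      simpa using h3
    rw [← ofReal_norm, ENNReal.ofReal_lt_ofReal_iff hε] at h2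
    rwa [dist_eq_norm]

lemma cls_bessel_op {ι H : Type*} [NormedAddCommGroup H] [InnerProductSpace ℂ H] [CompleteSpace H]
    (u v : ι → H) (hu : Orthonormal ℂ u) (C : ℝ) (hC : 0 ≤ C)
    (hv : ∀ (x : H) (F : Finset ι), ∑ p ∈ F, ‖⟪v p, x⟫_ℂ‖ ^ 2 ≤ C * ‖x‖ ^ 2) :
    ∃ A : H →L[ℂ] H, (∀ x, HasSum (fun p => ⟪v p, x⟫_ℂ • u p) (A x)) ∧
      ∀ q x, ⟪u q, A x⟫_ℂ = ⟪v q, x⟫_ℂ := by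
  have hmem : ∀ x, Memℓp (E := fun _ : ι => ℂ) (fun p => ⟪v p, x⟫_ℂ) 2 := fun x =>
    memℓp_gen' (C := C * ‖x‖ ^ 2) (by simpa using hv x)
  let Θ0 : H →ₗ[ℂ] lp (fun _ : ι => ℂ) 2 :=
    { toFun := fun x => ⟨fun p => ⟪v p, x⟫_ℂ, hmem x⟩
      map_add' := by intro x y; ext p; exact inner_add_right _ _ _
      map_smul' := by intro c x; ext p; simp [inner_smul_right] }
  let Θ : H →L[ℂ] lp (fun _ : ι => ℂ) 2 := Θ0.mkContinuous (Real.sqrt C) (by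
    intro x
    apply lp.norm_le_of_forall_sum_le (by norm_num) (by positivity)
    intro F
    simp only [ENNReal.toReal_ofNat, Real.rpow_ofNat]
    rw [mul_pow, Real.sq_sqrt hC]
    exact hv x F)
  let e := hu.orthogonalFamily.linearIsometry
  have hsum : ∀ x, HasSum (fun p => ⟪v p, x⟫_ℂ • u p) (e (Θ x)) := by
    intro x
    exact hu.orthogonalFamily.hasSum_linearIsometry (Θ x)
  refine ⟨e.toContinuousLinearMap.comp Θ, hsum, ?_⟩
  intro q x
  have h1 := (innerSL ℂ (u q)).hasSum (hsum x)
  have h2 : HasSum (fun p => innerSL ℂ (u q) (⟪v p, x⟫_ℂ • u p)) ⟪v q, x⟫_ℂ := by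
    have h3 := hasSum_single (f := fun p => innerSL ℂ (u q) (⟪v p, x⟫_ℂ • u p)) q (by
      intro p hp
      simp only [innerSL_apply_apply, inner_smul_right]
      rw [hu.2 hp.symm, mul_zero])
    convert h3 using 1
    simp only [innerSL_apply_apply, inner_smul_right]
    rw [inner_self_eq_norm_sq_to_K, hu.1 q]
    simp
  exact h1.unique h2

lemma cls_proj_comm {H : Type*} [NormedAddCommGroup H] [InnerProductSpace ℂ H] [CompleteSpace H]
    (U : H ≃ₗᵢ[ℂ] H) (K : Submodule ℂ H) (hKc : IsClosed (K : Set H))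
    (h1 : ∀ f ∈ K, U f ∈ K) (h2 : ∀ f ∈ K, U.symm f ∈ K) (x : H) :
    Kᗮ.starProjection (U x) = U (Kᗮ.starProjection x) := by
  haveI : CompleteSpace K := hKc.completeSpace_coe
  refine Submodule.eq_starProjection_of_mem_orthogonal ?_ ?_
  · rw [Submodule.mem_orthogonal]
    intro y hy
    have h3 := (Submodule.mem_orthogonal K _).1 (Kᗮ.starProjection_apply_mem x) _ (h2 y hy)
    rw [← h3, ← U.inner_map_map (U.symm y), U.apply_symm_apply]
  · rw [← map_sub]
    have h3 := Submodule.sub_starProjection_mem_orthogonal (K := Kᗮ) x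
    rw [Submodule.orthogonal_orthogonal] at h3 ⊢
    exact h1 _ h3

lemma cls_sum_bound {H : Type*} [NormedAddCommGroup H] [InnerProductSpace ℂ H]
    (U : H ≃ₗᵢ[ℂ] H) (η : ℕ → H) (C c : ℕ → ℝ) (hη : ∀ i, ClsBessel U (η i) (C i))
    (hc : ∀ i, c i ^ 2 * C i ≤ (1 / 2) ^ i) (x : H) (F : Finset (ℤ × ℕ)) :
    ∑ p ∈ F, c p.2 ^ 2 * ‖⟪(U ^ p.1) (η p.2), x⟫_ℂ‖ ^ 2 ≤ 2 * ‖x‖ ^ 2 := by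
  have hsub : F ⊆ F.image Prod.fst ×ˢ F.image Prod.snd := Finset.subset_product
  calc _ ≤ ∑ p ∈ F.image Prod.fst ×ˢ F.image Prod.snd,
          c p.2 ^ 2 * ‖⟪(U ^ p.1) (η p.2), x⟫_ℂ‖ ^ 2 :=
        Finset.sum_le_sum_of_subset_of_nonneg hsub (fun _ _ _ => by positivity)
    _ = ∑ i ∈ F.image Prod.snd, c i ^ 2 * ∑ n ∈ F.image Prod.fst, ‖⟪(U ^ n) (η i), x⟫_ℂ‖ ^ 2 := by
        rw [Finset.sum_product_right]
        simp only [Finset.mul_sum]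
    _ ≤ ∑ i ∈ F.image Prod.snd, (1 / 2 : ℝ) ^ i * ‖x‖ ^ 2 := by
        refine Finset.sum_le_sum fun i _ => ?_
        calc _ ≤ c i ^ 2 * (C i * ‖x‖ ^ 2) := by gcongr; exact (hη i).2 x _
          _ = (c i ^ 2 * C i) * ‖x‖ ^ 2 := by ring
          _ ≤ _ := by gcongr; exact hc i
    _ = (∑ i ∈ F.image Prod.snd, (1 / 2 : ℝ) ^ i) * ‖x‖ ^ 2 := by rw [Finset.sum_mul]
    _ ≤ 2 * ‖x‖ ^ 2 := by
        gcongr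
        exact (summable_geometric_two.sum_le_tsum _ (fun _ _ => by positivity)).trans_eq
          tsum_geometric_two

theorem countableLebesgueSpectrum_of_subspace_and_ac
    {H : Type*} [NormedAddCommGroup H] [InnerProductSpace ℂ H] [CompleteSpace H]
    [TopologicalSpace.SeparableSpace H]
    (U : H ≃ₗᵢ[ℂ] H)
    (hK : ∃ K : Submodule ℂ H, IsClosed (K : Set H) ∧
      (∀ f ∈ K, U f ∈ K) ∧ (∀ f ∈ K, U.symm f ∈ K) ∧
      ∃ g : ℕ → H, Orthonormal ℂ (fun p : ℤ × ℕ => (U ^ p.1) (g p.2)) ∧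
        (Submodule.span ℂ
          (Set.range fun p : ℤ × ℕ => (U ^ p.1) (g p.2))).topologicalClosure = K)
    (hac : ∀ f : H, ∀ σ : Measure (AddCircle (1 : ℝ)), IsFiniteMeasure σ →
      (∀ n : ℤ, ∫ t, fourier (-n) t ∂σ = ⟪(U ^ n) f, f⟫_ℂ) →
      σ ≪ MeasureTheory.volume) :
    HasCountableLebesgueSpectrum U := by
  obtain ⟨K, hKc, hK1, hK2, g, hg, hspan⟩ := hK
  haveI : CompleteSpace K := hKc.completeSpace_coe
  -- density of Bessel vectors
  obtain ⟨Φ, hΦ⟩ := cls_funcalc U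
  have hUadj : ∀ (n : ℤ) (x y : H), ⟪(U ^ n) x, y⟫_ℂ = ⟪x, (U ^ (-n)) y⟫_ℂ := by
    intro n x y
    rw [← (U ^ n).inner_map_map x ((U ^ (-n)) y)]
    have : (U ^ n) ((U ^ (-n)) y) = (U ^ n * U ^ (-n)) y := rfl
    rw [this, ← zpow_add, add_neg_cancel, zpow_zero]
    rfl
  have hBd : Dense {η : H | ∃ C, ClsBessel U η C} := by
    intro f
    rw [Metric.mem_closure_iff]
    intro ε hε
    obtain ⟨σ, hfin, hσ⟩ := cls_integral Φ f
    have hacσ := hac f σ hfin (by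
      intro n
      rw [hσ, hΦ, hUadj])
    obtain ⟨η, C, h1, h2⟩ := cls_bessel_dense U Φ hΦ f σ hσ hacσ ε hε
    exact ⟨η, ⟨C, h1⟩, h2⟩
  obtain ⟨t, htB, htc, htd⟩ := hBd.exists_countable_dense_subset
  obtain ⟨θ, rfl⟩ := htc.exists_eq_range htd.nonempty
  have hθ : ∀ k, ∃ C, ClsBessel U (θ k) C := fun k => htB ⟨k, rfl⟩
  choose C hθ using hθ
  -- projection
  set P := Kᗮ.starProjection with hP
  have hPU := cls_zpow_comm U P (cls_proj_comm U K hKc hK1 hK2)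
  have hPin : ∀ x y, ⟪P x, y⟫_ℂ = ⟪x, P y⟫_ℂ := Submodule.inner_starProjection_left_eq_right Kᗮ
  set u : ℤ × ℕ → H := fun p => (U ^ p.1) (g p.2) with hu
  have huK : ∀ p, u p ∈ K := by
    intro p
    rw [← hspan]
    exact Submodule.le_topologicalClosure _ (Submodule.subset_span ⟨p, rfl⟩)
  have hPu : ∀ p, P (u p) = 0 := by
    intro p
    rw [hP, Submodule.starProjection_apply_eq_zero_iff, Submodule.orthogonal_orthogonal]
    exact huK p
  let k : ℕ → ℕ := fun i => (Nat.unpair i).1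
  let η : ℕ → H := fun i => P (θ (k i))
  have hηx : ∀ (n : ℤ) (i : ℕ) (x : H), ⟪(U ^ n) (η i), x⟫_ℂ = ⟪(U ^ n) (θ (k i)), P x⟫_ℂ := by
    intro n i x
    simp only [η]
    rw [← hPU, hPin]
  have hPnorm : ∀ x, ‖P x‖ ≤ ‖x‖ := fun x => Submodule.norm_starProjection_apply_le _ x
  have hηB : ∀ i, ClsBessel U (η i) (C (k i)) := by
    intro i
    refine ⟨(hθ _).1, fun x F => ?_⟩
    simp only [hηx]
    refine ((hθ (k i)).2 (P x) F).trans ?_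
    have := (hθ (k i)).1
    gcongr
    exact hPnorm x
  let c : ℕ → ℝ := fun i => (1 / 2) ^ i / (1 + C (k i))
  have hC0 : ∀ i, 0 ≤ C i := fun i => (hθ i).1
  have hcpos : ∀ i, 0 < c i := fun i => by
    have := hC0 (k i)
    simp only [c]; positivity
  have hc1 : ∀ i, c i ≤ 1 := by
    intro i
    have h := hC0 (k i)
    simp only [c]
    rw [div_le_one (by linarith)]
    have : (1 / 2 : ℝ) ^ i ≤ 1 := pow_le_one₀ (by norm_num) (by norm_num)
    linarith
  have hcC : ∀ i, c i ^ 2 * C (k i) ≤ (1 / 2) ^ i := by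
    intro i
    have h := hC0 (k i)
    have h1 : c i * C (k i) ≤ (1 / 2) ^ i := by
      simp only [c]
      rw [div_mul_eq_mul_div, div_le_iff₀ (by linarith)]
      gcongr
      linarith
    calc c i ^ 2 * C (k i) = c i * (c i * C (k i)) := by ring
      _ ≤ 1 * (c i * C (k i)) := by
        have := hcpos i
        gcongr
        exact hc1 i
      _ ≤ _ := by rw [one_mul]; exact h1
  let d : ℕ → ℝ := fun i => c i * (1 / 2) ^ i
  have hdpos : ∀ i, 0 < d i := fun i => by have := hcpos i; simp only [d]; positivity
  have hd1 : ∀ i, d i ≤ 1 := by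
    intro i
    exact mul_le_one₀ (hc1 i) (by positivity) (pow_le_one₀ (by norm_num) (by norm_num))
  let v : ℤ × ℕ → H := fun p => (U ^ p.1) ((c p.2 : ℂ) • η p.2 + (d p.2 : ℂ) • g p.2)
  have hvx : ∀ p x, ⟪v p, x⟫_ℂ = c p.2 * ⟪(U ^ p.1) (η p.2), x⟫_ℂ + d p.2 * ⟪u p, x⟫_ℂ := by
    intro p x
    simp only [v, u, map_add, map_smul, inner_add_left, inner_smul_left, Complex.conj_ofReal]
  have hvB : ∀ (x : H) (F : Finset (ℤ × ℕ)), ∑ p ∈ F, ‖⟪v p, x⟫_ℂ‖ ^ 2 ≤ 6 * ‖x‖ ^ 2 := by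
    intro x F
    have h1 := cls_sum_bound U η (fun i => C (k i)) c hηB hcC x F
    have h2 := hg.sum_inner_products_le x (s := F)
    calc _ ≤ ∑ p ∈ F, (2 * (c p.2 ^ 2 * ‖⟪(U ^ p.1) (η p.2), x⟫_ℂ‖ ^ 2) + 2 * ‖⟪u p, x⟫_ℂ‖ ^ 2) := by
          refine Finset.sum_le_sum fun p _ => ?_
          rw [hvx]
          set a := ⟪(U ^ p.1) (η p.2), x⟫_ℂ
          set b := ⟪u p, x⟫_ℂ
          have n1 : ‖(c p.2 : ℂ) * a + d p.2 * b‖ ≤ c p.2 * ‖a‖ + ‖b‖ := by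
            refine (norm_add_le _ _).trans ?_
            rw [norm_mul, norm_mul, Complex.norm_real, Complex.norm_real,
              Real.norm_of_nonneg (hcpos _).le, Real.norm_of_nonneg (hdpos _).le]
            gcongr
            exact mul_le_of_le_one_left (norm_nonneg _) (hd1 _)
          calc _ ≤ (c p.2 * ‖a‖ + ‖b‖) ^ 2 := by gcongr
            _ ≤ _ := by nlinarith [sq_nonneg (c p.2 * ‖a‖ - ‖b‖)]
      _ = 2 * ∑ p ∈ F, (c p.2 ^ 2 * ‖⟪(U ^ p.1) (η p.2), x⟫_ℂ‖ ^ 2)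
            + 2 * ∑ p ∈ F, ‖⟪u p, x⟫_ℂ‖ ^ 2 := by
          rw [Finset.sum_add_distrib, Finset.mul_sum, Finset.mul_sum]
      _ ≤ 2 * (2 * ‖x‖ ^ 2) + 2 * ‖x‖ ^ 2 := by gcongr
      _ = _ := by ring
  obtain ⟨A, hA, hAin⟩ := cls_bessel_op u v hg 6 (by norm_num) hvB
  refine cls_final U g hg A ?_ ?_ ?_ (fun i => (d i : ℂ))
    (fun i => by exact_mod_cast (hdpos i).ne') ?_
  · intro x
    have h1 := hA (U x)
    have h2 := (U : H →L[ℂ] H).hasSum (hA x)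
    let e : ℤ × ℕ ≃ ℤ × ℕ := (Equiv.addRight (1 : ℤ)).prodCongr (Equiv.refl ℕ)
    rw [← e.hasSum_iff] at h1
    refine h1.unique ?_
    convert h2 using 1
    · ext p
      have hstep : ∀ y, (U ^ (p.1 + 1)) y = U ((U ^ p.1) y) := by
        intro y
        rw [add_comm, zpow_add, zpow_one]; rfl
      change ⟪(U ^ (p.1 + 1)) _, U x⟫_ℂ • (U ^ (p.1 + 1)) (g p.2) = U (⟪v p, x⟫_ℂ • u p)
      rw [hstep, hstep, U.inner_map_map, map_smul]
      rfl
    · rfl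
  · intro x hx
    have h0 : ∀ p, (c p.2 : ℂ) * ⟪(U ^ p.1) (η p.2), x⟫_ℂ + d p.2 * ⟪u p, x⟫_ℂ = 0 := by
      intro p
      rw [← hvx, ← hAin, hx, inner_zero_right]
    have h1 : ∀ i, ‖⟪η i, x⟫_ℂ‖ ≤ (1 / 2) ^ i * ‖x‖ := by
      intro i
      have h2 := h0 (0, i)
      have h3 : ⟪η i, x⟫_ℂ = - (((1 / 2 : ℝ) ^ i : ℝ) : ℂ) * ⟪u (0, i), x⟫_ℂ := by
        have hc : (c i : ℂ) ≠ 0 := by exact_mod_cast (hcpos i).ne'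
        apply mul_left_cancel₀ hc
        have e1 : ((U ^ (0:ℤ)) (η i)) = η i := rfl
        have e2 : (d i : ℂ) = c i * (((1 / 2 : ℝ) ^ i : ℝ) : ℂ) := by
          simp only [d]; push_cast; ring
        simp only [e1, e2] at h2
        linear_combination h2
      rw [h3, norm_mul, norm_neg, Complex.norm_real, Real.norm_of_nonneg (by positivity)]
      gcongr
      refine (norm_inner_le_norm _ _).trans ?_
      rw [hg.1, one_mul]
    have h2 : ∀ j, ⟪θ j, P x⟫_ℂ = 0 := by
      intro j
      rw [← norm_le_zero_iff]
      have hl : Tendsto (fun m : ℕ => (1 / 2 : ℝ) ^ m * ‖x‖) atTop (𝓝 (0 * ‖x‖)) :=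
        (tendsto_pow_atTop_nhds_zero_of_lt_one (by norm_num) (by norm_num)).mul_const _
      rw [zero_mul] at hl
      refine ge_of_tendsto' hl fun m => ?_
      have h3 := h1 (Nat.pair j m)
      have e1 : η (Nat.pair j m) = P (θ j) := by simp [η, k]
      rw [e1, hPin] at h3
      refine h3.trans ?_
      gcongr ?_ * _
      exact pow_le_pow_of_le_one (by norm_num) (by norm_num) (Nat.right_le_pair j m)
    have hPx : P x = 0 := by
      refine htd.eq_zero_of_inner_left (𝕜 := ℂ) ?_
      rintro _ ⟨j, rfl⟩
      rw [← inner_conj_symm, h2, map_zero]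
    have h3 : ∀ p, ⟪u p, x⟫_ℂ = 0 := by
      intro p
      have h4 := h0 p
      rw [hηx, hPx, inner_zero_right, mul_zero, zero_add] at h4
      exact (mul_eq_zero.1 h4).resolve_left (by exact_mod_cast (hdpos p.2).ne')
    have hxK : x ∈ K := by
      have := (Submodule.starProjection_apply_eq_zero_iff (K := Kᗮ) (v := x)).1 hPx
      rwa [Submodule.orthogonal_orthogonal] at this
    have hle : K ≤ (ℂ ∙ x)ᗮ := by
      rw [← hspan]
      refine Submodule.topologicalClosure_minimal _ ?_ (Submodule.isClosed_orthogonal _)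
      rw [Submodule.span_le]
      rintro _ ⟨p, rfl⟩
      rw [SetLike.mem_coe, Submodule.mem_orthogonal_singleton_iff_inner_left]
      exact h3 p
    have := hle hxK
    rw [Submodule.mem_orthogonal_singleton_iff_inner_left] at this
    exact inner_self_eq_zero.1 this
  · intro x
    change A x ∈ closure _
    refine mem_closure_of_tendsto (hA x) (Eventually.of_forall fun F => ?_)
    exact Submodule.sum_mem _ fun p _ => Submodule.smul_mem _ _ (Submodule.subset_span ⟨p, rfl⟩)
  · intro j
    have e0 : u (0, j) = g j := rfl
    refine (hA (g j)).unique ?_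
    have hz : ∀ p, ⟪v p, g j⟫_ℂ = d p.2 * ⟪u p, u (0, j)⟫_ℂ := by
      intro p
      rw [hvx, hηx, ← e0, hPu, inner_zero_right, mul_zero, zero_add]
    have h3 := hasSum_single (f := fun p => ⟪v p, g j⟫_ℂ • u p) (0, j) (by
      intro p hp
      rw [hz, hg.2 hp, mul_zero, zero_smul])
    convert h3 using 1
    rw [hz, inner_self_eq_norm_sq_to_K, hg.1, e0]
    simp
end

section
/- There exist a Banach space X and two bounded linear operators T₁, T₂ on X such that the pair (T₁, T₂) is d-frequently hypercyclic, but (T₁, T₂) is not densely d-hypercyclic: the set of d-hypercyclic vectors of (T₁, T₂) is not dense in X. -/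
open Filter Topology Set
open scoped Classical

namespace DFHC

lemma lowerDensity_pos_of_seq (A : Set ℕ) (φ : ℕ → ℕ) (hφ : StrictMono φ) (K : ℕ) (hK : 0 < K)
    (hb : ∀ m, φ m ≤ K * (m + 1)) (hA : ∀ m, φ m ∈ A) : 0 < lowerDensity A := by
  have hKr : (0 : ℝ) < K := by exact_mod_cast hK
  have key : ∀ N : ℕ, N / K ≤ ((Finset.Icc 1 N).filter (· ∈ A)).card + 1 := by
    intro N
    have h1 : ((Finset.Ico 1 (N / K)).image φ) ⊆ (Finset.Icc 1 N).filter (· ∈ A) := by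
      intro n hn
      simp only [Finset.mem_image, Finset.mem_Ico, Finset.mem_filter, Finset.mem_Icc] at hn ⊢
      obtain ⟨m, ⟨hm1, hm2⟩, rfl⟩ := hn
      refine ⟨⟨hm1.trans (hφ.id_le m), (hb m).trans ?_⟩, hA m⟩
      calc K * (m + 1) ≤ K * (N / K) := Nat.mul_le_mul_left _ hm2
        _ ≤ N := Nat.mul_div_le N K
    have h2 := Finset.card_le_card h1
    rw [Finset.card_image_of_injective _ hφ.injective, Nat.card_Ico] at h2
    omega
  have hev : ∀ᶠ N : ℕ in atTop, (1 / (2 * K) : ℝ) ≤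
      (((Finset.Icc 1 N).filter (· ∈ A)).card : ℝ) / N := by
    filter_upwards [eventually_ge_atTop (4 * K), eventually_gt_atTop 0] with N hN hN0
    have hNr : (0 : ℝ) < N := by exact_mod_cast hN0
    have h4 : (4 * K : ℝ) ≤ N := by exact_mod_cast hN
    rw [div_le_div_iff₀ (by positivity) hNr]
    have h3 : N < K * (N / K + 1) := by
      have := Nat.lt_mul_div_succ N hK
      simpa using this
    have h5 : N < K * (((Finset.Icc 1 N).filter (· ∈ A)).card + 2) :=
      h3.trans_le (Nat.mul_le_mul_left _ (by have := key N; omega))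
    have h6 : (N : ℝ) < K * ((((Finset.Icc 1 N).filter (· ∈ A)).card : ℝ) + 2) := by
      exact_mod_cast h5
    nlinarith
  have hbd : IsBoundedUnder (· ≤ ·) atTop
      (fun N : ℕ => (((Finset.Icc 1 N).filter (· ∈ A)).card : ℝ) / N) := by
    refine isBoundedUnder_of ⟨1, fun N => ?_⟩
    apply div_le_one_of_le₀ _ (by positivity)
    have := Finset.card_filter_le (Finset.Icc 1 N) (· ∈ A)
    rw [Nat.card_Icc] at this
    exact_mod_cast this
  have : (1 / (2 * K) : ℝ) ≤ lowerDensity A :=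
    le_liminf_of_le hbd.isCoboundedUnder_ge hev
  exact lt_of_lt_of_le (by positivity) this

/-- index of the word placed in block `i` -/
def idx (i : ℕ) : ℕ := padicValNat 2 (i + 1)

/-- starting position of the `i`-th word -/
def pos (i : ℕ) : ℕ := 2 * (∑ j ∈ Finset.range i, idx j) + i + idx i

lemma sum_idx (i : ℕ) : ∑ j ∈ Finset.range i, idx j ≤ i := by
  have h : ∑ j ∈ Finset.range i, idx j = padicValNat 2 (Nat.factorial i) := by
    induction i with
    | zero => simp
    | succ n ih =>
      rw [Finset.sum_range_succ, ih, Nat.factorial_succ,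
        padicValNat.mul (by omega) (Nat.factorial_ne_zero n), idx, add_comm]
  rw [h]
  have := sub_one_mul_padicValNat_factorial (p := 2) i
  omega

lemma pos_le (i : ℕ) : pos i ≤ 4 * (i + 1) := by
  have h := sum_idx (i + 1)
  have h' := sum_idx i
  rw [Finset.sum_range_succ] at h
  unfold pos
  omega

lemma pos_gap (i t : ℕ) : pos i + idx i + idx (i + t + 1) + t + 1 ≤ pos (i + t + 1) := by
  have h : ∑ j ∈ Finset.range i, idx j + idx i ≤ ∑ j ∈ Finset.range (i + t + 1), idx j := by
    rw [← Finset.sum_range_succ]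
    exact Finset.sum_le_sum_of_subset (Finset.range_mono (by omega))
  unfold pos
  omega

lemma pos_strictMono : StrictMono pos :=
  strictMono_nat_of_lt_succ fun n => by have := pos_gap n 0; simp at this; omega

lemma idx_eq (k m : ℕ) : idx (2 ^ k * (2 * m + 1) - 1) = k := by
  unfold idx
  have : 2 ^ k * (2 * m + 1) - 1 + 1 = 2 ^ k * (2 * m + 1) :=
    Nat.sub_add_cancel (Nat.mul_pos (by positivity) (by omega))
  rw [this, padicValNat.mul (by positivity) (by omega), padicValNat.prime_pow,
    padicValNat.eq_zero_of_not_dvd (by omega)]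
  simp

lemma half_bound (a : ℕ) : (1 / 2 : ℝ) ^ a * (a + 1) ≤ 1 := by
  have h : ((a + 1 : ℕ) : ℝ) ≤ 2 ^ a := by exact_mod_cast Nat.lt_two_pow_self
  rw [one_div, inv_pow, inv_mul_le_iff₀ (by positivity)]
  push_cast at h
  linarith

theorem exists_fhc {Y : Type*} [NormedAddCommGroup Y] [NormedSpace ℝ Y] [CompleteSpace Y]
    (T S : Y →L[ℝ] Y) (hTS : ∀ y, T (S y) = y) (hS : ∀ y, ‖S y‖ ≤ (1 / 2) * ‖y‖)
    (e : ℕ → Y) (he : DenseRange e) (hT : ∀ i, ∃ m, (T ^ m) (e i) = 0) :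
    ∃ x : Y, ∀ U : Set Y, IsOpen U → U.Nonempty → 0 < lowerDensity {n : ℕ | (T ^ n) x ∈ U} := by
  let w : ℕ → Y := fun k =>
    if ‖e (Nat.unpair k).1‖ ≤ k + 1 ∧ (T ^ k) (e (Nat.unpair k).1) = 0
      then e (Nat.unpair k).1 else 0
  have hw1 : ∀ k, ‖w k‖ ≤ k + 1 := by
    intro k
    simp only [w]
    split_ifs with h
    · exact h.1
    · simp; positivity
  have hTz : ∀ (m n : ℕ) (y : Y), m ≤ n → (T ^ m) y = 0 → (T ^ n) y = 0 := by
    intro m n y hmn h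
    obtain ⟨t, rfl⟩ := Nat.exists_eq_add_of_le' hmn
    rw [pow_add, mul_apply_eq_comp, h, map_zero]
  have hw2 : ∀ k n, k ≤ n → (T ^ n) (w k) = 0 := by
    intro k n hkn
    refine hTz k n _ hkn ?_
    simp only [w]
    split_ifs with h
    · exact h.2
    · simp
  have hSn : ∀ n y, ‖(S ^ n) y‖ ≤ (1 / 2) ^ n * ‖y‖ := by
    intro n
    induction n with
    | zero => intro y; simp
    | succ n ih =>
      intro y
      rw [pow_succ', mul_apply_eq_comp]
      calc _ ≤ (1 / 2) * ‖(S ^ n) y‖ := hS _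
        _ ≤ (1 / 2) * ((1 / 2) ^ n * ‖y‖) := by gcongr; exact ih y
        _ = _ := by ring
  have hTSn : ∀ n y, (T ^ n) ((S ^ n) y) = y := by
    intro n
    induction n with
    | zero => intro y; simp
    | succ n ih =>
      intro y
      rw [pow_succ T, pow_succ' S, mul_apply_eq_comp, mul_apply_eq_comp,
        hTS, ih]
  have hTS1 : ∀ m n y, (T ^ m) ((S ^ (m + n)) y) = (S ^ n) y := by
    intro m n y
    rw [pow_add, mul_apply_eq_comp, hTSn]
  have hTS2 : ∀ m n y, (T ^ (n + m)) ((S ^ m) y) = (T ^ n) y := by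
    intro m n y
    rw [pow_add, mul_apply_eq_comp, hTSn]
  have hpw : ∀ a b : ℕ, a ≤ b → (1 / 2 : ℝ) ^ b ≤ (1 / 2) ^ a := fun a b h =>
    pow_le_pow_of_le_one (by norm_num) (by norm_num) h
  -- norm estimate
  have hest : ∀ (c k n : ℕ), c + k ≤ n → ‖(S ^ n) (w k)‖ ≤ (1 / 2) ^ c := by
    intro c k n h
    calc ‖(S ^ n) (w k)‖ ≤ (1 / 2) ^ n * ‖w k‖ := hSn _ _
      _ ≤ (1 / 2) ^ (c + k) * (k + 1) := by
        exact mul_le_mul (hpw _ _ h) (hw1 k) (norm_nonneg _) (by positivity)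
      _ = (1 / 2) ^ c * ((1 / 2) ^ k * (k + 1)) := by ring
      _ ≤ (1 / 2) ^ c * 1 := by gcongr; exact half_bound k
      _ = _ := mul_one _
  have hgeo : Summable (fun i : ℕ => (1 / 2 : ℝ) ^ i) := summable_geometric_two
  let u : ℕ → Y := fun i => (S ^ (pos i)) (w (idx i))
  have hsum : Summable u :=
    Summable.of_norm_bounded hgeo fun i => hest i (idx i) (pos i) (by unfold pos; omega)
  refine ⟨∑' i, u i, fun U hU hUne => ?_⟩
  have hmain : ∀ i, ‖(T ^ (pos i)) (∑' i, u i) - w (idx i)‖ ≤ (1 / 2) ^ (idx i) := by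
    intro i
    rw [(T ^ (pos i)).map_tsum hsum]
    have hs' : Summable (fun j => (T ^ (pos i)) (u j)) := (T ^ (pos i)).summable hsum
    rw [← hs'.sum_add_tsum_nat_add (i + 1), Finset.sum_range_succ, Finset.sum_eq_zero]
    · have h1 : (T ^ (pos i)) (u i) = w (idx i) := hTSn _ _
      rw [h1, zero_add, add_sub_cancel_left]
      have h2 : HasSum (fun t : ℕ => (1 / 2 : ℝ) ^ (idx i + 1) * (1 / 2) ^ t)
          ((1 / 2 : ℝ) ^ (idx i + 1) * 2) := hasSum_geometric_two.mul_left _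
      have h3 : (1 / 2 : ℝ) ^ (idx i + 1) * 2 = (1 / 2) ^ idx i := by ring
      rw [h3] at h2
      refine tsum_of_norm_bounded h2 fun t => ?_
      have hg := pos_gap i t
      have e1 : t + (i + 1) = i + t + 1 := by omega
      rw [e1]
      obtain ⟨r, hr⟩ := Nat.exists_eq_add_of_le (show pos i ≤ pos (i + t + 1) by omega)
      have h4 : (T ^ (pos i)) (u (i + t + 1)) = (S ^ r) (w (idx (i + t + 1))) := by
        simp only [u]
        rw [hr, hTS1]
      rw [h4, ← pow_add]
      exact hest (idx i + 1 + t) (idx (i + t + 1)) r (by omega)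
    · intro j hj
      rw [Finset.mem_range] at hj
      obtain ⟨t, rfl⟩ := Nat.exists_eq_add_of_lt hj
      have hg := pos_gap j t
      obtain ⟨r, hr⟩ := Nat.exists_eq_add_of_le' (show pos j ≤ pos (j + t + 1) by omega)
      simp only [u]
      rw [hr, hTS2]
      exact hw2 (idx j) r (by omega)
  -- choose the word
  obtain ⟨i0, hi0⟩ := he.exists_mem_open hU hUne
  obtain ⟨r, hr, hball⟩ := Metric.isOpen_iff.1 hU _ hi0
  obtain ⟨m0, hm0⟩ := hT i0
  obtain ⟨n1, hn1⟩ := exists_pow_lt_of_lt_one hr (show (1 / 2 : ℝ) < 1 by norm_num)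
  obtain ⟨n2, hn2⟩ := exists_nat_ge ‖e i0‖
  set k := Nat.pair i0 (m0 + n1 + n2) with hk
  have hkge : m0 + n1 + n2 ≤ k := Nat.right_le_pair _ _
  have hwk : w k = e i0 := by
    simp only [w]
    rw [hk, Nat.unpair_pair, ← hk]
    rw [if_pos]
    refine ⟨?_, hTz m0 k _ (by omega) hm0⟩
    have : (n2 : ℝ) ≤ k := by exact_mod_cast (by omega : n2 ≤ k)
    simp only
    linarith
  refine lowerDensity_pos_of_seq _ (fun m => pos (2 ^ k * (2 * m + 1) - 1)) ?_ (8 * 2 ^ k)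
    (by positivity) ?_ ?_
  · refine pos_strictMono.comp ?_
    refine strictMono_nat_of_lt_succ fun m => ?_
    have h1 : 0 < 2 ^ k := by positivity
    have h2 : 2 ^ k * (2 * (m + 1) + 1) = 2 ^ k * (2 * m + 1) + 2 * 2 ^ k := by ring
    omega
  · intro m
    refine (pos_le _).trans ?_
    have h1 : 0 < 2 ^ k * (2 * m + 1) := Nat.mul_pos (by positivity) (by omega)
    rw [Nat.sub_add_cancel h1]
    nlinarith [show 0 < 2 ^ k by positivity]
  · intro m
    apply hball
    have := hmain (2 ^ k * (2 * m + 1) - 1)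
    rw [idx_eq, hwk] at this
    rw [Metric.mem_ball, dist_eq_norm]
    exact this.trans_lt ((hpw n1 k (by omega)).trans_lt hn1)

open scoped ZeroAtInfty

/-- the space `c₀` -/
abbrev C0 := C₀(ℕ, ℝ)

/-- build an element of `c₀` -/
def mkC0 (f : ℕ → ℝ) (hf : Tendsto f atTop (𝓝 0)) : C0 where
  toFun := f
  continuous_toFun := continuous_of_discreteTopology
  zero_at_infty' := by rwa [cocompact_eq_cofinite, Nat.cofinite_eq_atTop]

@[simp] lemma mkC0_apply (f : ℕ → ℝ) (hf) (n : ℕ) : mkC0 f hf n = f n := rfl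

lemma tendsto_C0 (f : C0) : Tendsto f atTop (𝓝 0) := by
  have := zero_at_infty f
  rwa [cocompact_eq_cofinite, Nat.cofinite_eq_atTop] at this

lemma norm_le_C0 {f : C0} {c : ℝ} (hc : 0 ≤ c) : ‖f‖ ≤ c ↔ ∀ n, |f n| ≤ c := by
  rw [← ZeroAtInftyContinuousMap.norm_toBCF_eq_norm, BoundedContinuousFunction.norm_le hc]
  rfl

lemma abs_le_norm_C0 (f : C0) (n : ℕ) : |f n| ≤ ‖f‖ := (norm_le_C0 (norm_nonneg f)).1 le_rfl n

/-- twice the backward shift -/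
noncomputable def T : C0 →L[ℝ] C0 :=
  LinearMap.mkContinuous
    { toFun := fun f => mkC0 (fun n => 2 * f (n + 1))
        (by simpa using ((tendsto_C0 f).comp (tendsto_add_atTop_nat 1)).const_mul 2)
      map_add' := by intro f g; ext n; simp [mul_add]
      map_smul' := by intro c f; ext n; simp; ring } 2
    (by
      intro f
      refine (norm_le_C0 (by positivity)).2 fun n => ?_
      have := abs_le_norm_C0 f (n + 1)
      simp [abs_mul, this])

@[simp] lemma T_apply (f : C0) (n : ℕ) : T f n = 2 * f (n + 1) := rfl

lemma T_pow_apply (k : ℕ) (f : C0) (n : ℕ) : (T ^ k) f n = 2 ^ k * f (n + k) := by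
  induction k generalizing f with
  | zero => simp
  | succ k ih =>
    rw [pow_succ, mul_apply_eq_comp, ih, T_apply, pow_succ, mul_assoc, add_assoc]

/-- half of the forward shift -/
noncomputable def S : C0 →L[ℝ] C0 :=
  LinearMap.mkContinuous
    { toFun := fun f => mkC0 (fun n => if n = 0 then 0 else (1 / 2) * f (n - 1))
        (by
          rw [← tendsto_add_atTop_iff_nat 1]
          simpa using (tendsto_C0 f).const_mul (2⁻¹ : ℝ))
      map_add' := by intro f g; ext n; by_cases h : n = 0 <;> simp [h, mul_add]
      map_smul' := by intro c f; ext n; by_cases h : n = 0 <;> simp [h]; ring } (1 / 2)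
    (by
      intro f
      refine (norm_le_C0 (by positivity)).2 fun n => ?_
      have := abs_le_norm_C0 f (n - 1)
      by_cases h : n = 0
      · simp [h]
      · simp [h, abs_mul, this])

lemma S_apply (f : C0) (n : ℕ) : S f n = if n = 0 then 0 else (1 / 2) * f (n - 1) := rfl

lemma S_norm (f : C0) : ‖S f‖ ≤ (1 / 2) * ‖f‖ :=
  LinearMap.mkContinuous_norm_le _ (by norm_num) _ |> fun h =>
    (S.le_opNorm f).trans (mul_le_mul_of_nonneg_right h (norm_nonneg f))

lemma T_S (f : C0) : T (S f) = f := by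
  ext n
  simp [S_apply]

/-- finitely supported rational sequences -/
noncomputable def fin (d : ℕ →₀ ℚ) : C0 := mkC0 (fun n => (d n : ℝ)) (by
  apply tendsto_const_nhds.congr'
  obtain ⟨N, hN⟩ := d.support.bddAbove
  filter_upwards [eventually_gt_atTop N] with n hn
  have : n ∉ d.support := fun h => absurd (hN h) (by omega)
  simp [Finsupp.notMem_support_iff.1 this])

lemma fin_T (d : ℕ →₀ ℚ) : ∃ N, ∀ m, N ≤ m → (T ^ m) (fin d) = 0 := by
  obtain ⟨N, hN⟩ := d.support.bddAbove
  refine ⟨N + 1, fun m hm => ?_⟩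
  ext n
  rw [T_pow_apply]
  have : n + m ∉ d.support := fun h => absurd (hN h) (by omega)
  simp [fin, Finsupp.notMem_support_iff.1 this]

lemma fin_dense : DenseRange fin := by
  rw [Metric.denseRange_iff]
  intro f r hr
  have h1 := (tendsto_C0 f).eventually (Metric.ball_mem_nhds 0 (half_pos hr))
  obtain ⟨N, hN⟩ := eventually_atTop.1 h1
  have h2 : ∀ n, ∃ q : ℚ, |f n - q| < r / 2 := fun n => exists_rat_near _ (half_pos hr)
  choose q hq using h2
  refine ⟨Finsupp.onFinset (Finset.range N) (fun n => if n < N then q n else 0) ?_, ?_⟩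
  · intro n hn
    by_contra h
    simp only [Finset.mem_range] at h
    simp [h] at hn
  · rw [dist_eq_norm]
    refine lt_of_le_of_lt ((norm_le_C0 (half_pos hr).le).2 fun n => ?_) (half_lt_self hr)
    simp only [ZeroAtInftyContinuousMap.sub_apply, fin, mkC0_apply, Finsupp.onFinset_apply]
    by_cases h : n < N
    · simpa [h] using (hq n).le
    · have := hN n (by omega)
      simp only [dist_zero_right, Real.norm_eq_abs] at this
      simpa [h] using this.le

lemma exists_pair : ∃ p : C0 × C0, ∀ O : Set (C0 × C0), IsOpen O → O.Nonempty →
    0 < lowerDensity {n : ℕ | ((T ^ n) p.1, (T ^ n) p.2) ∈ O} := by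
  obtain ⟨e, he⟩ := exists_surjective_nat ((ℕ →₀ ℚ) × (ℕ →₀ ℚ))
  have hpow : ∀ (n : ℕ) (p : C0 × C0), ((T.prodMap T) ^ n) p = ((T ^ n) p.1, (T ^ n) p.2) := by
    intro n
    induction n with
    | zero => intro p; simp
    | succ n ih => intro p; rw [pow_succ, mul_apply_eq_comp, ih, pow_succ]; rfl
  obtain ⟨x, hx⟩ := exists_fhc (T.prodMap T) (S.prodMap S)
    (by rintro ⟨a, b⟩; simp [T_S])
    (by
      rintro ⟨a, b⟩
      change max ‖S a‖ ‖S b‖ ≤ 1 / 2 * max ‖a‖ ‖b‖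
      apply max_le
      · exact (S_norm a).trans (by gcongr; exact le_max_left _ _)
      · exact (S_norm b).trans (by gcongr; exact le_max_right _ _))
    ((Prod.map fin fin) ∘ e)
    (by rw [DenseRange, he.range_comp]; exact fin_dense.prodMap fin_dense)
    (by
      intro i
      obtain ⟨N, hN⟩ := fin_T (e i).1
      obtain ⟨M, hM⟩ := fin_T (e i).2
      refine ⟨max N M, ?_⟩
      rw [hpow]
      exact Prod.ext (hN _ (le_max_left _ _)) (hM _ (le_max_right _ _)))
  refine ⟨x, fun O hO hne => ?_⟩
  have := hx O hO hne
  simpa only [hpow] using this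

/-- evaluation at a coordinate -/
noncomputable def ev (n : ℕ) : C0 →L[ℝ] ℝ :=
  LinearMap.mkContinuous
    { toFun := fun f => f n
      map_add' := fun _ _ => rfl
      map_smul' := fun _ _ => rfl } 1
    (by intro f; simpa using abs_le_norm_C0 f n)

@[simp] lemma ev_apply (n : ℕ) (f : C0) : ev n f = f n := rfl

/-- a vector dominating `y` with rapidly growing orbit -/
noncomputable def dom (y : C0) : C0 := mkC0 (fun n => √|y n| + (2 / 3) ^ n) (by
  have h1 : Tendsto (fun n => √|y n|) atTop (𝓝 0) := by
    have := (tendsto_C0 y).abs.sqrt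
    simpa using this
  have h2 : Tendsto (fun n : ℕ => (2 / 3 : ℝ) ^ n) atTop (𝓝 0) :=
    tendsto_pow_atTop_nhds_zero_of_lt_one (by norm_num) (by norm_num)
  simpa using h1.add h2)

lemma dom_growth (y : C0) (a b : ℝ) (hb : b ≠ 0) :
    ∀ᶠ n : ℕ in atTop, 1 ≤ |2 ^ n * (a * y n + b * dom y n)| := by
  have h1 : Tendsto (fun n => |a| * √|y n|) atTop (𝓝 0) := by
    have := (tendsto_C0 y).abs.sqrt.const_mul |a|
    simpa using this
  have hb' : 0 < |b| := abs_pos.2 hb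
  have h2 : Tendsto (fun n : ℕ => (4 / 3 : ℝ) ^ n) atTop atTop :=
    tendsto_pow_atTop_atTop_of_one_lt (by norm_num)
  filter_upwards [h1.eventually (gt_mem_nhds hb'), h2.eventually (eventually_ge_atTop (1 / |b|))]
    with n hn1 hn2
  rw [abs_mul, abs_of_pos (by positivity : (0 : ℝ) < 2 ^ n)]
  have hs : √|y n| * √|y n| = |y n| := Real.mul_self_sqrt (abs_nonneg _)
  have hsn := Real.sqrt_nonneg |y n|
  have h3 : |b| * (2 / 3) ^ n ≤ |a * y n + b * dom y n| := by
    have hd : |dom y n| = √|y n| + (2 / 3) ^ n := abs_of_nonneg (by simp only [dom, mkC0_apply]; positivity)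
    have := abs_sub_abs_le_abs_sub (b * dom y n) (-(a * y n))
    rw [abs_neg, abs_mul, abs_mul, hd, sub_neg_eq_add, add_comm (b * _)] at this
    have h5 : |a| * |y n| ≤ |b| * √|y n| := by
      have := mul_le_mul_of_nonneg_right hn1.le hsn
      rwa [mul_assoc, hs] at this
    linarith
  have h4 : (2 : ℝ) ^ n * (2 / 3) ^ n = (4 / 3) ^ n := by rw [← mul_pow]; norm_num
  calc (1 : ℝ) = |b| * (1 / |b|) := by field_simp
    _ ≤ |b| * (4 / 3) ^ n := by gcongr
    _ = 2 ^ n * (|b| * (2 / 3) ^ n) := by rw [← h4]; ring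
    _ ≤ _ := by gcongr

lemma not_dense_of_growth (u : ℕ → ℝ) (hu : ∀ᶠ n in atTop, 1 ≤ |u n|) : ¬ DenseRange u := by
  intro h
  obtain ⟨N, hN⟩ := eventually_atTop.1 hu
  have hfin : (u '' Set.Iio N).Finite := (Set.finite_Iio N).image u
  have hcl : IsClosed (u '' Set.Iio N ∪ {t : ℝ | 1 ≤ |t|}) :=
    hfin.isClosed.union (isClosed_le continuous_const continuous_abs)
  have hsub : Set.range u ⊆ u '' Set.Iio N ∪ {t : ℝ | 1 ≤ |t|} := by
    rintro _ ⟨n, rfl⟩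
    by_cases hn : n < N
    · exact Or.inl ⟨n, hn, rfl⟩
    · exact Or.inr (hN n (by omega))
  have huniv : ∀ t, t ∈ u '' Set.Iio N ∪ {t : ℝ | 1 ≤ |t|} := fun t =>
    closure_minimal hsub hcl (h t)
  refine (Set.Ioo_infinite (show (0 : ℝ) < 1 by norm_num)) (hfin.subset fun t ht => ?_)
  rcases huniv t with h | h
  · exact h
  · simp only [mem_ofPred_eq, abs_of_pos ht.1] at h
    exact absurd ht.2 (by linarith)

lemma exists_unit {E : Type*} [NormedAddCommGroup E] [NormedSpace ℝ E] [CompleteSpace E]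
    (R : E →L[ℝ] E) : ∃ c : ℝ, 0 < c ∧ ∃ L : (E →L[ℝ] E)ˣ,
      ∀ v, (L : E →L[ℝ] E) v = v + c • R v := by
  obtain ⟨c, hc0, hc⟩ : ∃ c : ℝ, 0 < c ∧ c * ‖R‖ < 1 := by
    refine ⟨1 / (‖R‖ + 1), by positivity, ?_⟩
    rw [one_div, inv_mul_lt_iff₀ (by positivity)]
    linarith
  have h : ‖-(c • R)‖ < 1 := by
    rwa [norm_neg, norm_smul, Real.norm_of_nonneg hc0.le]
  obtain ⟨L, hL⟩ := isUnit_one_sub_of_norm_lt_one h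
  refine ⟨c, hc0, L, fun v => ?_⟩
  rw [hL]
  simp

end DFHC

open DFHC

/-- There exist a Banach space `X` and bounded operators `T₁, T₂` on `X` such that
`(T₁,T₂)` is `d`-frequently hypercyclic, but the set of `d`-hypercyclic vectors of
`(T₁,T₂)` is not dense in `X`. -/
theorem exists_dFHC_pair_not_densely_dHC :
    ∃ (X : Type) (_ : NormedAddCommGroup X) (_ : NormedSpace ℝ X) (_ : CompleteSpace X)
      (T₁ T₂ : X →L[ℝ] X),
      (∃ x : X, ∀ U V : Set X, IsOpen U → U.Nonempty → IsOpen V → V.Nonempty →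
        0 < lowerDensity {n : ℕ | (T₁ ^ n) x ∈ U ∧ (T₂ ^ n) x ∈ V}) ∧
      ¬ Dense {x : X | Dense (Set.range fun n : ℕ => ((T₁ ^ n) x, (T₂ ^ n) x))} := by
  obtain ⟨⟨x, y⟩, hxy⟩ := exists_pair
  simp only at hxy
  have hx0 : x ≠ 0 := by
    rintro rfl
    have hempty : {n : ℕ | ((T ^ n) (0 : C0), (T ^ n) y) ∈ ({0}ᶜ : Set C0) ×ˢ (univ : Set C0)}
        = ∅ := by
      ext n
      simp
    have h := hxy (({0}ᶜ : Set C0) ×ˢ univ) (isOpen_compl_singleton.prod isOpen_univ)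
      ⟨(fin (Finsupp.single 0 1), 0), by
        refine ⟨fun h => ?_, mem_univ _⟩
        have := DFunLike.congr_fun (mem_singleton_iff.1 h) 0
        simp [fin] at this⟩
    rw [hempty] at h
    simp [lowerDensity] at h
  obtain ⟨i, hi⟩ : ∃ i, x i ≠ 0 := by
    by_contra! h
    exact hx0 (by ext n; simpa using h n)
  set z := dom y with hz
  let g : C0 →L[ℝ] ℝ := x i • ev (i + 1) - x (i + 1) • ev i
  have hgx : g x = 0 := by simp [g]; ring
  have hg0 : g (fin (Finsupp.single (i + 1) 1)) ≠ 0 := by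
    simpa [g, fin] using hi
  let R₀ : C0 →L[ℝ] C0 := (ev i).smulRight y + g.smulRight z
  obtain ⟨c, hc0, L, hL⟩ := exists_unit R₀
  have hLap : ∀ v : C0, (L : C0 →L[ℝ] C0) v = v + c • (v i • y + g v • z) := by
    intro v
    exact hL v
  have hLL : ∀ v : C0, (L : C0 →L[ℝ] C0) ((↑L⁻¹ : C0 →L[ℝ] C0) v) = v := by
    intro v
    rw [← mul_apply_eq_comp, L.mul_inv]; rfl
  have hLL' : ∀ v : C0, (↑L⁻¹ : C0 →L[ℝ] C0) ((L : C0 →L[ℝ] C0) v) = v := by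
    intro v
    rw [← mul_apply_eq_comp, L.inv_mul]; rfl
  let T₂ : C0 →L[ℝ] C0 := (↑L⁻¹ : C0 →L[ℝ] C0) * T * (L : C0 →L[ℝ] C0)
  have hT2 : ∀ (n : ℕ) (v : C0), (T₂ ^ n) v
      = (↑L⁻¹ : C0 →L[ℝ] C0) ((T ^ n) ((L : C0 →L[ℝ] C0) v)) := by
    intro n v
    simp only [T₂]
    rw [Units.conj_pow']
    rfl
  refine ⟨C0, inferInstance, inferInstance, inferInstance, T, T₂, ⟨x, ?_⟩, ?_⟩
  · intro U V hU ⟨u, hu⟩ hV ⟨v, hv⟩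
    have hci : c * x i ≠ 0 := mul_ne_zero hc0.ne' hi
    have hcont : Continuous fun p : C0 × C0 =>
        (↑L⁻¹ : C0 →L[ℝ] C0) (p.1 + (c * x i) • p.2) := by fun_prop
    have h := hxy (Prod.fst ⁻¹' U ∩ (fun p : C0 × C0 =>
        (↑L⁻¹ : C0 →L[ℝ] C0) (p.1 + (c * x i) • p.2)) ⁻¹' V)
      ((hU.preimage continuous_fst).inter (hV.preimage hcont))
      ⟨(u, (c * x i)⁻¹ • ((L : C0 →L[ℝ] C0) v - u)), hu, by
        simp only [mem_preimage]
        rw [smul_inv_smul₀ hci, add_sub_cancel, hLL']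
        exact hv⟩
    convert h using 3
    funext n
    simp only [mem_inter_iff, mem_preimage]
    rw [hT2, hLap, hgx, zero_smul, add_zero, map_add, map_smul, map_smul, smul_smul]
  · intro hd
    have hsub : {x : C0 | Dense (Set.range fun n : ℕ => ((T ^ n) x, (T₂ ^ n) x))}
        ⊆ {v | g v = 0} := by
      intro v hv
      by_contra hgv
      have hgv' : g v ≠ 0 := hgv
      let F : C0 × C0 → ℝ := fun p => ((L : C0 →L[ℝ] C0) p.2 - p.1) 0
      have hFc : Continuous F := by
        have : F = fun p => ev 0 ((L : C0 →L[ℝ] C0) p.2 - p.1) := rfl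
        rw [this]
        fun_prop
      have hFs : Function.Surjective F := by
        intro t
        refine ⟨(-(t • fin (Finsupp.single 0 1)), 0), ?_⟩
        simp [F, fin]
      have hdr : DenseRange (fun n : ℕ => F ((T ^ n) v, (T₂ ^ n) v)) :=
        hFs.denseRange.comp hv hFc
      refine not_dense_of_growth _ ?_ hdr
      have hgr := dom_growth y (c * v i) (c * g v) (mul_ne_zero hc0.ne' hgv')
      filter_upwards [hgr] with n hn
      convert hn using 2
      simp only [F]
      rw [hT2, hLL, ← map_sub, T_pow_apply, hLap]
      simp [hz]
      ring
    have hcl : IsClosed {v : C0 | g v = 0} := isClosed_eq g.continuous continuous_const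
    have := closure_minimal hsub hcl (hd (fin (Finsupp.single (i + 1) 1)))
    exact hg0 this
end
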